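/- arXiv:2604.19437 — 2 statements merged into one kernel-verified Lean document; each statement's English description precedes it below -/
import Mathlib

section
/- Let q be a positive definite integral quadratic form in 3 variables with Gram matrix M_q, and let Q be a positive definite integral quadratic form in 4 variables with Gram matrix M_Q. For every ε > 0 there is a constant C, depending only on Q and ε, such that the number of representations of q by Q, namely #{ X ∈ Mat_{4×3}(ℤ) : Xᵀ·M_Q·X = M_q }, is at most C · m_1(q) · m_2'(q) · disc(q)^ε. -/
open Matrix

noncomputable section

/-- `M` is the Gram matrix of a positive definite integral quadratic form in `n` variables. -/
def IsIntegralPosDefForm {n : ℕ} (M : Matrix (Fin n) (Fin n) ℚ) : Prop :=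
  M.IsSymm ∧ (∀ i, ∃ z : ℤ, M i i = z) ∧ (∀ i j, ∃ z : ℤ, 2 * M i j = z) ∧
    ∀ v : Fin n → ℚ, v ≠ 0 → 0 < v ⬝ᵥ M.mulVec v

/-- Gram determinant of the family `u` of integer vectors with respect to `M`. -/
def gramDet {nvar j : ℕ} (M : Matrix (Fin nvar) (Fin nvar) ℚ)
    (u : Fin j → Fin nvar → ℤ) : ℚ :=
  (Matrix.of fun a b =>
    (fun i => ((u a i : ℚ))) ⬝ᵥ M.mulVec fun i => ((u b i : ℚ))).det

/-- `k_1(p,q') + ⋯ + k_j(p,q')`: the minimum over all rank-`j` primitive sublattices `Λ`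
(of nonzero discriminant) of `ord_p(2^j·disc(q'|_Λ))`. -/
def kSum {nvar : ℕ} (M : Matrix (Fin nvar) (Fin nvar) ℚ) (j p0 : ℕ) : ℕ :=
  sInf {v : ℕ | ∃ u : Fin j → Fin nvar → ℤ,
    LinearIndependent ℤ u ∧
    (∀ w : Fin nvar → ℤ,
      (fun i => ((w i : ℚ))) ∈
          Submodule.span ℚ (Set.range fun a => fun i => ((u a i : ℚ))) →
        w ∈ Submodule.span ℤ (Set.range u)) ∧
    2 ^ j * gramDet M u ≠ 0 ∧
    (v : ℤ) = padicValRat p0 (2 ^ j * gramDet M u)}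

/-- `m1`, `m2` and `m2'` are the quantities `m_1(q)`, `m_2(q)` and `m_2'(q)`:
`m_j(q) = ∏_p p^(k_j(p,q))` is the positive rational determined by
`v_p(m_j) = k_j(p,q)` for all primes `p`, and `m_2'(q)` is the largest positive integer
whose square divides `m_2(q)`. -/
def IsM1M2M2' {nvar : ℕ} (Mq : Matrix (Fin nvar) (Fin nvar) ℚ)
    (m1 m2 : ℚ) (m2' : ℕ) : Prop :=
  0 < m1 ∧ (∀ p : ℕ, p.Prime → padicValRat p m1 = kSum Mq 1 p) ∧
    0 < m2 ∧
    (∀ p : ℕ, p.Prime → padicValRat p m2 = (kSum Mq 2 p : ℤ) - (kSum Mq 1 p : ℤ)) ∧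
    0 < m2' ∧ (∃ z : ℤ, m2 = (m2' : ℚ) ^ 2 * z) ∧
    ∀ k : ℕ, 0 < k → (∃ z : ℤ, m2 = (k : ℚ) ^ 2 * z) → k ≤ m2' 

theorem card_le_of_pairwise_dvd_sub {n l : ℕ} (hn : 0 < n) (hl : l ∣ n) (S : Finset ℕ)
    (hS : ∀ y ∈ S, y < n) (h : ∀ y ∈ S, ∀ z ∈ S, (l : ℤ) ∣ (y : ℤ) - z) :
    S.card ≤ n / l := by
  have hl0 : 0 < l := Nat.pos_of_dvd_of_pos hl hn
  have : S.card ≤ (Finset.range (n / l)).card := by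
    refine Finset.card_le_card_of_injOn (fun y => y / l) ?_ ?_
    · intro y hy
      have := hS y hy
      simp only [Finset.coe_range, Set.mem_Iio]
      exact Nat.div_lt_div_of_lt_of_dvd hl this
    · intro y hy z hz hyz
      have h1 := h y hy z hz
      have h2 : y % l = z % l := ((Nat.modEq_iff_dvd.2 h1).symm)
      have hyz' : y / l = z / l := hyz
      rw [← Nat.div_add_mod y l, ← Nat.div_add_mod z l, h2, hyz']
  simpa using this

/-- Counting square roots of `ν` modulo `n`, sorted by a factorization of `n`. -/
theorem card_sqrt_mod_le_sum {n : ℕ} (hn : 0 < n) (ν : ℤ) :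
    ((Finset.range n).filter fun y : ℕ => (n : ℤ) ∣ (y : ℤ) ^ 2 - ν).card ≤
      ∑ d ∈ n.divisors, if ((Nat.gcd d (n / d) : ℕ) : ℤ) ^ 2 ∣ 4 * ν
        then Nat.gcd d (n / d) else 0 := by
  classical
  set S := (Finset.range n).filter fun y : ℕ => (n : ℤ) ∣ (y : ℤ) ^ 2 - ν with hSdef
  rcases S.eq_empty_or_nonempty with h0 | ⟨y0, hy0⟩
  · rw [h0]; simp
  have hy0' : (n : ℤ) ∣ (y0 : ℤ) ^ 2 - ν := (Finset.mem_filter.1 hy0).2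
  let cell : ℕ → Finset ℕ := fun d =>
    S.filter fun y : ℕ => (d : ℤ) ∣ (y : ℤ) - y0 ∧ ((n / d : ℕ) : ℤ) ∣ (y : ℤ) + y0
  have hcover : S ⊆ n.divisors.biUnion cell := by
    intro y hy
    have hy' : (n : ℤ) ∣ (y : ℤ) ^ 2 - ν := (Finset.mem_filter.1 hy).2
    have h1 : (n : ℤ) ∣ ((y : ℤ) - y0) * ((y : ℤ) + y0) := by
      have := dvd_sub hy' hy0'
      exact this.trans (dvd_of_eq (by ring))
    obtain ⟨a, b, ha, hb, hab⟩ := exists_dvd_and_dvd_of_dvd_mul h1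
    have hn' : n = a.natAbs * b.natAbs := by
      rw [← Int.natAbs_mul, ← hab]; simp
    have ha0 : 0 < a.natAbs := Nat.pos_of_mul_pos_right (hn' ▸ hn)
    rw [Finset.mem_biUnion]
    refine ⟨a.natAbs, ?_, ?_⟩
    · rw [Nat.mem_divisors]
      exact ⟨⟨_, hn'⟩, hn.ne'⟩
    · refine Finset.mem_filter.2 ⟨hy, ?_, ?_⟩
      · exact Int.natAbs_dvd.2 ha
      · have : n / a.natAbs = b.natAbs := by
          rw [hn']; exact Nat.mul_div_cancel_left _ ha0
        rw [this]; exact Int.natAbs_dvd.2 hb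
  refine (Finset.card_le_card hcover).trans (Finset.card_biUnion_le.trans ?_)
  refine Finset.sum_le_sum fun d hd => ?_
  have hdn : d ∣ n := Nat.dvd_of_mem_divisors hd
  obtain ⟨d', hd'⟩ := hdn
  have hd0 : 0 < d := by rcases Nat.eq_zero_or_pos d with h | h; · subst h; simp at hd'; omega
                         exact h
  have hd2 : n / d = d' := by rw [hd']; exact Nat.mul_div_cancel_left _ hd0
  rcases (cell d).eq_empty_or_nonempty with hc | ⟨y, hy⟩
  · rw [hc]; simp
  obtain ⟨hyS, hy1, hy2⟩ := Finset.mem_filter.1 hy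
  rw [hd2] at hy2 ⊢
  have hg1 : ((Nat.gcd d d' : ℕ) : ℤ) ∣ d := by exact_mod_cast Nat.gcd_dvd_left d d'
  have hg2 : ((Nat.gcd d d' : ℕ) : ℤ) ∣ d' := by exact_mod_cast Nat.gcd_dvd_right d d'
  have hgy : ((Nat.gcd d d' : ℕ) : ℤ) ∣ 2 * y0 := by
    have := dvd_sub (hg2.trans hy2) (hg1.trans hy1)
    exact this.trans (dvd_of_eq (by ring))
  have hcond : ((Nat.gcd d d' : ℕ) : ℤ) ^ 2 ∣ 4 * ν := by
    have h1 : ((Nat.gcd d d' : ℕ) : ℤ) ^ 2 ∣ 4 * (y0 : ℤ) ^ 2 := by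
      have := pow_dvd_pow_of_dvd hgy 2
      exact this.trans (dvd_of_eq (by ring))
    have h2 : ((Nat.gcd d d' : ℕ) : ℤ) ^ 2 ∣ n := by
      rw [hd', sq]; push_cast; exact mul_dvd_mul hg1 hg2
    have := dvd_sub h1 ((h2.trans hy0').mul_left 4)
    exact this.trans (dvd_of_eq (by ring))
  rw [if_pos hcond]
  have hlcm : Nat.lcm d d' ∣ n := Nat.lcm_dvd ⟨d', hd'⟩ ⟨d, by rw [hd', mul_comm]⟩
  have hle := card_le_of_pairwise_dvd_sub hn hlcm (cell d)
    (fun y hy => Finset.mem_range.1 (Finset.mem_filter.1 (Finset.mem_filter.1 hy).1).1)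
    (fun y hy z hz => by
      obtain ⟨-, hy1, hy2⟩ := Finset.mem_filter.1 hy
      obtain ⟨-, hz1, hz2⟩ := Finset.mem_filter.1 hz
      rw [hd2] at hy2 hz2
      have h1 : (d : ℤ) ∣ (y : ℤ) - z := by
        have := dvd_sub hy1 hz1
        exact this.trans (dvd_of_eq (by ring))
      have h2 : (d' : ℤ) ∣ (y : ℤ) - z := by
        have := dvd_sub hy2 hz2
        exact this.trans (dvd_of_eq (by ring))
      rw [Int.natCast_dvd] at h1 h2 ⊢
      exact Nat.lcm_dvd h1 h2)
  refine hle.trans (le_of_eq ?_)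
  have hgl := Nat.gcd_mul_lcm d d'
  rw [← hd'] at hgl
  rw [← hgl]
  refine Nat.mul_div_cancel _ (Nat.lcm_pos hd0 ?_)
  rcases Nat.eq_zero_or_pos d' with h | h
  · subst h; simp at hd'; omega
  · exact h

theorem card_sqrt_mod_le {n : ℕ} (hn : 0 < n) (ν : ℤ) (B : ℕ)
    (hB : ∀ e : ℕ, e ^ 2 ∣ n → (e : ℤ) ^ 2 ∣ 4 * ν → e ≤ B) :
    ((Finset.range n).filter fun y : ℕ => (n : ℤ) ∣ (y : ℤ) ^ 2 - ν).card ≤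
      n.divisors.card * B := by
  refine (card_sqrt_mod_le_sum hn ν).trans ?_
  rw [← smul_eq_mul]
  refine Finset.sum_le_card_nsmul _ _ _ fun d hd => ?_
  split_ifs with h
  · refine hB _ ?_ h
    obtain ⟨d', hd'⟩ := Nat.dvd_of_mem_divisors hd
    have hd0 : 0 < d := Nat.pos_of_mem_divisors hd
    rw [hd', Nat.mul_div_cancel_left _ hd0, sq]
    exact mul_dvd_mul (Nat.gcd_dvd_left _ _) (Nat.gcd_dvd_right _ _)
  · exact Nat.zero_le _

theorem card_sqrt_mod_prime_pow_le {p : ℕ} (hp : p.Prime) (t : ℕ) (ν : ℤ) :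
    ((Finset.range (p ^ t)).filter fun y : ℕ => ((p : ℤ) ^ t) ∣ (y : ℤ) ^ 2 - ν).card ≤
      (t + 1) * p ^ (t / 2) := by
  have := card_sqrt_mod_le (n := p ^ t) (pow_pos hp.pos t) ν (p ^ (t / 2)) ?_
  · rw [Nat.divisors_prime_pow hp, Finset.card_map, Finset.card_range] at this
    simpa using this
  · intro e he _
    obtain ⟨j, hj, rfl⟩ := (Nat.dvd_prime_pow hp).1 ((dvd_pow_self e two_ne_zero).trans he)
    rw [← pow_mul] at he
    have := (Nat.pow_dvd_pow_iff_le_right hp.one_lt).1 he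
    exact Nat.pow_le_pow_right hp.pos (by omega)

/-- A factor `4` costs at most the square of a factor `p ^ k ≤ 2` in divisibility by powers
of `p`. -/
theorem exists_prime_pow_dvd_of_dvd_four_mul {p : ℕ} (hp : p.Prime) :
    ∃ k : ℕ, p ^ k ≤ 2 ∧ ∀ (i : ℕ) (z : ℤ), (p : ℤ) ^ i ∣ 4 * z → (p : ℤ) ^ (i - 2 * k) ∣ z := by
  by_cases h2 : p = 2
  · subst h2
    refine ⟨1, le_rfl, fun i z h => ?_⟩
    rcases le_or_gt i 2 with hi | hi
    · simp [Nat.sub_eq_zero_of_le hi]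
    · obtain ⟨j, rfl⟩ := Nat.exists_eq_add_of_le hi.le
      have h4 : ((2 : ℕ) : ℤ) ^ (2 + j) = 4 * 2 ^ j := by rw [pow_add]; norm_num
      rw [h4] at h
      have := Int.dvd_of_mul_dvd_mul_left (by norm_num) h
      simpa using this
  · refine ⟨0, by norm_num, fun i z h => ?_⟩
    have hc : IsCoprime ((p : ℤ) ^ i) 4 := by
      have : Nat.Coprime (p ^ i) (2 ^ 2) :=
        Nat.Coprime.pow _ _ ((Nat.coprime_primes hp Nat.prime_two).2 h2)
      have := Nat.isCoprime_iff_coprime.2 this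
      exact_mod_cast this
    simpa using hc.dvd_of_dvd_mul_left h

theorem card_sq_sub_sq_dvd_le {p : ℕ} (hp : p.Prime) {i s : ℕ} (hi : i ≤ s) (ν : ℤ) :
    ((Finset.range (p ^ s)).filter fun x : ℕ => (p : ℤ) ^ i ∣ (x : ℤ) ^ 2 - ν).card ≤
      p ^ (s - i) * ((i + 1) * p ^ (i / 2)) := by
  classical
  have hpi : 0 < p ^ i := pow_pos hp.pos i
  have hps : 0 < p ^ s := pow_pos hp.pos s
  refine (Finset.card_le_mul_card_image_of_maps_to (f := fun x => x % p ^ i)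
    (t := (Finset.range (p ^ i)).filter fun y : ℕ => ((p : ℤ) ^ i) ∣ (y : ℤ) ^ 2 - ν) ?_
    (p ^ (s - i))
    ?_).trans (Nat.mul_le_mul_left _ (card_sqrt_mod_prime_pow_le hp i ν))
  · intro x hx
    obtain ⟨hx1, hx2⟩ := Finset.mem_filter.1 hx
    refine Finset.mem_filter.2 ⟨Finset.mem_range.2 (Nat.mod_lt _ hpi), ?_⟩
    have h1 : ((p : ℤ) ^ i) ∣ (x : ℤ) - ((x % p ^ i : ℕ) : ℤ) := by
      push_cast
      exact Int.dvd_self_sub_emod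
    have h2 : ((p : ℤ) ^ i) ∣ (x : ℤ) ^ 2 - ((x % p ^ i : ℕ) : ℤ) ^ 2 := by
      rw [sq_sub_sq]; exact h1.mul_left _
    have := dvd_sub hx2 h2
    exact this.trans (dvd_of_eq (by ring))
  · intro b _
    have h := card_le_of_pairwise_dvd_sub (n := p ^ s) (l := p ^ i) hps (pow_dvd_pow p hi)
      (Finset.filter (fun x => x % p ^ i = b)
        ((Finset.range (p ^ s)).filter fun x : ℕ => (p : ℤ) ^ i ∣ (x : ℤ) ^ 2 - ν))
      (fun y hy => Finset.mem_range.1 (Finset.mem_filter.1 (Finset.mem_filter.1 hy).1).1)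
      (fun y hy z hz => by
        have h1 := (Finset.mem_filter.1 hy).2
        have h2 := (Finset.mem_filter.1 hz).2
        exact Nat.modEq_iff_dvd.1 (show z ≡ y [MOD p ^ i] from h2.trans h1.symm))
    rwa [Nat.pow_div hi hp.pos] at h

/-- The number of solutions of a diagonal binary quadratic congruence. -/
theorem card_binary_congruence_le {p : ℕ} (hp : p.Prime) {s t : ℕ} (hst : s ≤ t) {u : ℤ}
    (hu : ¬ (p : ℤ) ∣ u) (ν : ℤ) :
    ((Finset.range (p ^ s) ×ˢ Finset.range (p ^ t)).filter fun xy : ℕ × ℕ =>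
        (p : ℤ) ^ t ∣ u * (p : ℤ) ^ (t - s) * (xy.1 : ℤ) ^ 2 + (xy.2 : ℤ) ^ 2 - ν).card ≤
      2 * ((t + 1) * (s + 1)) * p ^ ((s + t) / 2) := by
  classical
  obtain ⟨k, hk2, hk⟩ := exists_prime_pow_dvd_of_dvd_four_mul hp
  have hpZ : Prime (p : ℤ) := Nat.prime_iff_prime_int.1 hp
  let μ : ℕ → ℤ := fun x => ν - u * (p : ℤ) ^ (t - s) * (x : ℤ) ^ 2
  have hfib : ((Finset.range (p ^ s) ×ˢ Finset.range (p ^ t)).filter fun xy : ℕ × ℕ =>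
        (p : ℤ) ^ t ∣ u * (p : ℤ) ^ (t - s) * (xy.1 : ℤ) ^ 2 + (xy.2 : ℤ) ^ 2 - ν).card =
      ∑ x ∈ Finset.range (p ^ s), ((Finset.range (p ^ t)).filter fun y : ℕ =>
        ((p ^ t : ℕ) : ℤ) ∣ (y : ℤ) ^ 2 - μ x).card := by
    rw [Finset.card_filter, Finset.sum_product]
    refine Finset.sum_congr rfl fun x _ => ?_
    rw [Finset.card_filter]
    refine Finset.sum_congr rfl fun y _ => ?_
    have : u * (p : ℤ) ^ (t - s) * (x : ℤ) ^ 2 + (y : ℤ) ^ 2 - ν = (y : ℤ) ^ 2 - μ x := by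
      simp only [μ]; ring
    simp only [this, Nat.cast_pow]
  rw [hfib]
  calc ∑ x ∈ Finset.range (p ^ s), ((Finset.range (p ^ t)).filter fun y : ℕ =>
        ((p ^ t : ℕ) : ℤ) ∣ (y : ℤ) ^ 2 - μ x).card
      ≤ ∑ x ∈ Finset.range (p ^ s), ∑ d ∈ (p ^ t).divisors,
          if ((Nat.gcd d (p ^ t / d) : ℕ) : ℤ) ^ 2 ∣ 4 * μ x
            then Nat.gcd d (p ^ t / d) else 0 :=
        Finset.sum_le_sum fun x _ => card_sqrt_mod_le_sum (pow_pos hp.pos t) (μ x)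
    _ = ∑ d ∈ (p ^ t).divisors, ∑ x ∈ Finset.range (p ^ s),
          if ((Nat.gcd d (p ^ t / d) : ℕ) : ℤ) ^ 2 ∣ 4 * μ x
            then Nat.gcd d (p ^ t / d) else 0 := Finset.sum_comm
    _ ≤ ∑ d ∈ (p ^ t).divisors, 2 * (s + 1) * p ^ ((s + t) / 2) := by
        refine Finset.sum_le_sum fun d hd => ?_
        obtain ⟨j, hj, rfl⟩ := (Nat.dvd_prime_pow hp).1 (Nat.dvd_of_mem_divisors hd)
        rw [Nat.pow_div hj hp.pos]
        obtain ⟨e, he, hegcd⟩ : ∃ e, 2 * e ≤ t ∧ Nat.gcd (p ^ j) (p ^ (t - j)) = p ^ e := by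
          rcases le_total j (t - j) with h | h
          · exact ⟨j, by omega, Nat.gcd_eq_left (pow_dvd_pow p h)⟩
          · exact ⟨t - j, by omega, Nat.gcd_eq_right (pow_dvd_pow p h)⟩
        rw [hegcd, ← Finset.sum_filter, Finset.sum_const, smul_eq_mul]
        set S := (Finset.range (p ^ s)).filter fun x : ℕ =>
          (((p ^ e : ℕ) : ℕ) : ℤ) ^ 2 ∣ 4 * μ x with hS
        rcases S.eq_empty_or_nonempty with h0 | ⟨x0, hx0⟩
        · rw [h0]; simp
        set i := 2 * e - (t - s) - 2 * k with hi
        have his : i ≤ s := by omega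
        have hSle : S.card ≤ p ^ (s - i) * ((i + 1) * p ^ (i / 2)) := by
          refine (Finset.card_le_card ?_).trans (card_sq_sub_sq_dvd_le hp his ((x0 : ℤ) ^ 2))
          intro x hx
          obtain ⟨hx1, hx2⟩ := Finset.mem_filter.1 hx
          refine Finset.mem_filter.2 ⟨hx1, ?_⟩
          have h1 := dvd_sub (Finset.mem_filter.1 hx0).2 hx2
          have h2 : (p : ℤ) ^ (2 * e) ∣
              4 * (u * ((p : ℤ) ^ (t - s) * ((x : ℤ) ^ 2 - (x0 : ℤ) ^ 2))) := by
            refine (dvd_of_eq ?_).trans (h1.trans (dvd_of_eq ?_))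
            · push_cast; ring
            · simp only [μ]; ring
          have h3 := hk _ _ h2
          have h4 : (p : ℤ) ^ (2 * e - 2 * k) ∣
              (p : ℤ) ^ (t - s) * ((x : ℤ) ^ 2 - (x0 : ℤ) ^ 2) :=
            hpZ.pow_dvd_of_dvd_mul_left _ hu h3
          rcases le_or_gt (2 * e - 2 * k) (t - s) with hle | hlt
          · have : i = 0 := by omega
            rw [this]; simp
          · have : 2 * e - 2 * k = (t - s) + i := by omega
            rw [this, pow_add] at h4
            exact Int.dvd_of_mul_dvd_mul_left (pow_ne_zero _ hpZ.ne_zero) h4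
        calc S.card * p ^ e ≤ p ^ (s - i) * ((i + 1) * p ^ (i / 2)) * p ^ e :=
              Nat.mul_le_mul_right _ hSle
          _ = (i + 1) * p ^ (s - i + i / 2 + e) := by rw [pow_add, pow_add]; ring
          _ ≤ (s + 1) * p ^ ((s + t) / 2 + k) :=
              Nat.mul_le_mul (by omega) (Nat.pow_le_pow_right hp.pos (by omega))
          _ = (s + 1) * (p ^ ((s + t) / 2) * p ^ k) := by rw [pow_add]
          _ ≤ (s + 1) * (p ^ ((s + t) / 2) * 2) := by gcongr
          _ = 2 * (s + 1) * p ^ ((s + t) / 2) := by ring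
    _ = 2 * ((t + 1) * (s + 1)) * p ^ ((s + t) / 2) := by
        rw [Finset.sum_const, Nat.divisors_prime_pow hp, Finset.card_map, Finset.card_range,
          smul_eq_mul]
        ring

/-- The divisor bound. -/
theorem exists_card_divisors_le_rpow {ε : ℝ} (hε : 0 < ε) :
    ∃ C : ℝ, 0 < C ∧ ∀ n : ℕ, n ≠ 0 → (n.divisors.card : ℝ) ≤ C * (n : ℝ) ^ ε := by
  have h2 : (1 : ℝ) < 2 ^ ε := Real.one_lt_rpow one_lt_two hε
  set b : ℝ := 2 ^ ε with hb
  set K : ℝ := max 1 (1 / (b - 1)) with hK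
  have hK1 : 1 ≤ K := le_max_left _ _
  have hK2 : 1 ≤ K * (b - 1) := by
    rw [← div_le_iff₀ (sub_pos.2 h2)]; exact le_max_right _ _
  obtain ⟨P, hP⟩ := exists_nat_ge ((2 : ℝ) ^ (1 / ε))
  have hsmall : ∀ v : ℕ, ((v + 1 : ℕ) : ℝ) ≤ K * b ^ v := by
    intro v
    have h := one_add_mul_le_pow (a := b - 1) (by linarith) v
    have h' : 1 + (v : ℝ) * (b - 1) ≤ b ^ v := by simpa using h
    have : K * (1 + (v : ℝ) * (b - 1)) ≤ K * b ^ v :=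
      mul_le_mul_of_nonneg_left h' (by linarith)
    push_cast
    nlinarith [mul_le_mul_of_nonneg_left hK2 (Nat.cast_nonneg (α := ℝ) v)]
  have hlocal : ∀ p : ℕ, p.Prime → ∀ v : ℕ,
      ((v + 1 : ℕ) : ℝ) ≤ (if p < P then K else 1) * ((p : ℝ) ^ v) ^ ε := by
    intro p hp v
    have hp2 : (2 : ℝ) ≤ p := by exact_mod_cast hp.two_le
    rw [← Real.rpow_natCast, ← Real.rpow_mul (by positivity), mul_comm (v : ℝ),
      Real.rpow_mul (by positivity), Real.rpow_natCast]
    split_ifs with hlt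
    · refine (hsmall v).trans ?_
      gcongr
      exact Real.rpow_le_rpow (by norm_num) hp2 hε.le
    · have h3 : (2 : ℝ) ≤ (p : ℝ) ^ ε := by
        have h4 : (2 : ℝ) ^ (1 / ε) ≤ p := hP.trans (by exact_mod_cast not_lt.1 hlt)
        have h5 := Real.rpow_le_rpow (by positivity) h4 hε.le
        rwa [← Real.rpow_mul (by norm_num), one_div, inv_mul_cancel₀ hε.ne', Real.rpow_one] at h5
      rw [one_mul]
      calc ((v + 1 : ℕ) : ℝ) ≤ (2 : ℝ) ^ v := by
            exact_mod_cast Nat.succ_le_of_lt (Nat.lt_two_pow_self (n := v))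
        _ ≤ _ := by gcongr
  refine ⟨K ^ P, by positivity, fun n hn => ?_⟩
  have hcast : (n : ℝ) ^ ε = ∏ p ∈ n.primeFactors, ((p : ℝ) ^ n.factorization p) ^ ε := by
    rw [Real.finsetProd_rpow _ _ (fun p _ => by positivity)]
    congr 1
    conv_lhs => rw [← Nat.prod_factorization_pow_eq_self hn]
    rw [Finsupp.prod, Nat.support_factorization]
    push_cast
    rfl
  rw [Nat.card_divisors hn, hcast]
  push_cast
  calc ∏ p ∈ n.primeFactors, ((n.factorization p : ℝ) + 1)
      ≤ ∏ p ∈ n.primeFactors,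
          ((if p < P then K else 1) * ((p : ℝ) ^ n.factorization p) ^ ε) :=
        Finset.prod_le_prod (fun p _ => by positivity) fun p hp => by
          exact_mod_cast hlocal p (Nat.prime_of_mem_primeFactors hp) _
    _ = (∏ p ∈ n.primeFactors, (if p < P then K else 1)) *
          ∏ p ∈ n.primeFactors, ((p : ℝ) ^ n.factorization p) ^ ε := Finset.prod_mul_distrib
    _ ≤ _ := by
        gcongr
        rw [Finset.prod_ite, Finset.prod_const, Finset.prod_const_one, mul_one]
        refine pow_le_pow_right₀ hK1 ?_
        calc (n.primeFactors.filter (· < P)).card ≤ (Finset.range P).card :=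
              Finset.card_le_card fun p hp => Finset.mem_range.2 (Finset.mem_filter.1 hp).2
          _ = P := Finset.card_range P

theorem det_fin_four_eq_schur (H : Matrix (Fin 4) (Fin 4) ℤ) (hH : H.IsSymm)
    (G : Matrix (Fin 3) (Fin 3) ℤ) (hG : H.submatrix Fin.castSucc Fin.castSucc = G)
    (r : Fin 3 → ℤ) (hr : ∀ i, H i.castSucc (Fin.last 3) = r i) :
    H.det = H (Fin.last 3) (Fin.last 3) * G.det - r ⬝ᵥ G.adjugate *ᵥ r := by
  have e1 : ∀ i j, H i j = H j i := fun i j => hH.apply j i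
  obtain rfl : (fun i : Fin 3 => H i.castSucc (Fin.last 3)) = r := funext hr
  subst hG
  have h30 := e1 3 0
  have h31 := e1 3 1
  have h32 := e1 3 2
  have h10 := e1 1 0
  have h20 := e1 2 0
  have h21 := e1 2 1
  rw [det_succ_row_zero, det_fin_three, adjugate_fin_three]
  simp only [Fin.sum_univ_four, det_fin_three, submatrix_apply, mulVec, dotProduct,
    Fin.sum_univ_three]
  simp [Fin.succAbove, Fin.lt_def, show Fin.last 3 = 3 from rfl, h30, h31, h32, h10, h20, h21]
  ring

theorem adjugate_form_add {G : Matrix (Fin 3) (Fin 3) ℤ} (hG : G.IsSymm) (k : ℤ)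
    (r v : Fin 3 → ℤ) :
    (k • r + G *ᵥ v) ⬝ᵥ G.adjugate *ᵥ (k • r + G *ᵥ v) =
      k ^ 2 * (r ⬝ᵥ G.adjugate *ᵥ r) + G.det * (2 * k * (r ⬝ᵥ v) + v ⬝ᵥ G *ᵥ v) := by
  have h1 : G.adjugate *ᵥ (G *ᵥ v) = G.det • v := by
    rw [mulVec_mulVec, adjugate_mul, smul_mulVec, one_mulVec]
  have h2 : (G *ᵥ v) ⬝ᵥ G.adjugate *ᵥ r = G.det * (r ⬝ᵥ v) := by
    rw [dotProduct_mulVec, ← mulVec_transpose, adjugate_transpose, hG.eq, h1, smul_dotProduct,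
      smul_eq_mul, dotProduct_comm]
  simp only [mulVec_add, mulVec_smul, h1, add_dotProduct, dotProduct_add, smul_dotProduct,
    dotProduct_smul, h2, smul_eq_mul]
  rw [dotProduct_comm (G *ᵥ v) v]
  ring

/-- The unipotent matrix adding the combination `w` of the first three columns to the last. -/
def shearLast (w : Fin 3 → ℤ) : Matrix (Fin 4) (Fin 4) ℤ :=
  !![1, 0, 0, w 0; 0, 1, 0, w 1; 0, 0, 1, w 2; 0, 0, 0, 1]

theorem det_shearLast (w : Fin 3 → ℤ) : (shearLast w).det = 1 := by
  simp [shearLast, det_succ_row_zero, Fin.sum_univ_succ]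

theorem mul_shearLast_castSucc (T : Matrix (Fin 4) (Fin 4) ℤ) (w : Fin 3 → ℤ) :
    (T * shearLast w).submatrix id Fin.castSucc = T.submatrix id Fin.castSucc := by
  ext i j
  fin_cases j <;> simp [Matrix.mul_apply, Fin.sum_univ_four, shearLast]

theorem gram_shearLast_last {H : Matrix (Fin 4) (Fin 4) ℤ} (w : Fin 3 → ℤ) (i : Fin 3) :
    ((shearLast w)ᵀ * H * shearLast w) i.castSucc (Fin.last 3) =
      H i.castSucc (Fin.last 3) + (H.submatrix Fin.castSucc Fin.castSucc *ᵥ w) i := by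
  fin_cases i <;>
  simp [Matrix.mul_apply, Fin.sum_univ_four, shearLast, mulVec, dotProduct, Fin.sum_univ_three,
    show Fin.last 3 = 3 from rfl] <;> ring

theorem submatrix_gram {A : Matrix (Fin 4) (Fin 4) ℤ} (T : Matrix (Fin 4) (Fin 4) ℤ) :
    (Tᵀ * A * T).submatrix Fin.castSucc Fin.castSucc =
      (T.submatrix id Fin.castSucc)ᵀ * A * T.submatrix id Fin.castSucc := by
  ext i j
  simp [Matrix.mul_apply]

theorem det_gram_of_isUnit {A T : Matrix (Fin 4) (Fin 4) ℤ} (hT : IsUnit T.det) :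
    (Tᵀ * A * T).det = A.det := by
  rw [det_mul, det_mul, det_transpose]
  rcases Int.isUnit_iff.1 hT with h | h <;> rw [h] <;> ring

theorem eq_of_blocks_eq {H H' : Matrix (Fin 4) (Fin 4) ℤ} (hH : H.IsSymm) (hH' : H'.IsSymm)
    (hG : H.submatrix Fin.castSucc Fin.castSucc = H'.submatrix Fin.castSucc Fin.castSucc)
    (hr : ∀ i : Fin 3, H i.castSucc (Fin.last 3) = H' i.castSucc (Fin.last 3))
    (hdet : H.det = H'.det) (h0 : (H.submatrix Fin.castSucc Fin.castSucc).det ≠ 0) : H = H' := by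
  have h1 := det_fin_four_eq_schur H hH _ rfl _ hr
  have h2 := det_fin_four_eq_schur H' hH' _ hG.symm _ (fun _ => rfl)
  have h3 : H (Fin.last 3) (Fin.last 3) = H' (Fin.last 3) (Fin.last 3) :=
    mul_right_cancel₀ h0 (by linarith)
  ext i j
  induction i using Fin.lastCases with
  | last =>
    induction j using Fin.lastCases with
    | last => exact h3
    | cast j => rw [← hH.apply, ← hH'.apply]; exact hr j
  | cast i =>
    induction j using Fin.lastCases with
    | last => exact hr i
    | cast j => exact congrFun (congrFun hG i) j

theorem isSymm_gram {m n : Type*} [Fintype m] {A : Matrix m m ℤ} (hA : A.IsSymm)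
    (T : Matrix m n ℤ) : (Tᵀ * A * T).IsSymm := by
  rw [IsSymm, transpose_mul, transpose_mul, transpose_transpose, hA.eq, Matrix.mul_assoc]

/-- Two bases of `ℤ⁴` whose first three vectors have the same Gram matrix `G`, and whose last
vectors have scalar products with them differing by an element of `G ℤ³`, are related by an
automorph of the form. -/
theorem exists_automorph_mul_eq {A T T' : Matrix (Fin 4) (Fin 4) ℤ} (hA : A.IsSymm)
    {G : Matrix (Fin 3) (Fin 3) ℤ} (hG0 : G.det ≠ 0) (hT : IsUnit T.det) (hT' : IsUnit T'.det)
    (hG : (Tᵀ * A * T).submatrix Fin.castSucc Fin.castSucc = G)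
    (hG' : (T'ᵀ * A * T').submatrix Fin.castSucc Fin.castSucc = G) (w : Fin 3 → ℤ)
    (hw : ∀ i : Fin 3, (Tᵀ * A * T) i.castSucc (Fin.last 3) =
      (T'ᵀ * A * T') i.castSucc (Fin.last 3) + (G *ᵥ w) i) :
    ∃ h : Matrix (Fin 4) (Fin 4) ℤ, hᵀ * A * h = A ∧
      h * T'.submatrix id Fin.castSucc = T.submatrix id Fin.castSucc := by
  set U := T' * shearLast w with hU
  have hUdet : IsUnit U.det := by rw [hU, det_mul, det_shearLast, mul_one]; exact hT'
  have hUgram : Uᵀ * A * U = (shearLast w)ᵀ * (T'ᵀ * A * T') * shearLast w := by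
    rw [hU, transpose_mul]; simp only [Matrix.mul_assoc]
  have hUsub : U.submatrix id Fin.castSucc = T'.submatrix id Fin.castSucc :=
    mul_shearLast_castSucc T' w
  have hUG : (Uᵀ * A * U).submatrix Fin.castSucc Fin.castSucc = G := by
    rw [submatrix_gram, hUsub, ← submatrix_gram, hG']
  have hEq : Tᵀ * A * T = Uᵀ * A * U := by
    refine eq_of_blocks_eq (isSymm_gram hA T) (isSymm_gram hA U) (hG.trans hUG.symm) ?_ ?_ ?_
    · intro i
      rw [hw, hUgram, gram_shearLast_last, hG']
    · rw [det_gram_of_isUnit hT, det_gram_of_isUnit hUdet]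
    · rwa [hG]
  have hUi : U * U⁻¹ = 1 := mul_nonsing_inv U hUdet
  refine ⟨T * U⁻¹, ?_, ?_⟩
  · calc (T * U⁻¹)ᵀ * A * (T * U⁻¹) = (U⁻¹)ᵀ * (Tᵀ * A * T) * U⁻¹ := by
          rw [transpose_mul]; simp only [Matrix.mul_assoc]
      _ = (U * U⁻¹)ᵀ * A * (U * U⁻¹) := by
          rw [hEq, transpose_mul U]; simp only [Matrix.mul_assoc]
      _ = A := by rw [hUi, transpose_one, Matrix.one_mul, Matrix.mul_one]
  · rw [← hUsub]
    have : T * U⁻¹ * U = T := by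
      rw [Matrix.mul_assoc, nonsing_inv_mul U hUdet, Matrix.mul_one]
    conv_rhs => rw [← this]
    ext i j
    simp [Matrix.mul_apply]

theorem exists_sqrt_mod_mul_add {H H₀ : Matrix (Fin 4) (Fin 4) ℤ} (hH : H.IsSymm)
    (hH₀ : H₀.IsSymm) {G : Matrix (Fin 3) (Fin 3) ℤ} {c : ℤ} {n : ℕ} (hn : 0 < n)
    (hGn : G.det = n) (hG : H.submatrix Fin.castSucc Fin.castSucc = G)
    (hG₀ : H₀.submatrix Fin.castSucc Fin.castSucc = G) (hc : H.det = c) (hc₀ : H₀.det = c)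
    (r r₀ : Fin 3 → ℤ) (hr : ∀ i, H i.castSucc (Fin.last 3) = r i)
    (hr₀ : ∀ i, H₀ i.castSucc (Fin.last 3) = r₀ i) :
    ∃ K : ℕ, K < n ∧ (n : ℤ) ∣ (K : ℤ) ^ 2 - c ^ 4 ∧
      ∃ z : Fin 3 → ℤ, c ^ 2 • r = (K : ℤ) • r₀ + G *ᵥ z := by
  have hGs : G.IsSymm := by rw [← hG]; exact hH.submatrix _
  set x : Fin 4 → ℤ := H₀.adjugate *ᵥ Fin.snoc (α := fun _ => ℤ) r 0 with hx
  set v : Fin 3 → ℤ := fun i => x i.castSucc with hv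
  set k : ℤ := x (Fin.last 3) with hk
  have hx' : H₀ *ᵥ x = c • Fin.snoc (α := fun _ => ℤ) r 0 := by
    rw [hx, mulVec_mulVec, mul_adjugate, smul_mulVec, one_mulVec, hc₀]
  have hcr : c • r = k • r₀ + G *ᵥ v := by
    ext i
    have h := congrFun hx' i.castSucc
    simp only [mulVec, dotProduct, Pi.smul_apply, smul_eq_mul, Fin.snoc_castSucc] at h
    rw [Fin.sum_univ_castSucc] at h
    simp only [Pi.smul_apply, Pi.add_apply, smul_eq_mul, mulVec, dotProduct, ← h, hr₀, ← hG₀,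
      submatrix_apply, hv, hk]
    ring
  have hn0 : (n : ℤ) ≠ 0 := by exact_mod_cast hn.ne'
  have hs := det_fin_four_eq_schur H hH G hG r hr
  have hs₀ := det_fin_four_eq_schur H₀ hH₀ G hG₀ r₀ hr₀
  have hform := adjugate_form_add hGs k r₀ v
  rw [← hcr] at hform
  simp only [mulVec_smul, smul_dotProduct, dotProduct_smul, smul_eq_mul] at hform
  have hdvd : (n : ℤ) ∣ (c * k) ^ 2 - c ^ 4 := by
    rw [← hGn]
    refine ⟨c * (2 * k * (r₀ ⬝ᵥ v) + v ⬝ᵥ G *ᵥ v) -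
      c ^ 3 * H (Fin.last 3) (Fin.last 3) + c * k ^ 2 * H₀ (Fin.last 3) (Fin.last 3), ?_⟩
    rw [hc] at hs
    rw [hc₀] at hs₀
    linear_combination c * hform - c ^ 3 * hs + c * k ^ 2 * hs₀
  have hK0 : 0 ≤ (c * k) % n := Int.emod_nonneg _ hn0
  refine ⟨((c * k) % n).toNat, ?_, ?_, (c * k / n) • G.adjugate *ᵥ r₀ + c • v, ?_⟩
  · zify
    rw [Int.toNat_of_nonneg hK0]
    exact Int.emod_lt_of_pos _ (by exact_mod_cast hn)
  · rw [Int.toNat_of_nonneg hK0]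
    have h1 : (n : ℤ) ∣ ((c * k) % n) ^ 2 - (c * k) ^ 2 := by
      rw [sq_sub_sq]
      refine Dvd.dvd.mul_left ?_ _
      exact ⟨-(c * k / n), by linarith [Int.emod_add_mul_ediv (c * k) n]⟩
    exact (dvd_add h1 hdvd).trans (dvd_of_eq (by ring))
  · rw [Int.toNat_of_nonneg hK0, mulVec_add, mulVec_smul, mulVec_mulVec, mul_adjugate,
      smul_mulVec, one_mulVec, mulVec_smul, hGn]
    have h2 : c ^ 2 • r = c • (c • r) := by rw [smul_smul, sq]
    rw [h2, hcr, smul_add, smul_smul, smul_smul, ← add_assoc, ← add_smul]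
    congr 2
    linarith [Int.emod_add_mul_ediv (c * k) n]

/-- The number of primitive representations of a ternary form of determinant `n` by a fixed
quaternary form with finitely many automorphs is bounded by a multiple of the number of divisors
of `n`. -/
theorem card_primitive_representations_le {A : Matrix (Fin 4) (Fin 4) ℤ} (hA : A.IsSymm)
    (hdet : A.det ≠ 0) (O : Finset (Matrix (Fin 4) (Fin 4) ℤ))
    (hO : ∀ h : Matrix (Fin 4) (Fin 4) ℤ, hᵀ * A * h = A → h ∈ O)
    {G : Matrix (Fin 3) (Fin 3) ℤ} {n : ℕ} (hn : 0 < n) (hGn : G.det = n)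
    (F : Finset (Matrix (Fin 4) (Fin 3) ℤ))
    (hF : ∀ Y ∈ F, Yᵀ * A * Y = G ∧
      ∃ T : Matrix (Fin 4) (Fin 4) ℤ, IsUnit T.det ∧ T.submatrix id Fin.castSucc = Y) :
    F.card ≤ O.card * (n.divisors.card * (2 * A.det.natAbs ^ 2) * (A.det.natAbs ^ 2) ^ 3) := by
  classical
  set c := A.det with hc
  rcases F.eq_empty_or_nonempty with h0 | ⟨Y₀, hY₀⟩
  · rw [h0]; simp
  choose! hYG T hT hTY using hF
  have hsub : ∀ Y ∈ F, ((T Y)ᵀ * A * T Y).submatrix Fin.castSucc Fin.castSucc = G :=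
    fun Y hY => by rw [submatrix_gram, hTY Y hY, hYG Y hY]
  have key : ∀ Y ∈ F, ∃ K : ℕ, K < n ∧ (n : ℤ) ∣ (K : ℤ) ^ 2 - c ^ 4 ∧
      ∃ z : Fin 3 → ℤ, c ^ 2 • (fun i : Fin 3 => ((T Y)ᵀ * A * T Y) i.castSucc (Fin.last 3)) =
        (K : ℤ) • (fun i : Fin 3 => ((T Y₀)ᵀ * A * T Y₀) i.castSucc (Fin.last 3)) + G *ᵥ z :=
    fun Y hY => exists_sqrt_mod_mul_add (isSymm_gram hA _) (isSymm_gram hA _) hn hGn (hsub Y hY)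
      (hsub Y₀ hY₀) (det_gram_of_isUnit (hT Y hY)) (det_gram_of_isUnit (hT Y₀ hY₀)) _ _
      (fun _ => rfl) (fun _ => rfl)
  choose! K hKn hKd z hz using key
  set b := c.natAbs ^ 2 with hb
  have hbc : (b : ℤ) = c ^ 2 := by rw [hb]; push_cast; exact sq_abs c
  have hc2 : c ^ 2 ≠ 0 := pow_ne_zero _ hdet
  have hb0 : (b : ℤ) ≠ 0 := by rw [hbc]; exact hc2
  set keys : Finset (ℕ × (Fin 3 → ℕ)) :=
    ((Finset.range n).filter fun y : ℕ => (n : ℤ) ∣ (y : ℤ) ^ 2 - c ^ 4) ×ˢ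
      Fintype.piFinset fun _ => Finset.range b with hkeys
  have hkeycard : keys.card ≤ n.divisors.card * (2 * b) * b ^ 3 := by
    rw [hkeys, Finset.card_product, Fintype.card_piFinset]
    simp only [Finset.card_range, Finset.prod_const, Finset.card_univ, Fintype.card_fin]
    refine Nat.mul_le_mul_right _ (card_sqrt_mod_le hn _ _ fun e _ he => ?_)
    have h1 : (e : ℤ) ^ 2 ∣ (2 * c ^ 2) ^ 2 := he.trans (dvd_of_eq (by ring))
    have h2 : (e : ℤ) ∣ ((2 * b : ℕ) : ℤ) := by
      push_cast
      rw [hbc]; exact (Int.pow_dvd_pow_iff two_ne_zero).1 h1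
    refine Nat.le_of_dvd ?_ (by exact_mod_cast h2)
    have : 0 < c.natAbs := Int.natAbs_pos.2 hdet
    positivity
  refine (Finset.card_le_mul_card_image_of_maps_to (t := keys)
    (f := fun Y => (K Y, fun i => (z Y i % b).toNat)) ?_ O.card ?_).trans
      (Nat.mul_le_mul_left _ hkeycard)
  · intro Y hY
    refine Finset.mem_product.2 ⟨Finset.mem_filter.2
      ⟨Finset.mem_range.2 (hKn Y hY), hKd Y hY⟩, Fintype.mem_piFinset.2 fun i => ?_⟩
    rw [Finset.mem_range]
    zify
    rw [Int.toNat_of_nonneg (Int.emod_nonneg _ hb0)]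
    exact Int.emod_lt_of_pos _ (by omega)
  · intro q _
    rcases (F.filter fun Y => (K Y, fun i => (z Y i % b).toNat) = q).eq_empty_or_nonempty
      with h0 | ⟨Y', hY'⟩
    · rw [h0]; simp
    obtain ⟨hY'F, hY'q⟩ := Finset.mem_filter.1 hY'
    refine (Finset.card_le_card (t := O.image fun h => h * Y') fun Y hY => ?_).trans
      Finset.card_image_le
    obtain ⟨hYF, hYq⟩ := Finset.mem_filter.1 hY
    have hq := hYq.trans hY'q.symm
    rw [Prod.mk.injEq] at hq
    have hdiv : ∀ i, ∃ w : ℤ, z Y i - z Y' i = c ^ 2 * w := fun i => by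
      have h1 := congrArg (Int.ofNat) (congrFun hq.2 i)
      simp only [Int.ofNat_eq_natCast] at h1
      rw [Int.toNat_of_nonneg (Int.emod_nonneg _ hb0),
        Int.toNat_of_nonneg (Int.emod_nonneg _ hb0)] at h1
      rw [← hbc]
      exact Int.ModEq.dvd (show z Y' i ≡ z Y i [ZMOD b] from h1.symm)
    choose w hw using hdiv
    obtain ⟨h, hhA, hh⟩ := exists_automorph_mul_eq (T := T Y) (T' := T Y') hA
      (by rw [hGn]; exact_mod_cast hn.ne') (hT Y hYF) (hT Y' hY'F) (hsub Y hYF) (hsub Y' hY'F) w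
      (fun i => by
        have e1 := congrFun (hz Y hYF) i
        have e2 := congrFun (hz Y' hY'F) i
        have e3 : G *ᵥ z Y = G *ᵥ z Y' + c ^ 2 • G *ᵥ w := by
          rw [← mulVec_smul, ← mulVec_add]
          congr 1
          ext j
          simp only [Pi.add_apply, Pi.smul_apply, smul_eq_mul]
          linarith [hw j]
        have e4 := congrFun e3 i
        simp only [Pi.add_apply, Pi.smul_apply, smul_eq_mul] at e1 e2 e4
        rw [hq.1] at e1
        refine mul_left_cancel₀ hc2 ?_
        linarith)
    rw [hTY Y hYF, hTY Y' hY'F] at hh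
    exact Finset.mem_image.2 ⟨h, hO h hhA, hh⟩

/-- Cauchy-Schwarz bound: an integral form that is positive on nonzero integer vectors takes
bounded values only finitely often. -/
theorem finite_setOf_quadratic_le {n : ℕ} {A : Matrix (Fin n) (Fin n) ℤ} (hA : A.IsSymm)
    (hpos : ∀ v : Fin n → ℤ, v ≠ 0 → 0 < v ⬝ᵥ A *ᵥ v) (hdet : A.det ≠ 0) (N : ℤ) :
    {v : Fin n → ℤ | v ⬝ᵥ A *ᵥ v ≤ N}.Finite := by
  have hnonneg : ∀ v : Fin n → ℤ, 0 ≤ v ⬝ᵥ A *ᵥ v := fun v => by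
    rcases eq_or_ne v 0 with rfl | h
    · simp
    · exact (hpos v h).le
  set u : Fin n → Fin n → ℤ := fun i => A.adjugate *ᵥ Pi.single i 1 with hu
  have hAu : ∀ i, A *ᵥ u i = A.det • Pi.single i 1 := fun i => by
    rw [hu, mulVec_mulVec, mul_adjugate, smul_mulVec, one_mulVec]
  have hbound : ∀ v : Fin n → ℤ, v ⬝ᵥ A *ᵥ v ≤ N → ∀ i, |v i| ≤ (u i ⬝ᵥ A *ᵥ u i) * N := by
    intro v hv i
    set a := u i ⬝ᵥ A *ᵥ u i with ha
    have hui : u i ≠ 0 := fun h => by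
      have h1 := congrFun (hAu i) i
      rw [h, mulVec_zero] at h1
      simp at h1
      exact hdet h1.symm
    have ha0 : 0 < a := hpos _ hui
    have hvu : v ⬝ᵥ A *ᵥ u i = A.det * v i := by
      rw [hAu, dotProduct_smul, smul_eq_mul, dotProduct_single, mul_one]
    have huv : u i ⬝ᵥ A *ᵥ v = A.det * v i := by
      rw [dotProduct_mulVec, ← mulVec_transpose, hA.eq, dotProduct_comm, hvu]
    have h := hnonneg (a • v - (A.det * v i) • u i)
    have hexp : (a • v - (A.det * v i) • u i) ⬝ᵥ A *ᵥ (a • v - (A.det * v i) • u i) =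
        a * (a * (v ⬝ᵥ A *ᵥ v) - (A.det * v i) ^ 2) := by
      simp only [mulVec_sub, mulVec_smul, sub_dotProduct, dotProduct_sub, smul_dotProduct,
        dotProduct_smul, smul_eq_mul, hvu, huv, ← ha]
      ring
    rw [hexp] at h
    have h2 : 0 ≤ a * (v ⬝ᵥ A *ᵥ v) - (A.det * v i) ^ 2 := nonneg_of_mul_nonneg_right h ha0
    have h3 : v i ^ 2 ≤ (A.det * v i) ^ 2 := by
      rw [mul_pow]
      have : 0 < A.det ^ 2 := by positivity
      nlinarith [sq_nonneg (v i)]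
    have h4 : |v i| ≤ v i ^ 2 := by
      rw [← sq_abs]
      rcases eq_or_ne (v i) 0 with h | h
      · simp [h]
      · nlinarith [Int.one_le_abs h]
    nlinarith
  refine (Set.Finite.pi fun i : Fin n =>
    Set.finite_Icc (-((u i ⬝ᵥ A *ᵥ u i) * N)) ((u i ⬝ᵥ A *ᵥ u i) * N)).subset ?_
  intro v hv i _
  exact abs_le.1 (hbound v hv i)

theorem finite_setOf_gram_eq {n m : ℕ} {A : Matrix (Fin n) (Fin n) ℤ} (hA : A.IsSymm)
    (hpos : ∀ v : Fin n → ℤ, v ≠ 0 → 0 < v ⬝ᵥ A *ᵥ v) (hdet : A.det ≠ 0)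
    (B : Matrix (Fin m) (Fin m) ℤ) :
    {X : Matrix (Fin n) (Fin m) ℤ | Xᵀ * A * X = B}.Finite := by
  have h := Set.Finite.pi fun j : Fin m => finite_setOf_quadratic_le hA hpos hdet (B j j)
  refine Set.Finite.of_finite_image (f := transpose) (h.subset ?_)
    (transpose_injective.injOn)
  rintro _ ⟨X, hX, rfl⟩ j _
  have : B j j = (Xᵀ j) ⬝ᵥ A *ᵥ Xᵀ j := by
    rw [← show Xᵀ * A * X = B from hX, Matrix.mul_assoc, Matrix.mul_apply]
    simp [dotProduct, Matrix.mul_apply, mulVec]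
  exact this.ge

/-- A primitive system of three vectors in `ℤ⁴` extends to a basis. -/
theorem exists_isUnit_det_of_primitive {Y : Matrix (Fin 4) (Fin 3) ℤ}
    (hY : ∀ v : Fin 3 → ℤ, ∀ d : ℤ, d ≠ 0 → (∃ y : Fin 4 → ℤ, Y *ᵥ v = d • y) →
      ∃ w : Fin 3 → ℤ, v = d • w) :
    ∃ T : Matrix (Fin 4) (Fin 4) ℤ, IsUnit T.det ∧ T.submatrix id Fin.castSucc = Y := by
  have hinj : Function.Injective Y.mulVecLin := by
    rw [injective_iff_map_eq_zero]
    intro v hv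
    rw [mulVecLin_apply] at hv
    ext i
    obtain ⟨w, hw⟩ := hY v (|v i| + 1) (by positivity) ⟨0, by rw [hv, smul_zero]⟩
    refine Int.eq_zero_of_abs_lt_dvd (m := |v i| + 1) ⟨w i, congrFun hw i⟩ (lt_add_one _)
  set N := LinearMap.range Y.mulVecLin with hN
  have htf : Module.IsTorsionFree ℤ ((Fin 4 → ℤ) ⧸ N) := by
    refine .of_smul_eq_zero fun d x hdx => ?_
    obtain ⟨y, rfl⟩ := N.mkQ_surjective x
    rw [← map_smul, ← LinearMap.mem_ker, Submodule.ker_mkQ] at hdx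
    rw [← LinearMap.mem_ker, Submodule.ker_mkQ, or_iff_not_imp_left]
    intro hd
    obtain ⟨v, hv⟩ := hdx
    obtain ⟨w, rfl⟩ := hY v d hd ⟨y, hv⟩
    rw [map_smul] at hv
    exact ⟨w, smul_right_injective _ hd hv⟩
  have hfree : Module.Free ℤ ((Fin 4 → ℤ) ⧸ N) := inferInstance
  have hrank : Module.finrank ℤ ((Fin 4 → ℤ) ⧸ N) = 1 := by
    have h1 := Submodule.finrank_quotient_add_finrank N
    have h2 : Module.finrank ℤ N = 3 := by
      rw [hN, LinearMap.finrank_range_of_inj hinj]; simp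
    rw [h2] at h1
    simp at h1
    exact h1
  set b := Module.finBasisOfFinrankEq ℤ ((Fin 4 → ℤ) ⧸ N) hrank with hb
  obtain ⟨y, hy⟩ := N.mkQ_surjective (b 0)
  set T : Matrix (Fin 4) (Fin 4) ℤ :=
    Matrix.of fun i => Fin.snoc (α := fun _ => ℤ) (Y i) (y i) with hT
  have hTv : ∀ (v : Fin 3 → ℤ) (t : ℤ),
      T *ᵥ Fin.snoc (α := fun _ => ℤ) v t = Y *ᵥ v + t • y := by
    intro v t
    ext i
    simp only [mulVec, dotProduct, hT, of_apply]
    rw [Fin.sum_univ_castSucc]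
    simp only [Fin.snoc_castSucc, Fin.snoc_last, Pi.add_apply, Pi.smul_apply, smul_eq_mul,
      mulVec, dotProduct]
    ring
  have hsurj : ∀ x : Fin 4 → ℤ, ∃ s : Fin 4 → ℤ, T *ᵥ s = x := by
    intro x
    have h1 : N.mkQ x = (b.repr (N.mkQ x) 0) • b 0 := by
      conv_lhs => rw [← b.sum_repr (N.mkQ x)]
      simp
    rw [← hy, ← map_smul, ← sub_eq_zero, ← map_sub, ← LinearMap.mem_ker, Submodule.ker_mkQ] at h1
    obtain ⟨v, hv⟩ := h1
    refine ⟨Fin.snoc (α := fun _ => ℤ) v (b.repr (N.mkQ x) 0), ?_⟩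
    rw [hTv]
    rw [mulVecLin_apply] at hv
    rw [hv]; abel
  choose s hs using fun i : Fin 4 => hsurj (Pi.single i 1)
  refine ⟨T, Matrix.isUnit_det_of_right_inverse (B := Matrix.of fun i j => s j i) ?_, ?_⟩
  · ext i j
    have := congrFun (hs j) i
    rw [Matrix.mul_apply, Matrix.one_apply]
    simpa [mulVec, dotProduct, Pi.single_apply] using this
  · ext i j
    simp [hT]

/-- The lattice of integer vectors `u` with `X (D⁻¹ u)` integral. -/
def divLattice {m n : ℕ} (D : ℤ) (X : Matrix (Fin m) (Fin n) ℤ) : Submodule ℤ (Fin n → ℤ) where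
  carrier := {u | ∃ y : Fin m → ℤ, X *ᵥ u = D • y}
  zero_mem' := ⟨0, by simp⟩
  add_mem' := by
    rintro _ _ ⟨y, hy⟩ ⟨z, hz⟩
    exact ⟨y + z, by rw [mulVec_add, hy, hz, smul_add]⟩
  smul_mem' := by
    rintro c _ ⟨y, hy⟩
    exact ⟨c • y, by rw [mulVec_smul, hy, smul_comm]⟩

theorem smul_mem_divLattice {m n : ℕ} (D : ℤ) (X : Matrix (Fin m) (Fin n) ℤ) (x : Fin n → ℤ) :
    D • x ∈ divLattice D X :=
  ⟨X *ᵥ x, mulVec_smul _ _ _⟩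

theorem exists_basis_matrix {n : ℕ} {N : Submodule ℤ (Fin n → ℤ)} {D : ℤ} (hD : D ≠ 0)
    (hDN : ∀ x, D • x ∈ N) :
    ∃ B : Matrix (Fin n) (Fin n) ℤ, (∀ x, x ∈ N ↔ ∃ v, B *ᵥ v = x) ∧ B.det ≠ 0 := by
  have hrank : Module.finrank ℤ N = n := by
    refine le_antisymm ?_ ?_
    · simpa using Submodule.finrank_le N
    · have h : Function.Injective
          ((LinearMap.lsmul ℤ (Fin n → ℤ) D).codRestrict N hDN) := by
        intro x y hxy
        exact smul_right_injective _ hD (congrArg Subtype.val hxy)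
      simpa using LinearMap.finrank_le_finrank_of_injective h
  set b := Module.finBasisOfFinrankEq ℤ N hrank with hb
  set B : Matrix (Fin n) (Fin n) ℤ := Matrix.of fun i j => (b j : Fin n → ℤ) i with hB
  have hBv : ∀ v : Fin n → ℤ, B *ᵥ v = ((∑ j, v j • b j : N) : Fin n → ℤ) := by
    intro v
    ext i
    simp [hB, mulVec, dotProduct, mul_comm]
  have hmem : ∀ x, x ∈ N ↔ ∃ v, B *ᵥ v = x := by
    intro x
    constructor
    · intro hx
      refine ⟨fun j => b.repr ⟨x, hx⟩ j, ?_⟩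
      rw [hBv, b.sum_repr]
    · rintro ⟨v, rfl⟩
      rw [hBv]; exact Subtype.coe_prop _
  refine ⟨B, hmem, fun h0 => ?_⟩
  obtain ⟨v, hv0, hv⟩ := Matrix.exists_mulVec_eq_zero_iff.2 h0
  rw [hBv] at hv
  have h1 : ∑ j, v j • b j = 0 := Subtype.ext hv
  exact hv0 (funext fun j => Fintype.linearIndependent_iff.1 b.linearIndependent v h1 j)

/-- The number of representations with a given lattice `divLattice`. -/
theorem card_representations_divLattice_le {A : Matrix (Fin 4) (Fin 4) ℤ} (hA : A.IsSymm)
    (hdet : A.det ≠ 0) (O : Finset (Matrix (Fin 4) (Fin 4) ℤ))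
    (hO : ∀ h : Matrix (Fin 4) (Fin 4) ℤ, hᵀ * A * h = A → h ∈ O)
    {B : Matrix (Fin 3) (Fin 3) ℤ} {n : ℕ} (hn : 0 < n) (hBn : B.det = n)
    (N : Submodule ℤ (Fin 3 → ℤ)) (F : Finset (Matrix (Fin 4) (Fin 3) ℤ))
    (hF : ∀ X ∈ F, Xᵀ * A * X = B ∧ divLattice n X = N) :
    F.card ≤ O.card * (n.divisors.card * (2 * A.det.natAbs ^ 2) * (A.det.natAbs ^ 2) ^ 3) := by
  classical
  rcases F.eq_empty_or_nonempty with h0 | ⟨X₀, hX₀⟩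
  · rw [h0]; simp
  have hn0 : (n : ℤ) ≠ 0 := by exact_mod_cast hn.ne'
  have hDN : ∀ x, (n : ℤ) • x ∈ N := fun x => (hF X₀ hX₀).2 ▸ smul_mem_divLattice _ _ x
  obtain ⟨S, hS, hS0⟩ := exists_basis_matrix hn0 hDN
  choose Cc hCc using fun j : Fin 3 => (hS _).1 (hDN (Pi.single j 1))
  set C : Matrix (Fin 3) (Fin 3) ℤ := Matrix.of fun i j => Cc j i with hC
  have hSC : S * C = (n : ℤ) • (1 : Matrix (Fin 3) (Fin 3) ℤ) := by
    ext i j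
    have := congrFun (hCc j) i
    rw [Matrix.mul_apply]
    simpa [mulVec, dotProduct, Pi.single_apply, Matrix.one_apply, hC] using this
  have hY : ∀ X ∈ F, ∃ Y : Matrix (Fin 4) (Fin 3) ℤ, X * S = (n : ℤ) • Y := by
    intro X hX
    have h1 : ∀ j, ∃ y : Fin 4 → ℤ, X *ᵥ (S *ᵥ Pi.single j 1) = (n : ℤ) • y := by
      intro j
      have : S *ᵥ Pi.single j 1 ∈ divLattice n X := by
        rw [(hF X hX).2, hS]; exact ⟨_, rfl⟩
      exact this
    choose y hy using h1
    refine ⟨Matrix.of fun i j => y j i, ?_⟩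
    ext i j
    have := congrFun (hy j) i
    rw [mulVec_mulVec] at this
    simpa using this
  choose! Y hY using hY
  have hXY : ∀ X ∈ F, X = Y X * C := by
    intro X hX
    have h1 : (n : ℤ) • X = (n : ℤ) • (Y X * C) := by
      rw [← Matrix.smul_mul, ← hY X hX, Matrix.mul_assoc, hSC, Matrix.mul_smul, Matrix.mul_one]
    exact smul_right_injective _ hn0 h1
  have hinj : Set.InjOn Y F := fun X hX X' hX' h => by
    rw [hXY X hX, hXY X' hX', h]
  set G := (Y X₀)ᵀ * A * Y X₀ with hG
  have hYG : ∀ X ∈ F, (n : ℤ) ^ 2 • ((Y X)ᵀ * A * Y X) = Sᵀ * B * S := by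
    intro X hX
    have : Sᵀ * B * S = (X * S)ᵀ * A * (X * S) := by
      rw [← (hF X hX).1, transpose_mul]; simp only [Matrix.mul_assoc]
    rw [this, hY X hX]
    simp only [transpose_smul, Matrix.smul_mul, Matrix.mul_smul, smul_smul, sq]
  have hGeq : ∀ X ∈ F, (Y X)ᵀ * A * Y X = G := fun X hX =>
    smul_right_injective _ (pow_ne_zero 2 hn0) ((hYG X hX).trans (hYG X₀ hX₀).symm)
  have hBG : B.det = G.det * C.det ^ 2 := by
    have : B = Cᵀ * G * C := by
      rw [← (hF X₀ hX₀).1]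
      conv_lhs => rw [hXY X₀ hX₀]
      rw [transpose_mul, hG]; simp only [Matrix.mul_assoc]
    rw [this, det_mul, det_mul, det_transpose]; ring
  have hGpos : 0 < G.det := by
    have h1 : 0 < G.det * C.det ^ 2 := by rw [← hBG, hBn]; exact_mod_cast hn
    exact pos_of_mul_pos_left h1 (sq_nonneg _)
  obtain ⟨g, hg⟩ := Int.eq_ofNat_of_zero_le hGpos.le
  have hgn : g ∣ n := by
    have : (g : ℤ) ∣ n := ⟨C.det ^ 2, by rw [← hg, ← hBG, hBn]⟩
    exact_mod_cast this
  have hg0 : 0 < g := by omega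
  have hmain := card_primitive_representations_le hA hdet O hO hg0 hg (F.image Y) (by
    intro Z hZ
    obtain ⟨X, hX, rfl⟩ := Finset.mem_image.1 hZ
    refine ⟨hGeq X hX, exists_isUnit_det_of_primitive fun v d hd hy => ?_⟩
    obtain ⟨y, hy⟩ := hy
    have h1 : X *ᵥ (S *ᵥ v) = ((n : ℤ) * d) • y := by
      rw [mulVec_mulVec, hY X hX, smul_mulVec, hy, smul_smul]
    set w := B.adjugate *ᵥ (Xᵀ *ᵥ (A *ᵥ y)) with hw
    have h2 : S *ᵥ v = d • w := by
      have h3 : (n : ℤ) • (S *ᵥ v) = (n : ℤ) • (d • w) := by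
        calc (n : ℤ) • (S *ᵥ v) = B.adjugate *ᵥ (B *ᵥ (S *ᵥ v)) := by
              rw [mulVec_mulVec _ B.adjugate, adjugate_mul, hBn, smul_mulVec, one_mulVec]
          _ = B.adjugate *ᵥ (Xᵀ *ᵥ (A *ᵥ (X *ᵥ (S *ᵥ v)))) := by
              rw [← (hF X hX).1]
              simp only [mulVec_mulVec, Matrix.mul_assoc]
          _ = (n : ℤ) • (d • w) := by
              rw [h1]; simp only [mulVec_smul, smul_smul, hw]
      exact smul_right_injective _ hn0 h3
    have h4 : w ∈ N := by
      rw [← (hF X hX).2]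
      refine ⟨y, ?_⟩
      have h5 : d • (X *ᵥ w) = d • ((n : ℤ) • y) := by
        rw [← mulVec_smul, ← h2, h1, smul_smul, mul_comm]
      exact smul_right_injective _ hd h5
    obtain ⟨u, hu⟩ := (hS w).1 h4
    refine ⟨u, ?_⟩
    have h6 : S *ᵥ (v - d • u) = 0 := by rw [mulVec_sub, mulVec_smul, hu, h2, sub_self]
    exact sub_eq_zero.1 (Matrix.eq_zero_of_mulVec_eq_zero hS0 h6))
  rw [Finset.card_image_of_injOn hinj] at hmain
  refine hmain.trans ?_
  gcongr

/-- The `p`-adic valuation of `x` is at least `k`. -/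
def PadicOrdGe (p : ℕ) (k : ℤ) (x : ℚ) : Prop := x = 0 ∨ k ≤ padicValRat p x

namespace PadicOrdGe

variable {p : ℕ} {k l : ℤ} {x y : ℚ}

theorem zero : PadicOrdGe p k 0 := Or.inl rfl

theorem mono (h : PadicOrdGe p k x) (hlk : l ≤ k) : PadicOrdGe p l x :=
  h.imp_right hlk.trans

theorem le_of_ne_zero (h : PadicOrdGe p k x) (hx : x ≠ 0) : k ≤ padicValRat p x :=
  h.resolve_left hx

theorem add [Fact p.Prime] (hx : PadicOrdGe p k x) (hy : PadicOrdGe p k y) :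
    PadicOrdGe p k (x + y) := by
  rcases eq_or_ne x 0 with rfl | hx0
  · rwa [zero_add]
  rcases eq_or_ne y 0 with rfl | hy0
  · rwa [add_zero]
  rcases eq_or_ne (x + y) 0 with h | h
  · exact Or.inl h
  · exact Or.inr ((le_min (hx.le_of_ne_zero hx0) (hy.le_of_ne_zero hy0)).trans
      (padicValRat.min_le_padicValRat_add h))

theorem neg (hx : PadicOrdGe p k x) : PadicOrdGe p k (-x) := by
  rcases hx with rfl | hx
  · rw [neg_zero]; exact zero
  · exact Or.inr (by rwa [padicValRat.neg])

theorem sub [Fact p.Prime] (hx : PadicOrdGe p k x) (hy : PadicOrdGe p k y) :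
    PadicOrdGe p k (x - y) := by
  rw [sub_eq_add_neg]; exact hx.add hy.neg

theorem mul [Fact p.Prime] (hx : PadicOrdGe p k x) (hy : PadicOrdGe p l y) :
    PadicOrdGe p (k + l) (x * y) := by
  rcases eq_or_ne x 0 with rfl | hx0
  · rw [zero_mul]; exact zero
  rcases eq_or_ne y 0 with rfl | hy0
  · rw [mul_zero]; exact zero
  · refine Or.inr ?_
    rw [padicValRat.mul hx0 hy0]
    exact add_le_add (hx.le_of_ne_zero hx0) (hy.le_of_ne_zero hy0)

theorem mul_left [Fact p.Prime] (hx : PadicOrdGe p 0 x) (hy : PadicOrdGe p k y) :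
    PadicOrdGe p k (x * y) := by
  simpa using hx.mul hy

theorem div [Fact p.Prime] (hx : PadicOrdGe p k x) (hy : y ≠ 0) :
    PadicOrdGe p (k - padicValRat p y) (x / y) := by
  rcases eq_or_ne x 0 with rfl | hx0
  · rw [zero_div]; exact zero
  · refine Or.inr ?_
    rw [padicValRat.div hx0 hy]
    exact sub_le_sub_right (hx.le_of_ne_zero hx0) _

theorem self : PadicOrdGe p (padicValRat p x) x := Or.inr le_rfl

theorem natCast_pow_iff [Fact p.Prime] {t : ℕ} {z : ℤ} :
    PadicOrdGe p t (z : ℚ) ↔ (p : ℤ) ^ t ∣ z := by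
  rw [padicValInt_dvd_iff, PadicOrdGe, padicValRat.of_int]
  norm_cast

theorem intCast (z : ℤ) : PadicOrdGe p 0 (z : ℚ) := by
  refine Or.inr ?_
  rw [padicValRat.of_int]
  positivity

theorem prime_zpow [Fact p.Prime] : PadicOrdGe p k ((p : ℚ) ^ k) := by
  refine Or.inr ?_
  rw [padicValRat.zpow, padicValRat.self (Fact.out : p.Prime).one_lt, mul_one]

theorem sum [Fact p.Prime] {ι : Type*} {s : Finset ι} {f : ι → ℚ}
    (h : ∀ i ∈ s, PadicOrdGe p k (f i)) :
    PadicOrdGe p k (∑ i ∈ s, f i) := by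
  classical
  induction s using Finset.induction_on with
  | empty => exact zero
  | insert a s ha ih =>
    rw [Finset.sum_insert ha]
    exact (h a (Finset.mem_insert_self a s)).add
      (ih fun i hi => h i (Finset.mem_insert_of_mem hi))

theorem not_dvd_den (hp : p.Prime) (h : PadicOrdGe p 0 x) : ¬ p ∣ x.den := by
  intro hd
  rcases h with rfl | h
  · exact hp.one_lt.ne' (by simpa using hd)
  · have hn : ¬ (p : ℤ) ∣ x.num := fun hn => by
      have h1 := Nat.dvd_gcd (Int.natCast_dvd.1 hn) hd
      rw [x.reduced] at h1
      exact hp.one_lt.ne' (Nat.dvd_one.1 h1)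
    rw [padicValRat_def, padicValInt.eq_zero_of_not_dvd hn] at h
    have : Fact p.Prime := ⟨hp⟩
    have h2 := one_le_padicValNat_of_dvd x.den_nz hd
    omega

theorem exists_natCast_sub [Fact p.Prime] (hx : PadicOrdGe p 0 x) (t : ℕ) :
    ∃ n < p ^ t, PadicOrdGe p t (x - (n : ℤ)) := by
  have hp : p.Prime := Fact.out
  have hd := not_dvd_den hp hx
  have hcop : IsCoprime (x.den : ℤ) ((p : ℤ) ^ t) := by
    have := ((Nat.Prime.coprime_iff_not_dvd hp).2 hd).symm.pow_right t
    exact_mod_cast Nat.isCoprime_iff_coprime.2 this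
  obtain ⟨a, b, hab⟩ := hcop
  have hpt : (0 : ℤ) < (p : ℤ) ^ t := pow_pos (by exact_mod_cast hp.pos) t
  have hnn := Int.emod_nonneg (x.num * a) hpt.ne'
  refine ⟨((x.num * a) % (p : ℤ) ^ t).toNat, ?_, ?_⟩
  · zify
    rw [Int.toNat_of_nonneg hnn]
    exact Int.emod_lt_of_pos _ hpt
  · rw [Int.toNat_of_nonneg hnn]
    set m := (x.num * a) % (p : ℤ) ^ t with hm
    have hden : (x.den : ℚ) ≠ 0 := by exact_mod_cast x.den_nz
    have h1 : (p : ℤ) ^ t ∣ x.num - x.den * m := by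
      refine ⟨x.num * b + x.den * ((x.num * a) / (p : ℤ) ^ t), ?_⟩
      have h2 := Int.emod_add_mul_ediv (x.num * a) ((p : ℤ) ^ t)
      rw [← hm] at h2
      linear_combination (-x.num) * hab - (x.den : ℤ) * h2
    have h3 := (natCast_pow_iff.2 h1).div hden
    have h4 : padicValRat p (x.den : ℚ) = 0 := by
      rw [padicValRat.of_nat, padicValNat.eq_zero_of_not_dvd hd]; rfl
    rw [h4, sub_zero] at h3
    convert h3 using 1
    push_cast
    rw [eq_div_iff hden, sub_mul, Rat.mul_den_eq_num]
    ring

end PadicOrdGe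

/-- A set of rationals closed under addition and multiplication by `p`-integral numbers,
containing `1` and with denominators bounded by `p ^ e`, is `p ^ (-i)` times the ring of
`p`-integral numbers. -/
theorem exists_eq_setOf_padicOrdGe {p : ℕ} [Fact p.Prime] {I : Set ℚ} (h1 : (1 : ℚ) ∈ I)
    (hmul : ∀ r x, PadicOrdGe p 0 r → x ∈ I → r * x ∈ I) {e : ℕ}
    (he : ∀ x ∈ I, PadicOrdGe p (-e) x) :
    ∃ i : ℕ, i ≤ e ∧ (p : ℚ) ^ (-i : ℤ) ∈ I ∧ ∀ x ∈ I, PadicOrdGe p (-i) x := by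
  classical
  have hp0 : (p : ℚ) ≠ 0 := by exact_mod_cast (Fact.out : p.Prime).ne_zero
  set S := (Finset.range (e + 1)).filter fun i : ℕ => (p : ℚ) ^ (-i : ℤ) ∈ I with hS
  have hne : S.Nonempty := ⟨0, by simp [hS, h1]⟩
  obtain ⟨hmax, hmem⟩ := Finset.mem_filter.1 (S.max'_mem hne)
  refine ⟨S.max' hne, by simpa [Nat.lt_succ_iff] using hmax, hmem, fun x hx => ?_⟩
  rcases eq_or_ne x 0 with rfl | hx0
  · exact PadicOrdGe.zero
  by_contra hcon
  have hlt : padicValRat p x < -(S.max' hne : ℤ) := by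
    rw [PadicOrdGe, not_or, not_le] at hcon; exact hcon.2
  have hge := (he x hx).le_of_ne_zero hx0
  obtain ⟨j, hj⟩ := Int.eq_ofNat_of_zero_le (a := -padicValRat p x) (by omega)
  have hjS : j ∈ S := by
    refine Finset.mem_filter.2 ⟨Finset.mem_range.2 (by omega), ?_⟩
    have := hmul ((p : ℚ) ^ (-j : ℤ) / x) x (by
      have h := (PadicOrdGe.prime_zpow (p := p) (k := (-j : ℤ))).div hx0
      exact h.mono (by omega)) hx
    rwa [div_mul_cancel₀ _ hx0] at this
  have := S.le_max' j hjS
  omega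

/-- `Q` is closed under addition and under multiplication by `p`-integral rationals, and the form
`B` takes `p`-integral values on it. -/
structure IsPadicIntegral (p : ℕ) (B : LinearMap.BilinForm ℚ (Fin 3 → ℚ))
    (Q : Set (Fin 3 → ℚ)) : Prop where
  add_mem : ∀ u ∈ Q, ∀ v ∈ Q, u + v ∈ Q
  smul_mem : ∀ r : ℚ, PadicOrdGe p 0 r → ∀ v ∈ Q, r • v ∈ Q
  integral : ∀ u ∈ Q, ∀ v ∈ Q, PadicOrdGe p 0 (B u v)

theorem IsPadicIntegral.intCast_smul_mem {p : ℕ} {B : LinearMap.BilinForm ℚ (Fin 3 → ℚ)}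
    {Q : Set (Fin 3 → ℚ)} (hQ : IsPadicIntegral p B Q) (z : ℤ) {v : Fin 3 → ℚ} (hv : v ∈ Q) :
    (z : ℚ) • v ∈ Q :=
  hQ.smul_mem _ (PadicOrdGe.intCast z) v hv

theorem IsPadicIntegral.sub_mem {p : ℕ} {B : LinearMap.BilinForm ℚ (Fin 3 → ℚ)}
    {Q : Set (Fin 3 → ℚ)} (hQ : IsPadicIntegral p B Q) {u v : Fin 3 → ℚ} (hu : u ∈ Q)
    (hv : v ∈ Q) : u - v ∈ Q := by
  have h := hQ.add_mem u hu _ (hQ.intCast_smul_mem (-1) hv)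
  rwa [Int.cast_neg, Int.cast_one, neg_one_smul, ← sub_eq_add_neg] at h

section

variable {p : ℕ} [Fact p.Prime] {B : LinearMap.BilinForm ℚ (Fin 3 → ℚ)}

theorem IsPadicIntegral.subset_of_generator {Q Q' : Set (Fin 3 → ℚ)} (hQ : IsPadicIntegral p B Q)
    (hQ' : IsPadicIntegral p B Q') (c : Fin 3) {f f' : Fin 3 → ℚ} (hf : f ∈ Q) (hf' : f' ∈ Q')
    {k : ℤ} (hfc : f c = (p : ℚ) ^ k) (hle : ∀ v ∈ Q, PadicOrdGe p k (v c))
    (hker : ∀ v ∈ Q, v c = 0 → v ∈ Q') (hsub : f - f' ∈ Q') : Q ⊆ Q' := by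
  intro v hv
  have hp0 : (p : ℚ) ≠ 0 := by exact_mod_cast (Fact.out : p.Prime).ne_zero
  have hfc0 : f c ≠ 0 := by rw [hfc]; exact zpow_ne_zero _ hp0
  have hr : PadicOrdGe p 0 (v c / f c) := by
    refine ((hle v hv).div hfc0).mono ?_
    rw [hfc, padicValRat.zpow, padicValRat.self (Fact.out : p.Prime).one_lt, mul_one, sub_self]
  set r := v c / f c
  have h1 : v - r • f ∈ Q' := by
    refine hker _ (hQ.sub_mem hv (hQ.smul_mem r hr f hf)) ?_
    simp [r, hfc0]
  have h2 := hQ'.add_mem _ (hQ'.add_mem _ h1 _ (hQ'.smul_mem r hr _ hsub)) _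
    (hQ'.smul_mem r hr _ hf')
  convert h2 using 1
  rw [smul_sub]; abel

/-- Lattices of rank two in the plane `v 2 = 0` with given elementary denominators. -/
structure IsPlaneLattice (p : ℕ) (B : LinearMap.BilinForm ℚ (Fin 3 → ℚ)) (i j : ℕ)
    (Q : Set (Fin 3 → ℚ)) : Prop extends IsPadicIntegral p B Q where
  first_mem : (p : ℚ) ^ (-i : ℤ) • Pi.single 0 1 ∈ Q
  exists_second : ∃ f ∈ Q, f 1 = (p : ℚ) ^ (-j : ℤ)
  third_eq : ∀ v ∈ Q, v 2 = 0
  second_ge : ∀ v ∈ Q, PadicOrdGe p (-j) (v 1)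
  first_ge : ∀ v ∈ Q, v 1 = 0 → PadicOrdGe p (-i) (v 0)

theorem card_planeLattice_le (hB : ∀ u v, B u v = B v u) (hpos : ∀ v, v ≠ 0 → 0 < B v v)
    {a : ℕ} (ha : padicValRat p (B (Pi.single 0 1) (Pi.single 0 1)) = a) (i j : ℕ)
    (𝒬 : Finset (Set (Fin 3 → ℚ))) (h𝒬 : ∀ Q ∈ 𝒬, IsPlaneLattice p B i j Q) :
    𝒬.card ≤ (a + 1) * p ^ (a / 2) := by
  classical
  have hp : p.Prime := Fact.out
  have hp0 : (p : ℚ) ≠ 0 := by exact_mod_cast hp.ne_zero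
  rcases 𝒬.eq_empty_or_nonempty with h0 | ⟨Q₀, hQ₀⟩
  · rw [h0]; simp
  set e : Fin 3 → ℚ := Pi.single 0 1 with he
  have he0 : e ≠ 0 := fun h => by simpa [he] using congrFun h 0
  set f₁ : Fin 3 → ℚ := (p : ℚ) ^ (-i : ℤ) • e with hf₁
  have hpi : (p : ℚ) ^ (-i : ℤ) ≠ 0 := zpow_ne_zero _ hp0
  have hf₁0 : f₁ ≠ 0 := smul_ne_zero hpi he0
  set d := B f₁ f₁ with hd
  have hd0 : d ≠ 0 := (hpos _ hf₁0).ne'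
  have hdval : padicValRat p d = a - 2 * i := by
    rw [hd, hf₁]
    simp only [map_smul, LinearMap.smul_apply, smul_eq_mul]
    rw [padicValRat.mul hpi (mul_ne_zero hpi (hpos e he0).ne'),
      padicValRat.mul hpi (hpos e he0).ne', ha, padicValRat.zpow, padicValRat.self hp.one_lt]
    ring
  have hdnn : 0 ≤ padicValRat p d :=
    ((h𝒬 Q₀ hQ₀).integral f₁ (h𝒬 Q₀ hQ₀).first_mem f₁ (h𝒬 Q₀ hQ₀).first_mem).le_of_ne_zero hd0
  obtain ⟨t, ht⟩ := Int.eq_ofNat_of_zero_le hdnn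
  have hta : t ≤ a := by omega
  choose! g hgQ hg using fun Q hQ => (h𝒬 Q hQ).exists_second
  have hres : ∀ Q ∈ 𝒬, ∃ n < p ^ t, PadicOrdGe p t (B f₁ (g Q) - (n : ℤ)) := fun Q hQ =>
    ((h𝒬 Q hQ).integral _ (h𝒬 Q hQ).first_mem _ (hgQ Q hQ)).exists_natCast_sub t
  choose! x hxlt hx using hres
  have hdiff : ∀ Q ∈ 𝒬, ∀ Q' ∈ 𝒬, g Q - g Q' = ((B f₁ (g Q) - B f₁ (g Q')) / d) • f₁ := by
    intro Q hQ Q' hQ'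
    have h1 : g Q - g Q' = ((g Q - g Q') 0 / (p : ℚ) ^ (-i : ℤ)) • f₁ := by
      ext l
      fin_cases l
      · simp [hf₁, he, hp0]
      · simp [hf₁, he, hg Q hQ, hg Q' hQ']
      · simp [hf₁, he, (h𝒬 Q hQ).third_eq _ (hgQ Q hQ), (h𝒬 Q' hQ').third_eq _ (hgQ Q' hQ')]
    have h2 : B f₁ (g Q) - B f₁ (g Q') = ((g Q - g Q') 0 / (p : ℚ) ^ (-i : ℤ)) * d := by
      rw [← map_sub]
      conv_lhs => rw [h1]
      rw [map_smul, smul_eq_mul]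
    rw [h2, mul_div_cancel_right₀ _ hd0]
    exact h1
  have hinj : Set.InjOn x 𝒬 := by
    have hsub : ∀ Q ∈ 𝒬, ∀ Q' ∈ 𝒬, x Q = x Q' → Q ⊆ Q' := by
      intro Q hQ Q' hQ' hxx
      have hL := h𝒬 Q hQ
      have hL' := h𝒬 Q' hQ'
      refine hL.toIsPadicIntegral.subset_of_generator hL'.toIsPadicIntegral 1 (hgQ Q hQ)
        (hgQ Q' hQ') (hg Q hQ) hL.second_ge (fun v hv hv1 => ?_) ?_
      · have hr : PadicOrdGe p 0 (v 0 / (p : ℚ) ^ (-i : ℤ)) := by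
          refine ((hL.first_ge v hv hv1).div hpi).mono ?_
          rw [padicValRat.zpow, padicValRat.self hp.one_lt, mul_one, sub_self]
        have h := hL'.smul_mem _ hr _ hL'.first_mem
        convert h using 1
        ext l
        fin_cases l
        · simp [hp0]
        · simp [hv1]
        · simp [hL.third_eq v hv]
      · rw [hdiff Q hQ Q' hQ']
        refine hL'.smul_mem _ ?_ _ hL'.first_mem
        have h := (hx Q hQ).sub (hx Q' hQ')
        rw [hxx, sub_sub_sub_cancel_right] at h
        exact (h.div hd0).mono (by omega)
    exact fun Q hQ Q' hQ' h => (hsub Q hQ Q' hQ' h).antisymm (hsub Q' hQ' Q hQ h.symm)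
  have hmaps : ∀ Q ∈ 𝒬, x Q ∈ (Finset.range (p ^ t)).filter fun y : ℕ =>
      ((p ^ t : ℕ) : ℤ) ∣ (y : ℤ) ^ 2 - (x Q₀ : ℤ) ^ 2 := by
    intro Q hQ
    refine Finset.mem_filter.2 ⟨Finset.mem_range.2 (hxlt Q hQ), ?_⟩
    push_cast
    rw [← PadicOrdGe.natCast_pow_iff]
    have hL := h𝒬 Q hQ
    have hL₀ := h𝒬 Q₀ hQ₀
    set ξ := B f₁ (g Q) with hξ
    set ξ₀ := B f₁ (g Q₀) with hξ₀
    have hsq : ∀ Q ∈ 𝒬, PadicOrdGe p t (B f₁ (g Q) ^ 2 - (x Q : ℚ) ^ 2) := by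
      intro Q hQ
      have h1 : PadicOrdGe p 0 (B f₁ (g Q) + (x Q : ℤ)) :=
        ((h𝒬 Q hQ).integral _ (h𝒬 Q hQ).first_mem _ (hgQ Q hQ)).add (PadicOrdGe.intCast _)
      have h2 := h1.mul_left (hx Q hQ)
      convert h2 using 1
      push_cast; ring
    have hdisc : PadicOrdGe p t (ξ ^ 2 - ξ₀ ^ 2) := by
      have h1 : g Q = g Q₀ + ((ξ - ξ₀) / d) • f₁ := by rw [← hdiff Q hQ Q₀ hQ₀]; abel
      have h2 : ξ ^ 2 - ξ₀ ^ 2 = (B (g Q) (g Q) - B (g Q₀) (g Q₀)) * d := by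
        have h3 : B (g Q) (g Q) = B (g Q₀) (g Q₀) + 2 * ((ξ - ξ₀) / d) * ξ₀ +
            ((ξ - ξ₀) / d) ^ 2 * d := by
          rw [h1]
          simp only [map_add, map_smul, LinearMap.add_apply, LinearMap.smul_apply, smul_eq_mul,
            hB (g Q₀) f₁, ← hd, ← hξ₀]
          ring
        rw [h3]; field_simp; ring
      rw [h2]
      refine ((hL.integral _ (hgQ Q hQ) _ (hgQ Q hQ)).sub
        (hL₀.integral _ (hgQ Q₀ hQ₀) _ (hgQ Q₀ hQ₀))).mul_left ?_
      rw [← ht]; exact PadicOrdGe.self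
    have h := (hdisc.sub (hsq Q hQ)).add (hsq Q₀ hQ₀)
    convert h using 1
    push_cast; ring
  calc 𝒬.card ≤ _ := Finset.card_le_card_of_injOn x hmaps hinj
    _ ≤ (t + 1) * p ^ (t / 2) := card_sqrt_mod_prime_pow_le hp t _
    _ ≤ (a + 1) * p ^ (a / 2) := by
        gcongr
        exact hp.one_lt.le

end

section

variable {p : ℕ} [Fact p.Prime] {B : LinearMap.BilinForm ℚ (Fin 3 → ℚ)}

theorem exists_orthogonal_of_min {Q : Set (Fin 3 → ℚ)} (hQ : IsPadicIntegral p B Q)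
    (hB : ∀ u v, B u v = B v u) (hpos : ∀ v, v ≠ 0 → 0 < B v v) {g o : Fin 3 → ℚ} (hg : g ∈ Q)
    (ho : o ∈ Q) (hg0 : g ≠ 0) (hdisc : B g g * B o o - B g o ^ 2 ≠ 0)
    (h1 : PadicOrdGe p (padicValRat p (B g g)) (B o o))
    (h2 : PadicOrdGe p (padicValRat p (B g g)) (2 * B g o)) :
    ∃ g₂ ∈ Q, B g g₂ = 0 ∧ g₂ ≠ 0 ∧ padicValRat p (B g g) ≤ padicValRat p (B g₂ g₂) ∧
      B g g * B g₂ g₂ = 4 * (B g g * B o o - B g o ^ 2) := by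
  set b := B g g with hb
  have hb0 : b ≠ 0 := (hpos g hg0).ne'
  set r := 2 * B g o / b with hr
  have hrint : PadicOrdGe p 0 r := (h2.div hb0).mono (sub_self _).ge
  have hrb : r * b = 2 * B g o := div_mul_cancel₀ _ hb0
  set g₂ := (2 : ℤ) • o - r • g with hg₂
  have hz : (2 : ℤ) • o = ((2 : ℤ) : ℚ) • o := (Int.cast_smul_eq_zsmul ℚ 2 o).symm
  have hval : B g₂ g₂ = 4 * B o o - r * (2 * B g o) := by
    rw [hg₂, hz]
    simp only [map_sub, map_smul, LinearMap.sub_apply, LinearMap.smul_apply, smul_eq_mul,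
      hB o g, ← hb]
    push_cast
    linear_combination r * hrb
  have hmul : b * B g₂ g₂ = 4 * (b * B o o - B g o ^ 2) := by
    rw [hval]
    linear_combination (-2 * B g o) * hrb
  have hg₂0 : g₂ ≠ 0 := fun h => by
    rw [h] at hmul
    simp only [map_zero, mul_zero] at hmul
    exact hdisc (by linarith)
  refine ⟨g₂, ?_, ?_, hg₂0, ?_, hmul⟩
  · rw [hg₂, hz]
    exact hQ.sub_mem (hQ.intCast_smul_mem 2 ho) (hQ.smul_mem r hrint g hg)
  · rw [hg₂, hz, map_sub, map_smul, map_smul, smul_eq_mul, smul_eq_mul, ← hb, hrb]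
    push_cast; ring
  · have h3 : PadicOrdGe p (padicValRat p b) (B g₂ g₂) := by
      rw [hval]
      refine PadicOrdGe.sub ?_ (hrint.mul_left h2)
      have := (PadicOrdGe.intCast (p := p) 4).mul_left h1
      simpa using this
    exact h3.le_of_ne_zero (hpos _ hg₂0).ne'

theorem IsPlaneLattice.exists_orthogonal {i j : ℕ} {Q : Set (Fin 3 → ℚ)}
    (hQ : IsPlaneLattice p B i j Q) (hB : ∀ u v, B u v = B v u)
    (hpos : ∀ v, v ≠ 0 → 0 < B v v) :
    ∃ g₁ ∈ Q, ∃ g₂ ∈ Q, g₁ ≠ 0 ∧ g₂ ≠ 0 ∧ B g₁ g₂ = 0 ∧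
      padicValRat p (B g₁ g₁) ≤ padicValRat p (B g₂ g₂) ∧
      padicValRat p (B g₁ g₁) + padicValRat p (B g₂ g₂) ≤
        padicValRat p (4 * (B (Pi.single 0 1) (Pi.single 0 1) * B (Pi.single 1 1) (Pi.single 1 1) -
          B (Pi.single 0 1) (Pi.single 1 1) ^ 2)) := by
  have hp : p.Prime := Fact.out
  have hp0 : (p : ℚ) ≠ 0 := by exact_mod_cast hp.ne_zero
  set e₀ : Fin 3 → ℚ := Pi.single 0 1 with he₀
  set e₁ : Fin 3 → ℚ := Pi.single 1 1 with he₁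
  set Δ := B e₀ e₀ * B e₁ e₁ - B e₀ e₁ ^ 2 with hΔ
  set π := (p : ℚ) ^ (-i : ℤ) with hπ
  set ρ := (p : ℚ) ^ (-j : ℤ) with hρ
  have hπ0 : π ≠ 0 := zpow_ne_zero _ hp0
  have hρ0 : ρ ≠ 0 := zpow_ne_zero _ hp0
  set f₁ := π • e₀ with hf₁
  have hf₁Q : f₁ ∈ Q := hQ.first_mem
  obtain ⟨f₂, hf₂Q, hf₂1⟩ : ∃ f ∈ Q, f 1 = ρ := hQ.exists_second
  have he₀0 : e₀ ≠ 0 := fun h => by simpa [he₀] using congrFun h 0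
  have hf₁0 : f₁ ≠ 0 := smul_ne_zero hπ0 he₀0
  have hf₂0 : f₂ ≠ 0 := fun h => hρ0 (by rw [← hf₂1, h]; rfl)
  have hf₁₂0 : f₁ + f₂ ≠ 0 := fun h => hρ0 (by
    have := congrFun h 1
    simpa [hf₁, he₀, hf₂1] using this)
  have hf₂ : f₂ = f₂ 0 • e₀ + ρ • e₁ := by
    ext l
    fin_cases l
    · simp [he₀, he₁]
    · simp [he₀, he₁, hf₂1]
    · simp [he₀, he₁, hQ.third_eq _ hf₂Q]
  have hdisc : B f₁ f₁ * B f₂ f₂ - B f₁ f₂ ^ 2 = π ^ 2 * ρ ^ 2 * Δ := by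
    rw [hf₂, hf₁]
    simp only [map_add, map_smul, LinearMap.add_apply, LinearMap.smul_apply, smul_eq_mul,
      hB e₁ e₀, hΔ]
    ring
  have hΔ0 : Δ ≠ 0 := by
    have hne : B e₀ e₀ • e₁ - B e₀ e₁ • e₀ ≠ 0 := fun h => (hpos e₀ he₀0).ne' (by
      have := congrFun h 1
      simpa [he₀, he₁] using this)
    have h := hpos _ hne
    have h2 : B (B e₀ e₀ • e₁ - B e₀ e₁ • e₀) (B e₀ e₀ • e₁ - B e₀ e₁ • e₀) = B e₀ e₀ * Δ := by
      simp only [map_sub, map_smul, LinearMap.sub_apply, LinearMap.smul_apply, smul_eq_mul,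
        hB e₁ e₀, hΔ]
      ring
    rw [h2] at h
    exact fun h0 => by rw [h0, mul_zero] at h; exact h.false
  have hdisc0 : B f₁ f₁ * B f₂ f₂ - B f₁ f₂ ^ 2 ≠ 0 := by
    rw [hdisc]
    exact mul_ne_zero (mul_ne_zero (pow_ne_zero _ hπ0) (pow_ne_zero _ hρ0)) hΔ0
  have hdiscval : padicValRat p (4 * (B f₁ f₁ * B f₂ f₂ - B f₁ f₂ ^ 2)) ≤
      padicValRat p (4 * Δ) := by
    rw [hdisc, padicValRat.mul (by norm_num) (hdisc ▸ hdisc0),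
      padicValRat.mul (mul_ne_zero (pow_ne_zero _ hπ0) (pow_ne_zero _ hρ0)) hΔ0,
      padicValRat.mul (pow_ne_zero _ hπ0) (pow_ne_zero _ hρ0), padicValRat.pow, padicValRat.pow,
      hπ, hρ, padicValRat.zpow, padicValRat.zpow, padicValRat.self hp.one_lt,
      padicValRat.mul (by norm_num) hΔ0]
    push_cast
    linarith
  suffices h : ∃ g ∈ Q, ∃ o ∈ Q, g ≠ 0 ∧
      B g g * B o o - B g o ^ 2 = B f₁ f₁ * B f₂ f₂ - B f₁ f₂ ^ 2 ∧
      PadicOrdGe p (padicValRat p (B g g)) (B o o) ∧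
      PadicOrdGe p (padicValRat p (B g g)) (2 * B g o) by
    obtain ⟨g, hg, o, ho, hg0, hgo, h1, h2⟩ := h
    obtain ⟨g₂, hg₂, horth, hg₂0, hle, hmul⟩ := exists_orthogonal_of_min hQ.toIsPadicIntegral hB
      hpos hg ho hg0 (hgo ▸ hdisc0) h1 h2
    refine ⟨g, hg, g₂, hg₂, hg0, hg₂0, horth, hle, ?_⟩
    rw [← padicValRat.mul (hpos g hg0).ne' (hpos g₂ hg₂0).ne', hmul, hgo]
    exact hdiscval
  have hsum : B (f₁ + f₂) (f₁ + f₂) = B f₁ f₁ + 2 * B f₁ f₂ + B f₂ f₂ := by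
    simp only [map_add, LinearMap.add_apply, hB f₂ f₁]; ring
  set v₁ := padicValRat p (B f₁ f₁) with hv₁
  set v₂ := padicValRat p (B f₂ f₂) with hv₂
  set v₃ := padicValRat p (B (f₁ + f₂) (f₁ + f₂)) with hv₃
  have hall : ∀ m, m ≤ v₁ → m ≤ v₂ → m ≤ v₃ → PadicOrdGe p m (B f₁ f₁) ∧
      PadicOrdGe p m (B f₂ f₂) ∧ PadicOrdGe p m (2 * B f₁ f₂) := by
    intro m h1 h2 h3
    have e1 : PadicOrdGe p m (B f₁ f₁) := PadicOrdGe.self.mono h1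
    have e2 : PadicOrdGe p m (B f₂ f₂) := PadicOrdGe.self.mono h2
    have e3 : PadicOrdGe p m (B (f₁ + f₂) (f₁ + f₂)) := PadicOrdGe.self.mono h3
    refine ⟨e1, e2, ?_⟩
    have := (e3.sub e1).sub e2
    rw [hsum] at this
    convert this using 1; ring
  rcases (by omega : (v₁ ≤ v₂ ∧ v₁ ≤ v₃) ∨ (v₂ ≤ v₁ ∧ v₂ ≤ v₃) ∨ (v₃ ≤ v₁ ∧ v₃ ≤ v₂))
    with ⟨h1, h2⟩ | ⟨h1, h2⟩ | ⟨h1, h2⟩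
  · obtain ⟨-, e2, e3⟩ := hall v₁ le_rfl h1 h2
    exact ⟨f₁, hf₁Q, f₂, hf₂Q, hf₁0, rfl, e2, e3⟩
  · obtain ⟨e1, -, e3⟩ := hall v₂ h1 le_rfl h2
    refine ⟨f₂, hf₂Q, f₁, hf₁Q, hf₂0, ?_, e1, ?_⟩
    · rw [hB f₂ f₁]; ring
    · rw [hB f₂ f₁]; exact e3
  · obtain ⟨e1, e2, e3⟩ := hall v₃ h1 h2 le_rfl
    refine ⟨f₁ + f₂, hQ.add_mem _ hf₁Q _ hf₂Q, f₁, hf₁Q, hf₁₂0, ?_, e1, ?_⟩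
    · rw [hsum]
      simp only [map_add, LinearMap.add_apply, hB f₂ f₁]
      ring
    · have h := ((PadicOrdGe.intCast (p := p) 2).mul_left e1).add e3
      convert h using 1
      simp only [map_add, LinearMap.add_apply, hB f₂ f₁]
      push_cast; ring

theorem eq_orthogonal_expansion (hpos : ∀ v, v ≠ 0 → 0 < B v v) (hB : ∀ u v, B u v = B v u)
    {g₁ g₂ w : Fin 3 → ℚ} (h₁ : g₁ ≠ 0) (h₂ : g₂ ≠ 0) (horth : B g₁ g₂ = 0) (hg₁ : g₁ 2 = 0)
    (hg₂ : g₂ 2 = 0) (hw : w 2 = 0) :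
    w = (B g₁ w / B g₁ g₁) • g₁ + (B g₂ w / B g₂ g₂) • g₂ := by
  have hb₁ := (hpos g₁ h₁).ne'
  have hb₂ := (hpos g₂ h₂).ne'
  set w' := w - ((B g₁ w / B g₁ g₁) • g₁ + (B g₂ w / B g₂ g₂) • g₂) with hw'
  have hw'2 : w' 2 = 0 := by simp [hw', hw, hg₁, hg₂]
  have ho₁ : B w' g₁ = 0 := by
    rw [hB, hw']
    simp only [map_sub, map_add, map_smul, smul_eq_mul, horth]
    field_simp; ring
  have ho₂ : B w' g₂ = 0 := by
    rw [hB, hw']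
    simp only [map_sub, map_add, map_smul, smul_eq_mul, hB g₂ g₁, horth]
    field_simp; ring
  have hdet : g₁ 0 * g₂ 1 - g₁ 1 * g₂ 0 ≠ 0 := by
    intro h
    have hl : ∀ l, g₂ l • g₁ - g₁ l • g₂ = 0 := by
      intro l
      ext m
      fin_cases l <;> fin_cases m <;> simp [hg₁, hg₂] <;> linarith
    refine h₂ (funext fun l => ?_)
    have h3 := congrArg (B g₁) (hl l)
    simp only [map_sub, map_smul, smul_eq_mul, horth, mul_zero, sub_zero, map_zero] at h3
    exact (mul_eq_zero.1 h3).resolve_right hb₁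
  have hcr : (g₁ 0 * g₂ 1 - g₁ 1 * g₂ 0) • w' =
      (w' 0 * g₂ 1 - w' 1 * g₂ 0) • g₁ + (g₁ 0 * w' 1 - g₁ 1 * w' 0) • g₂ := by
    ext m
    fin_cases m
    · simp; ring
    · simp; ring
    · simp [hg₁, hg₂, hw'2]
  have h4 := congrArg (B w') hcr
  simp only [map_add, map_smul, smul_eq_mul, ho₁, ho₂, mul_zero, add_zero] at h4
  have h5 : w' = 0 := by
    by_contra h
    exact (mul_ne_zero hdet (hpos w' h).ne') h4
  exact sub_eq_zero.1 h5

end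

section

variable {p : ℕ} [Fact p.Prime] {B : LinearMap.BilinForm ℚ (Fin 3 → ℚ)}

/-- Lattices with plane section `Q` and elementary denominator `p ^ k` of the third coordinate. -/
structure IsExtensionLattice (p : ℕ) (B : LinearMap.BilinForm ℚ (Fin 3 → ℚ)) (k : ℕ)
    (Q M : Set (Fin 3 → ℚ)) : Prop extends IsPadicIntegral p B M where
  exists_third : ∃ f ∈ M, f 2 = (p : ℚ) ^ (-k : ℤ)
  third_ge : ∀ v ∈ M, PadicOrdGe p (-k) (v 2)
  mem_plane_iff : ∀ v, v ∈ Q ↔ v ∈ M ∧ v 2 = 0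

theorem PadicOrdGe.sq_sub_sq {k : ℤ} {x : ℚ} {n : ℤ} (hx : PadicOrdGe p 0 x)
    (h : PadicOrdGe p k (x - n)) : PadicOrdGe p k (x ^ 2 - (n : ℚ) ^ 2) := by
  have h2 := (hx.add (PadicOrdGe.intCast n)).mul_left h
  convert h2 using 1
  ring

theorem card_extensionLattice_le (hB : ∀ u v, B u v = B v u) (hpos : ∀ v, v ≠ 0 → 0 < B v v)
    {i j : ℕ} {Q : Set (Fin 3 → ℚ)} (hQ : IsPlaneLattice p B i j Q) {K : ℕ}
    (hK : padicValRat p (4 * (B (Pi.single 0 1) (Pi.single 0 1) *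
      B (Pi.single 1 1) (Pi.single 1 1) - B (Pi.single 0 1) (Pi.single 1 1) ^ 2)) ≤ K) (k : ℕ)
    (𝓜 : Finset (Set (Fin 3 → ℚ))) (h𝓜 : ∀ M ∈ 𝓜, IsExtensionLattice p B k Q M) :
    𝓜.card ≤ 2 * ((K + 1) * (K + 1)) * p ^ (K / 2) := by
  classical
  have hp : p.Prime := Fact.out
  have hp0 : (p : ℚ) ≠ 0 := by exact_mod_cast hp.ne_zero
  rcases 𝓜.eq_empty_or_nonempty with h0 | ⟨M₀, hM₀⟩
  · rw [h0]; simp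
  obtain ⟨g₁, hg₁, g₂, hg₂, hg₁0, hg₂0, horth, hst, hsum⟩ := hQ.exists_orthogonal hB hpos
  set b₁ := B g₁ g₁ with hb₁
  set b₂ := B g₂ g₂ with hb₂
  have hb₁0 : b₁ ≠ 0 := (hpos g₁ hg₁0).ne'
  have hb₂0 : b₂ ≠ 0 := (hpos g₂ hg₂0).ne'
  obtain ⟨s, hs⟩ := Int.eq_ofNat_of_zero_le ((hQ.integral g₁ hg₁ g₁ hg₁).le_of_ne_zero hb₁0)
  obtain ⟨t, ht⟩ := Int.eq_ofNat_of_zero_le ((hQ.integral g₂ hg₂ g₂ hg₂).le_of_ne_zero hb₂0)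
  rw [← hb₁] at hs
  rw [← hb₂] at ht
  have hle : s ≤ t := by omega
  have hstK : s + t ≤ K := by omega
  choose! g hgM hg using fun M hM => (h𝓜 M hM).exists_third
  have hmem : ∀ M ∈ 𝓜, ∀ v ∈ Q, v ∈ M := fun M hM v hv => (((h𝓜 M hM).mem_plane_iff v).1 hv).1
  have hint : ∀ v ∈ Q, ∀ M ∈ 𝓜, PadicOrdGe p 0 (B v (g M)) := fun v hv M hM =>
    (h𝓜 M hM).integral _ (hmem M hM v hv) _ (hgM M hM)
  choose! x hxlt hx using fun M hM => (hint g₁ hg₁ M hM).exists_natCast_sub s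
  choose! y hylt hy using fun M hM => (hint g₂ hg₂ M hM).exists_natCast_sub t
  have hdiff : ∀ M ∈ 𝓜, ∀ M' ∈ 𝓜, g M - g M' =
      ((B g₁ (g M) - B g₁ (g M')) / b₁) • g₁ + ((B g₂ (g M) - B g₂ (g M')) / b₂) • g₂ := by
    intro M hM M' hM'
    rw [← map_sub, ← map_sub]
    refine eq_orthogonal_expansion hpos hB hg₁0 hg₂0 horth (hQ.third_eq _ hg₁)
      (hQ.third_eq _ hg₂) ?_
    rw [Pi.sub_apply, hg M hM, hg M' hM', sub_self]
  have hinj : Set.InjOn (fun M => (x M, y M)) 𝓜 := by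
    have hsub : ∀ M ∈ 𝓜, ∀ M' ∈ 𝓜, x M = x M' → y M = y M' → M ⊆ M' := by
      intro M hM M' hM' hxx hyy
      have hL := h𝓜 M hM
      have hL' := h𝓜 M' hM'
      refine hL.toIsPadicIntegral.subset_of_generator hL'.toIsPadicIntegral 2 (hgM M hM)
        (hgM M' hM') (hg M hM) hL.third_ge
        (fun v hv hv2 => hmem M' hM' v ((hL.mem_plane_iff v).2 ⟨hv, hv2⟩)) ?_
      rw [hdiff M hM M' hM']
      refine hL'.add_mem _ (hL'.smul_mem _ ?_ _ (hmem M' hM' _ hg₁)) _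
        (hL'.smul_mem _ ?_ _ (hmem M' hM' _ hg₂))
      · have h := (hx M hM).sub (hx M' hM')
        rw [hxx, sub_sub_sub_cancel_right] at h
        exact (h.div hb₁0).mono (by omega)
      · have h := (hy M hM).sub (hy M' hM')
        rw [hyy, sub_sub_sub_cancel_right] at h
        exact (h.div hb₂0).mono (by omega)
    intro M hM M' hM' h
    obtain ⟨h1, h2⟩ := Prod.mk.inj h
    exact (hsub M hM M' hM' h1 h2).antisymm (hsub M' hM' M hM h1.symm h2.symm)
  set r := b₂ / b₁ / (p : ℚ) ^ (t - s) with hr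
  have hpts : (p : ℚ) ^ (t - s) ≠ 0 := pow_ne_zero _ hp0
  have hr0 : r ≠ 0 := div_ne_zero (div_ne_zero hb₂0 hb₁0) hpts
  have hrval : padicValRat p r = 0 := by
    rw [hr, padicValRat.div (div_ne_zero hb₂0 hb₁0) hpts, padicValRat.div hb₂0 hb₁0,
      padicValRat.pow, padicValRat.self hp.one_lt, hs, ht, Nat.cast_sub hle]
    ring
  have hrp : r * (p : ℚ) ^ (t - s) = b₂ / b₁ := div_mul_cancel₀ _ hpts
  obtain ⟨u, -, hu⟩ := PadicOrdGe.exists_natCast_sub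
    (show PadicOrdGe p 0 r from hrval ▸ PadicOrdGe.self) (t + 1)
  have hup : ¬ (p : ℤ) ∣ (u : ℤ) := by
    intro hd
    have h1 : PadicOrdGe p ((1 : ℕ) : ℤ) ((u : ℤ) : ℚ) :=
      PadicOrdGe.natCast_pow_iff.2 (by simpa using hd)
    have h2 := (hu.mono (by push_cast; omega : ((1 : ℕ) : ℤ) ≤ ((t + 1 : ℕ) : ℤ))).add h1
    rw [sub_add_cancel] at h2
    have := h2.le_of_ne_zero hr0
    rw [hrval] at this
    omega
  have happrox : ∀ M ∈ 𝓜, PadicOrdGe p t (b₂ / b₁ * B g₁ (g M) ^ 2 + B g₂ (g M) ^ 2 -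
      (u * (p : ℚ) ^ (t - s) * (x M : ℚ) ^ 2 + (y M : ℚ) ^ 2)) := by
    intro M hM
    have h1 : PadicOrdGe p t (b₂ / b₁ * (B g₁ (g M) ^ 2 - ((x M : ℤ) : ℚ) ^ 2)) := by
      have h3 : PadicOrdGe p (t - s : ℤ) (b₂ / b₁) := by
        refine Or.inr ?_
        rw [padicValRat.div hb₂0 hb₁0, hs, ht]
      have h2 := h3.mul ((hint g₁ hg₁ M hM).sq_sub_sq (hx M hM))
      exact h2.mono (by omega)
    have h2 : PadicOrdGe p t (((((p ^ (t - s) * x M ^ 2 : ℕ) : ℤ)) : ℚ) * (r - (u : ℤ))) :=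
      (PadicOrdGe.intCast _).mul_left (hu.mono (by push_cast; omega))
    have h3 := (h1.add h2).add ((hint g₂ hg₂ M hM).sq_sub_sq (hy M hM))
    convert h3 using 1
    push_cast
    linear_combination (-(x M : ℚ) ^ 2) * hrp
  have hnorm : ∀ M ∈ 𝓜, ∀ M' ∈ 𝓜, PadicOrdGe p t
      ((b₂ / b₁ * B g₁ (g M) ^ 2 + B g₂ (g M) ^ 2) -
        (b₂ / b₁ * B g₁ (g M') ^ 2 + B g₂ (g M') ^ 2)) := by
    intro M hM M' hM'
    have h1 : (b₂ / b₁ * B g₁ (g M) ^ 2 + B g₂ (g M) ^ 2) -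
        (b₂ / b₁ * B g₁ (g M') ^ 2 + B g₂ (g M') ^ 2) =
        (B (g M) (g M) - B (g M') (g M')) * b₂ := by
      have h2 : g M = g M' + (((B g₁ (g M) - B g₁ (g M')) / b₁) • g₁ +
          ((B g₂ (g M) - B g₂ (g M')) / b₂) • g₂) := by
        rw [← hdiff M hM M' hM']; abel
      generalize B g₁ (g M) = ξ₁ at h2 ⊢
      generalize B g₂ (g M) = ξ₂ at h2 ⊢
      rw [h2]
      simp only [map_add, map_smul, LinearMap.add_apply, LinearMap.smul_apply, smul_eq_mul,
        hB (g M') g₁, hB (g M') g₂, hB g₂ g₁, horth, ← hb₁, ← hb₂]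
      field_simp
      ring
    rw [h1]
    refine (((h𝓜 M hM).integral _ (hgM M hM) _ (hgM M hM)).sub
      ((h𝓜 M' hM').integral _ (hgM M' hM') _ (hgM M' hM'))).mul_left ?_
    have := PadicOrdGe.self (p := p) (x := b₂)
    rwa [ht] at this
  have hmaps : ∀ M ∈ 𝓜, (x M, y M) ∈
      (Finset.range (p ^ s) ×ˢ Finset.range (p ^ t)).filter fun xy : ℕ × ℕ =>
        (p : ℤ) ^ t ∣ (u : ℤ) * (p : ℤ) ^ (t - s) * (xy.1 : ℤ) ^ 2 + (xy.2 : ℤ) ^ 2 -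
          ((u : ℤ) * (p : ℤ) ^ (t - s) * (x M₀ : ℤ) ^ 2 + (y M₀ : ℤ) ^ 2) := by
    intro M hM
    refine Finset.mem_filter.2 ⟨Finset.mem_product.2 ⟨Finset.mem_range.2 (hxlt M hM),
      Finset.mem_range.2 (hylt M hM)⟩, ?_⟩
    rw [← PadicOrdGe.natCast_pow_iff]
    have h := ((hnorm M hM M₀ hM₀).sub (happrox M hM)).add (happrox M₀ hM₀)
    convert h using 1
    push_cast; ring
  calc 𝓜.card ≤ _ := Finset.card_le_card_of_injOn _ hmaps hinj
    _ ≤ 2 * ((t + 1) * (s + 1)) * p ^ ((s + t) / 2) := card_binary_congruence_le hp hle hup _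
    _ ≤ 2 * ((K + 1) * (K + 1)) * p ^ (K / 2) := by
        gcongr
        · omega
        · omega
        · exact hp.one_lt.le

theorem exists_isPlaneLattice_isExtensionLattice {M : Set (Fin 3 → ℚ)}
    (hM : IsPadicIntegral p B M) (hstd : ∀ l, Pi.single l 1 ∈ M) {e : ℕ}
    (he : ∀ v ∈ M, ∀ l, PadicOrdGe p (-e) (v l)) :
    ∃ i ≤ e, ∃ j ≤ e, ∃ k ≤ e, IsPlaneLattice p B i j {v ∈ M | v 2 = 0} ∧
      IsExtensionLattice p B k {v ∈ M | v 2 = 0} M := by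
  obtain ⟨i, hi, hi1, hi2⟩ := exists_eq_setOf_padicOrdGe (p := p) (e := e)
    (I := {x | x • (Pi.single 0 1 : Fin 3 → ℚ) ∈ M}) (by simpa using hstd 0)
    (fun r x hr hx => by rw [Set.mem_ofPred_eq, mul_smul]; exact hM.smul_mem r hr _ hx)
    (fun x hx => by simpa using he _ hx 0)
  obtain ⟨j, hj, ⟨fj, ⟨hfj, hfj2⟩, hfj1⟩, hj2⟩ := exists_eq_setOf_padicOrdGe (p := p) (e := e)
    (I := (fun v : Fin 3 → ℚ => v 1) '' {v ∈ M | v 2 = 0}) ⟨_, ⟨hstd 1, by simp⟩, by simp⟩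
    (by
      rintro r _ hr ⟨v, ⟨hv, hv2⟩, rfl⟩
      exact ⟨r • v, ⟨hM.smul_mem r hr v hv, by simp [hv2]⟩, by simp⟩)
    (by rintro _ ⟨v, ⟨hv, -⟩, rfl⟩; exact he v hv 1)
  obtain ⟨k, hk, ⟨fk, hfk, hfk2⟩, hk2⟩ := exists_eq_setOf_padicOrdGe (p := p) (e := e)
    (I := (fun v : Fin 3 → ℚ => v 2) '' M) ⟨_, hstd 2, by simp⟩
    (by
      rintro r _ hr ⟨v, hv, rfl⟩
      exact ⟨r • v, hM.smul_mem r hr v hv, by simp⟩)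
    (by rintro _ ⟨v, hv, rfl⟩; exact he v hv 2)
  refine ⟨i, hi, j, hj, k, hk, ?_, ?_⟩
  · exact
      { add_mem := fun u hu v hv => ⟨hM.add_mem u hu.1 v hv.1, by simp [hu.2, hv.2]⟩
        smul_mem := fun r hr v hv => ⟨hM.smul_mem r hr v hv.1, by simp [hv.2]⟩
        integral := fun u hu v hv => hM.integral u hu.1 v hv.1
        first_mem := ⟨hi1, by simp⟩
        exists_second := ⟨fj, ⟨hfj, hfj2⟩, hfj1⟩
        third_eq := fun v hv => hv.2
        second_ge := fun v hv => hj2 _ ⟨v, hv, rfl⟩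
        first_ge := fun v hv hv1 => hi2 _ (by
          have h : v 0 • (Pi.single 0 1 : Fin 3 → ℚ) = v := by
            ext l
            fin_cases l
            · simp
            · simp [hv1]
            · simp [hv.2]
          rw [Set.mem_ofPred_eq, h]
          exact hv.1) }
  · exact
      { toIsPadicIntegral := hM
        exists_third := ⟨fk, hfk, hfk2⟩
        third_ge := fun v hv => hk2 _ ⟨v, hv, rfl⟩
        mem_plane_iff := fun v => Iff.rfl }

theorem card_padicIntegral_le (hB : ∀ u v, B u v = B v u) (hpos : ∀ v, v ≠ 0 → 0 < B v v)
    {a K e : ℕ} (ha : padicValRat p (B (Pi.single 0 1) (Pi.single 0 1)) = a)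
    (hK : padicValRat p (4 * (B (Pi.single 0 1) (Pi.single 0 1) *
      B (Pi.single 1 1) (Pi.single 1 1) - B (Pi.single 0 1) (Pi.single 1 1) ^ 2)) ≤ K)
    (𝓜 : Finset (Set (Fin 3 → ℚ))) (h𝓜 : ∀ M ∈ 𝓜, IsPadicIntegral p B M)
    (hstd : ∀ M ∈ 𝓜, ∀ l, Pi.single l 1 ∈ M)
    (he : ∀ M ∈ 𝓜, ∀ v ∈ M, ∀ l, PadicOrdGe p (-e) (v l)) :
    𝓜.card ≤ 2 * ((K + 1) * (K + 1)) * p ^ (K / 2) * ((a + 1) * p ^ (a / 2)) * (e + 1) ^ 3 := by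
  classical
  choose! i hi j hj k hk hQ hM using fun M hM =>
    exists_isPlaneLattice_isExtensionLattice (h𝓜 M hM) (hstd M hM) (he M hM)
  have himg : (𝓜.image fun M => (i M, j M, k M)).card ≤ (e + 1) ^ 3 := by
    have hsub : (𝓜.image fun M => (i M, j M, k M)) ⊆
        Finset.range (e + 1) ×ˢ Finset.range (e + 1) ×ˢ Finset.range (e + 1) := by
      intro x hx
      obtain ⟨M, hM', rfl⟩ := Finset.mem_image.1 hx
      simp only [Finset.mem_product, Finset.mem_range, Nat.lt_succ_iff]
      exact ⟨hi M hM', hj M hM', hk M hM'⟩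
    refine (Finset.card_le_card hsub).trans_eq ?_
    simp only [Finset.card_product, Finset.card_range]
    ring
  refine (Finset.card_le_mul_card_image (f := fun M => (i M, j M, k M)) 𝓜
    (2 * ((K + 1) * (K + 1)) * p ^ (K / 2) * ((a + 1) * p ^ (a / 2))) ?_).trans
    (Nat.mul_le_mul_left _ himg)
  rintro ⟨i₀, j₀, k₀⟩ -
  set 𝓕 := 𝓜.filter fun M => (i M, j M, k M) = (i₀, j₀, k₀) with h𝓕
  have hmem : ∀ M ∈ 𝓕, M ∈ 𝓜 ∧ i M = i₀ ∧ j M = j₀ ∧ k M = k₀ := by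
    intro M hM'
    simpa [h𝓕] using hM'
  have hplane : (𝓕.image fun M => {v ∈ M | v 2 = 0}).card ≤ (a + 1) * p ^ (a / 2) := by
    refine card_planeLattice_le hB hpos ha i₀ j₀ _ fun Q hQ' => ?_
    obtain ⟨M, hM', rfl⟩ := Finset.mem_image.1 hQ'
    obtain ⟨h1, h2, h3, -⟩ := hmem M hM'
    rw [← h2, ← h3]
    exact hQ M h1
  refine (Finset.card_le_mul_card_image (f := fun M => {v ∈ M | v 2 = 0}) 𝓕
    (2 * ((K + 1) * (K + 1)) * p ^ (K / 2)) ?_).trans (Nat.mul_le_mul_left _ hplane)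
  intro Q hQ'
  obtain ⟨M, hM', rfl⟩ := Finset.mem_image.1 hQ'
  have hM1 := (hmem M hM').1
  refine card_extensionLattice_le hB hpos (hQ M hM1) hK k₀ _ fun M' hM'' => ?_
  obtain ⟨h4, h5⟩ := Finset.mem_filter.1 hM''
  obtain ⟨h1, -, -, h3⟩ := hmem M' h4
  rw [← h5, ← h3]
  exact hM M' h1

end

theorem exists_forall_pow_padicValInt_dvd {α : Type*} {p : ℕ} [Fact p.Prime] {f : α → ℤ}
    {S : Set α} (h : ∃ x ∈ S, f x ≠ 0) :
    ∃ m ∈ S, f m ≠ 0 ∧ ∀ x ∈ S, (p : ℤ) ^ padicValInt p (f m) ∣ f x := by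
  obtain ⟨x₀, hx₀, hf₀⟩ := h
  obtain ⟨m, ⟨hmS, hm⟩, hmin⟩ := WellFounded.has_min
    (measure fun x => padicValInt p (f x)).wf {x | x ∈ S ∧ f x ≠ 0} ⟨x₀, hx₀, hf₀⟩
  refine ⟨m, hmS, hm, fun x hx => ?_⟩
  rw [padicValInt_dvd_iff]
  by_cases hx0 : f x = 0
  · exact Or.inl hx0
  · exact Or.inr (not_lt.1 (hmin x ⟨hx, hx0⟩))

section

variable {V : Type*} [AddCommGroup V] {b : LinearMap.BilinForm ℤ V}

theorem dvd_two_mul_of_forall_dvd_self (hb : ∀ u v, b u v = b v u) {n : ℤ}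
    (h : ∀ w, n ∣ b w w) (u v : V) : n ∣ 2 * b u v := by
  have h1 := ((h (u + v)).sub (h u)).sub (h v)
  have h2 : b (u + v) (u + v) - b u u - b v v = 2 * b u v := by
    simp only [map_add, LinearMap.add_apply, hb v u]; ring
  rwa [h2] at h1

theorem pow_dvd_sixteen_mul_disc {p : ℕ} [Fact p.Prime] (hb : ∀ u v, b u v = b v u) {e : V}
    (he0 : b e e ≠ 0) (he : ∀ w, (p : ℤ) ^ padicValInt p (b e e) ∣ b w w) {d : ℕ}
    (hd : ∀ w, (p : ℤ) ^ d ∣ b e e * b w w - b e w ^ 2) (u₁ u₂ : V) :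
    (p : ℤ) ^ d ∣ 16 * (b u₁ u₁ * b u₂ u₂ - b u₁ u₂ ^ 2) := by
  have hpZ : Prime (p : ℤ) := Nat.prime_iff_prime_int.1 Fact.out
  set a := padicValInt p (b e e) with ha
  obtain ⟨α, hα⟩ := he e
  have hα' : ¬ (p : ℤ) ∣ α := by
    rintro ⟨c, hc⟩
    have h1 : (p : ℤ) ^ (a + 1) ∣ b e e := ⟨c, by rw [hα, hc]; ring⟩
    rw [padicValInt_dvd_iff] at h1
    rcases h1 with h1 | h1
    · exact he0 h1
    · omega
  have hβ := dvd_two_mul_of_forall_dvd_self hb he e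
  set δ : V → V → ℤ := fun u v => b e e * b u v - b e u * b e v with hδ
  have hδd : ∀ w, (p : ℤ) ^ d ∣ δ w w := fun w => by
    simpa only [hδ, ← sq] using hd w
  have hδa : ∀ w, (p : ℤ) ^ (2 * a) ∣ 4 * δ w w := fun w => by
    have h1 : 4 * δ w w = 4 * (b e e * b w w) - (2 * b e w) * (2 * b e w) := by
      simp only [hδ]; ring
    rw [h1, two_mul, pow_add]
    exact (dvd_mul_of_dvd_right (mul_dvd_mul (he e) (he w)) 4).sub (mul_dvd_mul (hβ w) (hβ w))
  have hpol : δ (u₁ + u₂) (u₁ + u₂) - δ u₁ u₁ - δ u₂ u₂ = 2 * δ u₁ u₂ := by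
    simp only [hδ, map_add, LinearMap.add_apply, hb u₂ u₁]; ring
  have h2d : (p : ℤ) ^ d ∣ 2 * δ u₁ u₂ :=
    hpol ▸ ((hδd (u₁ + u₂)).sub (hδd u₁)).sub (hδd u₂)
  have h8a : (p : ℤ) ^ (2 * a) ∣ 8 * δ u₁ u₂ := by
    have h1 : 8 * δ u₁ u₂ = 4 * δ (u₁ + u₂) (u₁ + u₂) - 4 * δ u₁ u₁ - 4 * δ u₂ u₂ := by
      linear_combination (-4) * hpol
    rw [h1]
    exact ((hδa (u₁ + u₂)).sub (hδa u₁)).sub (hδa u₂)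
  have hββ : ∀ u v, (p : ℤ) ^ (2 * a) ∣ 4 * (2 * b e u * (2 * b e v)) := fun u v => by
    rw [two_mul a, pow_add]
    exact dvd_mul_of_dvd_right (mul_dvd_mul (hβ u) (hβ v)) 4
  have hββ' : ∀ u v, (p : ℤ) ^ (2 * a) ∣ 2 * b e u * (2 * b e v) := fun u v => by
    rw [two_mul a, pow_add]
    exact mul_dvd_mul (hβ u) (hβ v)
  have hid : b e e ^ 2 * (16 * (b u₁ u₁ * b u₂ u₂ - b u₁ u₂ ^ 2)) =
      4 * (δ u₁ u₁ * (4 * δ u₂ u₂)) - 2 * δ u₁ u₂ * (8 * δ u₁ u₂) +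
      4 * (δ u₁ u₁ * (2 * b e u₂ * (2 * b e u₂))) + 4 * (δ u₂ u₂ * (2 * b e u₁ * (2 * b e u₁))) -
      2 * δ u₁ u₂ * (4 * (2 * b e u₁ * (2 * b e u₂))) := by
    simp only [hδ]; ring
  have hmain : (p : ℤ) ^ (d + 2 * a) ∣
      b e e ^ 2 * (16 * (b u₁ u₁ * b u₂ u₂ - b u₁ u₂ ^ 2)) := by
    rw [hid, pow_add]
    refine ((((dvd_mul_of_dvd_right (mul_dvd_mul (hδd u₁) (hδa u₂)) 4).sub
      (mul_dvd_mul h2d h8a)).add ?_).add ?_).sub (mul_dvd_mul h2d (hββ u₁ u₂))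
    · exact dvd_mul_of_dvd_right (mul_dvd_mul (hδd u₁) (hββ' u₂ u₂)) 4
    · exact dvd_mul_of_dvd_right (mul_dvd_mul (hδd u₂) (hββ' u₁ u₁)) 4
  have h1 : (p : ℤ) ^ (2 * a) * (p : ℤ) ^ d ∣
      (p : ℤ) ^ (2 * a) * (α ^ 2 * (16 * (b u₁ u₁ * b u₂ u₂ - b u₁ u₂ ^ 2))) := by
    rw [← pow_add, add_comm]
    convert hmain using 1
    rw [hα]; ring
  have h2 := (mul_dvd_mul_iff_left (pow_ne_zero _ hpZ.ne_zero)).1 h1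
  have hcop : IsCoprime ((p : ℤ) ^ d) (α ^ 2) :=
    (IsCoprime.pow_left ((Prime.coprime_iff_not_dvd hpZ).2 hα')).pow_right
  exact hcop.dvd_of_dvd_mul_left h2

end

section

variable {A : Matrix (Fin 3) (Fin 3) ℤ}

theorem dvd_mul_det_of_forall_dvd_disc (hA : A.IsSymm) {n c : ℤ}
    (h : ∀ u₁ u₂ : Fin 3 → ℤ, n ∣ c * (toBilin' A u₁ u₁ * toBilin' A u₂ u₂ -
      toBilin' A u₁ u₂ ^ 2)) : n ∣ 2 * c * A.det := by
  have h01 := hA.apply 0 1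
  have h02 := hA.apply 0 2
  have h12 := hA.apply 1 2
  have e1 := h ![0, 1, 0] ![0, 0, 1]
  have e2 := h ![0, 0, 1] ![1, 1, 0]
  have e3 := h ![0, 0, 1] ![1, 0, 0]
  have e4 := h ![0, 1, 0] ![1, 0, 1]
  have e5 := h ![0, 1, 0] ![1, 0, 0]
  have key := (dvd_mul_of_dvd_right e1 (2 * A 0 0)).sub (dvd_mul_of_dvd_right
    ((e2.sub e3).sub e1) (A 0 1)) |>.sub (dvd_mul_of_dvd_right ((e4.sub e5).sub e1) (A 0 2))
  refine key.trans (dvd_of_eq ?_)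
  simp [toBilin'_apply', det_fin_three, Matrix.mulVec, dotProduct, Fin.sum_univ_three, h01, h02,
    h12]
  ring

theorem disc_eq_crossProduct (hA : A.IsSymm) (u v : Fin 3 → ℤ) :
    toBilin' A u u * toBilin' A v v - toBilin' A u v ^ 2 =
      (crossProduct u v) ⬝ᵥ A.adjugate *ᵥ (crossProduct u v) := by
  have h01 := hA.apply 0 1
  have h02 := hA.apply 0 2
  have h12 := hA.apply 1 2
  rw [adjugate_fin_three]
  simp [toBilin'_apply', cross_apply, Matrix.mulVec, dotProduct, Fin.sum_univ_three, h01, h02, h12]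
  ring

end

theorem exists_disc_ne_zero {b : LinearMap.BilinForm ℤ (Fin 3 → ℤ)} (hb : ∀ u v, b u v = b v u)
    (hpos : ∀ v, v ≠ 0 → 0 < b v v) {e : Fin 3 → ℤ} (he : e ≠ 0) :
    ∃ w, b e e * b w w - b e w ^ 2 ≠ 0 := by
  by_contra! h
  have hα := hpos e he
  have hpar : ∀ w, b e e • w = b e w • e := by
    intro w
    by_contra hne
    have h1 := hpos _ (sub_ne_zero.2 hne)
    have h2 : b (b e e • w - b e w • e) (b e e • w - b e w • e) =
        b e e * (b e e * b w w - b e w ^ 2) := by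
      simp only [map_sub, map_smul, LinearMap.sub_apply, LinearMap.smul_apply, smul_eq_mul,
        hb w e]
      ring
    rw [h2, h w, mul_zero] at h1
    exact h1.false
  have h00 := congrFun (hpar (Pi.single 0 1)) 0
  have h01 := congrFun (hpar (Pi.single 0 1)) 1
  have h11 := congrFun (hpar (Pi.single 1 1)) 1
  simp only [Pi.smul_apply, smul_eq_mul, Pi.single_eq_same, mul_one, ne_eq, one_ne_zero,
    not_false_eq_true, Pi.single_eq_of_ne, mul_zero] at h00 h01 h11
  rcases mul_eq_zero.1 h01.symm with h2 | h2
  · rw [h2, zero_mul] at h00; exact hα.ne' h00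
  · rw [h2, mul_zero] at h11; exact hα.ne' h11

theorem toBilin'_map_intCast {n : ℕ} (A : Matrix (Fin n) (Fin n) ℤ) (u v : Fin n → ℤ) :
    toBilin' (A.map (Int.cast : ℤ → ℚ)) (fun l => (u l : ℚ)) (fun l => (v l : ℚ)) =
      ((toBilin' A u v : ℤ) : ℚ) := by
  simp [toBilin'_apply', Matrix.mulVec, dotProduct]

theorem toBilin'_comm {n : ℕ} {R : Type*} [CommRing R] {A : Matrix (Fin n) (Fin n) R}
    (hA : A.IsSymm) (u v : Fin n → R) : toBilin' A u v = toBilin' A v u := by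
  rw [toBilin'_apply', toBilin'_apply', dotProduct_mulVec, ← mulVec_transpose, hA.eq,
    dotProduct_comm]

theorem padicOrdGe_of_forall_mulVec {p : ℕ} [Fact p.Prime] {G : Matrix (Fin 3) (Fin 3) ℤ}
    (hG : G.det ≠ 0) {v : Fin 3 → ℚ}
    (h : ∀ m, PadicOrdGe p 0 ((G.map (Int.cast : ℤ → ℚ) *ᵥ v) m)) (m : Fin 3) :
    PadicOrdGe p (-padicValInt p G.det) (v m) := by
  have hG' : (G.det : ℚ) ≠ 0 := by exact_mod_cast hG
  have h1 : (G.det : ℚ) • v = (G.adjugate.map (Int.cast : ℤ → ℚ)) *ᵥ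
      (G.map (Int.cast : ℤ → ℚ) *ᵥ v) := by
    have h2 : G.adjugate.map (Int.cast : ℤ → ℚ) * G.map (Int.cast : ℤ → ℚ) =
        (G.det : ℚ) • (1 : Matrix (Fin 3) (Fin 3) ℚ) := by
      have h3 := congrArg (fun X : Matrix (Fin 3) (Fin 3) ℤ => X.map (Int.castRingHom ℚ))
        (adjugate_mul G)
      simp only [Matrix.map_mul] at h3
      rw [show G.adjugate.map (Int.cast : ℤ → ℚ) = G.adjugate.map (Int.castRingHom ℚ) from rfl,
        show G.map (Int.cast : ℤ → ℚ) = G.map (Int.castRingHom ℚ) from rfl, h3]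
      ext a b
      rcases eq_or_ne a b with rfl | hab
      · simp only [map_apply, Matrix.smul_apply, one_apply_eq, smul_eq_mul, mul_one, eq_intCast]
      · simp only [map_apply, Matrix.smul_apply, one_apply_ne hab, smul_eq_mul, mul_zero, map_zero]
    rw [mulVec_mulVec, h2, smul_mulVec, one_mulVec]
  have h2 : PadicOrdGe p 0 ((G.det : ℚ) * v m) := by
    have h3 := congrFun h1 m
    rw [Pi.smul_apply, smul_eq_mul] at h3
    rw [h3]
    rw [Matrix.mulVec, dotProduct]
    exact PadicOrdGe.sum fun l _ => (PadicOrdGe.intCast (G.adjugate m l)).mul_left (h l)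
  have h4 := h2.div hG'
  rw [mul_div_cancel_left₀ _ hG', padicValRat.of_int, zero_sub] at h4
  exact h4

theorem IsPadicIntegral.intCast_mem {p : ℕ} {B : LinearMap.BilinForm ℚ (Fin 3 → ℚ)}
    {M : Set (Fin 3 → ℚ)} (hM : IsPadicIntegral p B M) (hstd : ∀ l, Pi.single l 1 ∈ M)
    (v : Fin 3 → ℤ) : (fun l => (v l : ℚ)) ∈ M := by
  have h := hM.add_mem _ (hM.add_mem _ (hM.intCast_smul_mem (v 0) (hstd 0)) _
    (hM.intCast_smul_mem (v 1) (hstd 1))) _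
    (hM.intCast_smul_mem (v 2) (hstd 2))
  convert h using 1
  ext l
  fin_cases l <;> simp

theorem pow_padicValInt_bound {p a K d k : ℕ} [Fact p.Prime] {D : ℤ} (hD : D ≠ 0)
    (hpD : (p : ℤ) ∣ D) {δ β : ℤ} (hδ : δ ≠ 0) (hβ : β ≠ 0) (hK : K = padicValInt p (4 * δ))
    (h2a : 2 * a ≤ K) (hd : d = padicValInt p δ) (hdD : (p : ℤ) ^ d ∣ 2 * 16 * D)
    (hdβ : (p : ℤ) ^ d ∣ 16 * β) (hak : a ≤ k) {e : ℕ} (he : e ≤ padicValInt p D + d) :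
    2 * ((K + 1) * (K + 1)) * p ^ (K / 2) * ((a + 1) * p ^ (a / 2)) * (e + 1) ^ 3 ≤
      (padicValInt p D + 1) ^ 28 * (p ^ (k / 2) * p ^ (padicValInt p β / 2)) := by
  have hp : p.Prime := Fact.out
  set τ := padicValInt p 2 with hτ
  have hτ1 : τ = 0 ∨ (τ = 1 ∧ p = 2) := by
    by_cases h2 : p = 2
    · subst h2
      exact Or.inr ⟨by rw [hτ]; exact padicValInt.self (by norm_num), rfl⟩
    · left
      refine padicValInt.eq_zero_of_not_dvd fun h => h2 ?_
      exact (Nat.prime_dvd_prime_iff_eq hp Nat.prime_two).1 (by exact_mod_cast h)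
  have h4 : padicValInt p 4 = 2 * τ := by
    rw [show (4 : ℤ) = 2 * 2 by norm_num, padicValInt.mul (by norm_num) (by norm_num)]; omega
  have h16 : padicValInt p 16 = 4 * τ := by
    rw [show (16 : ℤ) = 4 * 4 by norm_num, padicValInt.mul (by norm_num) (by norm_num)]; omega
  have hKd : K = 2 * τ + d := by
    rw [hK, padicValInt.mul (by norm_num) hδ, h4, hd]
  set v := padicValInt p D with hv
  have hv1 : 1 ≤ v := by
    have h1 := (padicValInt_dvd_iff (p := p) 1 D).1 (by simpa using hpD)
    exact h1.resolve_left hD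
  have hd1 : d ≤ 5 * τ + v := by
    have h1 := ((padicValInt_dvd_iff (p := p) d _).1 hdD).resolve_left
      (mul_ne_zero (by norm_num) hD)
    rw [padicValInt.mul (by norm_num) hD, padicValInt.mul (by norm_num) (by norm_num), h16] at h1
    omega
  have hd2 : d ≤ 4 * τ + padicValInt p β := by
    have h1 := ((padicValInt_dvd_iff (p := p) d _).1 hdβ).resolve_left
      (mul_ne_zero (by norm_num) hβ)
    rwa [padicValInt.mul (by norm_num) hβ, h16] at h1
  have hpτ : p ^ (3 * τ) ≤ 8 := by
    rcases hτ1 with h | ⟨h, h'⟩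
    · simp [h]
    · simp [h, h']
  have hτle : τ ≤ 1 := by omega
  have hpK : p ^ (K / 2) ≤ 8 * p ^ (padicValInt p β / 2) := by
    calc p ^ (K / 2) ≤ p ^ (3 * τ + padicValInt p β / 2) :=
          Nat.pow_le_pow_right hp.pos (by omega)
      _ = p ^ (3 * τ) * p ^ (padicValInt p β / 2) := pow_add _ _ _
      _ ≤ _ := Nat.mul_le_mul_right _ hpτ
  have hpa : p ^ (a / 2) ≤ p ^ (k / 2) := Nat.pow_le_pow_right hp.pos (by omega)
  have h2v : 2 ≤ v + 1 := by omega
  calc 2 * ((K + 1) * (K + 1)) * p ^ (K / 2) * ((a + 1) * p ^ (a / 2)) * (e + 1) ^ 3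
      ≤ 2 * ((8 * (v + 1)) * (8 * (v + 1))) * (8 * p ^ (padicValInt p β / 2)) *
        ((8 * (v + 1)) * p ^ (k / 2)) * (8 * (v + 1)) ^ 3 := by
        gcongr <;> omega
    _ = 2 ^ 22 * ((v + 1) ^ 6 * (p ^ (k / 2) * p ^ (padicValInt p β / 2))) := by ring
    _ ≤ (v + 1) ^ 22 * ((v + 1) ^ 6 * (p ^ (k / 2) * p ^ (padicValInt p β / 2))) := by gcongr
    _ = _ := by ring

theorem isPadicIntegral_preimage {p : ℕ} {B : LinearMap.BilinForm ℚ (Fin 3 → ℚ)}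
    {M : Set (Fin 3 → ℚ)} (hM : IsPadicIntegral p B M) (f : (Fin 3 → ℚ) →ₗ[ℚ] (Fin 3 → ℚ)) :
    IsPadicIntegral p (B.comp f f) (f ⁻¹' M) where
  add_mem u hu v hv := by
    rw [Set.mem_preimage, map_add]
    exact hM.add_mem _ hu _ hv
  smul_mem r hr v hv := by
    rw [Set.mem_preimage, map_smul]
    exact hM.smul_mem r hr _ hv
  integral u hu v hv := hM.integral _ hu _ hv

/-- A frame adapted at `p` to a positive definite form: its first vector has a value of minimal
valuation, its first two vectors span a plane of almost minimal discriminant, and its determinant is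
controlled by that discriminant. -/
theorem exists_adapted_frame {p : ℕ} [Fact p.Prime] {A : Matrix (Fin 3) (Fin 3) ℤ}
    (hA : A.IsSymm) (hpos : ∀ v : Fin 3 → ℤ, v ≠ 0 → 0 < toBilin' A v v) :
    ∃ E : Matrix (Fin 3) (Fin 3) ℤ, E.det ≠ 0 ∧
      (∀ w, (p : ℤ) ^ padicValInt p (toBilin' A (E 0) (E 0)) ∣ toBilin' A w w) ∧
      (p : ℤ) ^ (2 * padicValInt p (toBilin' A (E 0) (E 0))) ∣
        4 * (toBilin' A (E 0) (E 0) * toBilin' A (E 1) (E 1) - toBilin' A (E 0) (E 1) ^ 2) ∧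
      toBilin' A (E 0) (E 0) * toBilin' A (E 1) (E 1) - toBilin' A (E 0) (E 1) ^ 2 ≠ 0 ∧
      (∀ u₁ u₂, (p : ℤ) ^ padicValInt p (toBilin' A (E 0) (E 0) * toBilin' A (E 1) (E 1) -
          toBilin' A (E 0) (E 1) ^ 2) ∣
        16 * (toBilin' A u₁ u₁ * toBilin' A u₂ u₂ - toBilin' A u₁ u₂ ^ 2)) ∧
      2 * padicValInt p E.det ≤ padicValInt p (toBilin' A (E 0) (E 0) * toBilin' A (E 1) (E 1) -
        toBilin' A (E 0) (E 1) ^ 2) := by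
  set b := toBilin' A with hb
  have hsymm : ∀ u v, b u v = b v u := toBilin'_comm hA
  obtain ⟨e₁, he₁, hα, he₁min⟩ := exists_forall_pow_padicValInt_dvd (p := p)
    (f := fun w => b w w) (S := {w | w ≠ 0})
    ⟨Pi.single 0 1, by simp, (hpos _ (by simp)).ne'⟩
  have he₁min' : ∀ w, (p : ℤ) ^ padicValInt p (b e₁ e₁) ∣ b w w := by
    intro w
    rcases eq_or_ne w 0 with rfl | hw
    · simp
    · exact he₁min w hw
  obtain ⟨w₀, hw₀⟩ := exists_disc_ne_zero hsymm hpos he₁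
  obtain ⟨e₂, -, hδ, he₂min⟩ := exists_forall_pow_padicValInt_dvd (p := p)
    (f := fun w => b e₁ e₁ * b w w - b e₁ w ^ 2) (S := Set.univ) ⟨w₀, trivial, hw₀⟩
  have hdisc := disc_eq_crossProduct hA e₁ e₂
  rw [← hb] at hdisc
  set w := crossProduct e₁ e₂ with hw
  have hw0 : ∃ l, w l ≠ 0 := by
    by_contra! h
    exact hδ (by rw [hdisc, show w = 0 from funext h, zero_dotProduct])
  obtain ⟨l, -, hl0, hlmin⟩ := exists_forall_pow_padicValInt_dvd (p := p) (f := w)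
    (S := Set.univ) (by simpa using hw0)
  have hdet : (Matrix.of ![e₁, e₂, Pi.single l 1]).det = w l := by
    rw [hw, cross_apply, det_fin_three]
    fin_cases l <;> simp; ring
  refine ⟨Matrix.of ![e₁, e₂, Pi.single l 1], by rw [hdet]; exact hl0, he₁min', ?_, hδ, ?_, ?_⟩
  · have h1 : 4 * (b e₁ e₁ * b e₂ e₂ - b e₁ e₂ ^ 2) =
        4 * (b e₁ e₁ * b e₂ e₂) - 2 * b e₁ e₂ * (2 * b e₁ e₂) := by ring
    have h2 := dvd_two_mul_of_forall_dvd_self hsymm he₁min' e₁ e₂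
    change (p : ℤ) ^ (2 * padicValInt p (b e₁ e₁)) ∣ 4 * (b e₁ e₁ * b e₂ e₂ - b e₁ e₂ ^ 2)
    rw [h1, two_mul, pow_add]
    exact (dvd_mul_of_dvd_right (mul_dvd_mul (he₁min' e₁) (he₁min' e₂)) 4).sub
      (mul_dvd_mul h2 h2)
  · exact pow_dvd_sixteen_mul_disc hsymm hα he₁min' fun w => he₂min w trivial
  · rw [hdet]
    change 2 * padicValInt p (w l) ≤ padicValInt p (b e₁ e₁ * b e₂ e₂ - b e₁ e₂ ^ 2)
    refine ((padicValInt_dvd_iff _ _).1 ?_).resolve_left hδ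
    rw [hdisc, dotProduct]
    refine Finset.dvd_sum fun m _ => ?_
    rw [two_mul, pow_add, Matrix.mulVec, dotProduct]
    exact mul_dvd_mul (hlmin m trivial)
      (Finset.dvd_sum fun n _ => dvd_mul_of_dvd_right (hlmin n trivial) _)

theorem card_padicIntegral_le_of_form {p : ℕ} [Fact p.Prime] {A : Matrix (Fin 3) (Fin 3) ℤ}
    (hA : A.IsSymm)
    (hpos : ∀ v : Fin 3 → ℚ, v ≠ 0 → 0 < toBilin' (A.map (Int.cast : ℤ → ℚ)) v v)
    (hD : A.det ≠ 0) (hpD : (p : ℤ) ∣ A.det) {x u₁ u₂ : Fin 3 → ℤ} (hx : toBilin' A x x ≠ 0)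
    (hu : toBilin' A u₁ u₁ * toBilin' A u₂ u₂ - toBilin' A u₁ u₂ ^ 2 ≠ 0)
    (𝓜 : Finset (Set (Fin 3 → ℚ)))
    (h𝓜 : ∀ M ∈ 𝓜, IsPadicIntegral p (toBilin' (A.map (Int.cast : ℤ → ℚ))) M)
    (hstd : ∀ M ∈ 𝓜, ∀ l, Pi.single l 1 ∈ M) :
    𝓜.card ≤ (padicValInt p A.det + 1) ^ 28 * (p ^ (padicValInt p (toBilin' A x x) / 2) *
      p ^ (padicValInt p (toBilin' A u₁ u₁ * toBilin' A u₂ u₂ - toBilin' A u₁ u₂ ^ 2) / 2)) := by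
  classical
  set b := toBilin' A with hb
  have hposZ : ∀ v : Fin 3 → ℤ, v ≠ 0 → 0 < b v v := by
    intro v hv
    have h := hpos (fun l => (v l : ℚ)) fun h => hv (funext fun l => by
      simpa using congrFun h l)
    rw [toBilin'_map_intCast] at h
    exact_mod_cast h
  obtain ⟨E, hE, hmin, h2a, hδ, hdisc, hdet⟩ := exists_adapted_frame (p := p) hA hposZ
  rw [← hb] at hmin h2a hδ hdisc hdet
  set δ := b (E 0) (E 0) * b (E 1) (E 1) - b (E 0) (E 1) ^ 2 with hδdef
  have hα : b (E 0) (E 0) ≠ 0 := (hposZ _ fun h => hE (det_eq_zero_of_row_eq_zero 0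
    fun j => congrFun h j)).ne'
  set f := toLin' (E.map (Int.cast : ℤ → ℚ))ᵀ with hf
  have hEQ : (E.map (Int.cast : ℤ → ℚ)).det ≠ 0 := by
    rw [← Int.cast_det]
    exact_mod_cast hE
  have hfinj : Function.Injective f := by
    have h := mulVec_injective_iff_isUnit.2 ((isUnit_iff_isUnit_det _).2
      (isUnit_iff_ne_zero.2 (by rwa [det_transpose] :
        (E.map (Int.cast : ℤ → ℚ))ᵀ.det ≠ 0)))
    exact h
  have hfsurj : Function.Surjective f := LinearMap.injective_iff_surjective.1 hfinj
  have hfs : ∀ l, f (Pi.single l 1) = fun m => (E l m : ℚ) := by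
    intro l
    rw [hf, toLin'_apply, mulVec_single_one]
    rfl
  set B := (toBilin' (A.map (Int.cast : ℤ → ℚ))).comp f f with hBdef
  have hBs : ∀ l m, B (Pi.single l 1) (Pi.single m 1) = ((b (E l) (E m) : ℤ) : ℚ) := by
    intro l m
    rw [hBdef, LinearMap.BilinForm.comp_apply, hfs, hfs]
    exact toBilin'_map_intCast A (E l) (E m)
  have hB : ∀ u v, B u v = B v u := fun u v => toBilin'_comm (hA.map _) _ _
  have hBpos : ∀ v, v ≠ 0 → 0 < B v v := fun v hv =>
    hpos _ fun h => hv (hfinj (by rw [h, map_zero]))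
  have hcard : (𝓜.image fun M => f ⁻¹' M).card = 𝓜.card :=
    Finset.card_image_of_injective _ (Set.preimage_injective.2 hfsurj)
  rw [← hcard]
  have hG : (E * A * Eᵀ).det ≠ 0 := by
    rw [det_mul, det_mul, det_transpose]
    exact mul_ne_zero (mul_ne_zero hE hD) hE
  have hGval : padicValInt p (E * A * Eᵀ).det ≤ padicValInt p A.det + padicValInt p δ := by
    rw [det_mul, det_mul, det_transpose, padicValInt.mul (mul_ne_zero hE hD) hE,
      padicValInt.mul hE hD]
    omega
  have hGB : ∀ v m, ((E * A * Eᵀ).map (Int.cast : ℤ → ℚ) *ᵥ v) m = B (Pi.single m 1) v := by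
    intro v m
    have h : (E * A * Eᵀ).map (Int.cast : ℤ → ℚ) = (E.map (Int.cast : ℤ → ℚ))ᵀᵀ *
        A.map (Int.cast : ℤ → ℚ) * (E.map (Int.cast : ℤ → ℚ))ᵀ := by
      rw [transpose_transpose, ← transpose_map]
      exact (Matrix.map_mul (f := Int.castRingHom ℚ)).trans
        (congrArg (· * Eᵀ.map (Int.castRingHom ℚ)) Matrix.map_mul)
    rw [hBdef, hf, toBilin'_comp, ← h, toBilin'_apply', single_one_dotProduct]
  refine (card_padicIntegral_le hB hBpos (a := padicValInt p (b (E 0) (E 0)))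
    (K := padicValInt p (4 * δ)) (e := padicValInt p (E * A * Eᵀ).det) ?_ ?_ _ ?_ ?_ ?_).trans
    (pow_padicValInt_bound hD hpD hδ hu rfl ?_ rfl ?_ (hdisc u₁ u₂) ?_ hGval)
  · rw [hBs, padicValRat.of_int]
  · rw [hBs, hBs, hBs, ← padicValRat.of_int]
    push_cast [hδdef]
    exact le_rfl
  · intro M' hM'
    obtain ⟨M, hM, rfl⟩ := Finset.mem_image.1 hM'
    exact isPadicIntegral_preimage (h𝓜 M hM) f
  · intro M' hM' l
    obtain ⟨M, hM, rfl⟩ := Finset.mem_image.1 hM'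
    rw [Set.mem_preimage, hfs]
    exact (h𝓜 M hM).intCast_mem (hstd M hM) (E l)
  · intro M' hM' v hv l
    obtain ⟨M, hM, rfl⟩ := Finset.mem_image.1 hM'
    refine padicOrdGe_of_forall_mulVec hG (fun m => ?_) l
    rw [hGB, hBdef, LinearMap.BilinForm.comp_apply, hfs]
    exact (h𝓜 M hM).integral _ ((h𝓜 M hM).intCast_mem (hstd M hM) (E m)) _ hv
  · exact ((padicValInt_dvd_iff _ _).1 h2a).resolve_left (mul_ne_zero (by norm_num) hδ)
  · exact dvd_mul_det_of_forall_dvd_disc hA hdisc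
  · exact ((padicValInt_dvd_iff _ _).1 (hmin x)).resolve_left hx

/-- The localization at `p` of the rational lattice `D⁻¹ N`. -/
def localLattice (p : ℕ) (D : ℤ) (N : Submodule ℤ (Fin 3 → ℤ)) : Set (Fin 3 → ℚ) :=
  {v | ∃ d : ℤ, ¬ (p : ℤ) ∣ d ∧ ∃ u ∈ N, ∀ l, (d * D : ℚ) * v l = u l}

section

variable {p : ℕ} [Fact p.Prime] {A : Matrix (Fin 3) (Fin 3) ℤ} {D : ℤ}
  {N N' : Submodule ℤ (Fin 3 → ℤ)}

theorem isPadicIntegral_localLattice (hD : D ≠ 0)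
    (hN : ∀ u ∈ N, ∀ u' ∈ N, D ^ 2 ∣ toBilin' A u u') :
    IsPadicIntegral p (toBilin' (A.map (Int.cast : ℤ → ℚ))) (localLattice p D N) where
  add_mem := by
    rintro v ⟨d, hd, u, hu, h⟩ v' ⟨d', hd', u', hu', h'⟩
    have hpZ : Prime (p : ℤ) := Nat.prime_iff_prime_int.1 Fact.out
    refine ⟨d * d', hpZ.not_dvd_mul hd hd', d' • u + d • u',
      N.add_mem (N.smul_mem _ hu) (N.smul_mem _ hu'), fun l => ?_⟩
    simp only [Pi.add_apply, Pi.smul_apply, smul_eq_mul]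
    push_cast
    rw [← h l, ← h' l]; ring
  smul_mem := by
    rintro r hr v ⟨d, hd, u, hu, h⟩
    have hpZ : Prime (p : ℤ) := Nat.prime_iff_prime_int.1 Fact.out
    refine ⟨d * r.den, hpZ.not_dvd_mul hd ?_, r.num • u, N.smul_mem _ hu, fun l => ?_⟩
    · exact_mod_cast PadicOrdGe.not_dvd_den Fact.out hr
    · simp only [Pi.smul_apply, smul_eq_mul]
      push_cast
      rw [← h l, ← Rat.mul_den_eq_num r]; ring
  integral := by
    rintro v ⟨d, hd, u, hu, h⟩ v' ⟨d', hd', u', hu', h'⟩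
    have hpZ : Prime (p : ℤ) := Nat.prime_iff_prime_int.1 Fact.out
    obtain ⟨z, hz⟩ := hN u hu u' hu'
    have hDQ : (D : ℚ) ≠ 0 := by exact_mod_cast hD
    have hdd : ((d * d' : ℤ) : ℚ) ≠ 0 := by
      rw [Int.cast_ne_zero]
      exact fun h0 => hpZ.not_dvd_mul hd hd' (by rw [h0]; exact dvd_zero _)
    have h1 : (fun l => (u l : ℚ)) = (d * D : ℚ) • v := funext fun l => (h l).symm
    have h2 : (fun l => (u' l : ℚ)) = (d' * D : ℚ) • v' := funext fun l => (h' l).symm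
    have h3 := toBilin'_map_intCast A u u'
    rw [h1, h2, hz, map_smul, map_smul, LinearMap.smul_apply, smul_eq_mul, smul_eq_mul] at h3
    push_cast at h3
    have h4 : toBilin' (A.map (Int.cast : ℤ → ℚ)) v v' = (z : ℚ) / ((d * d' : ℤ) : ℚ) := by
      rw [eq_div_iff hdd]
      push_cast
      have h5 : (D : ℚ) ^ 2 * (toBilin' (A.map (Int.cast : ℤ → ℚ)) v v' * (d * d')) =
          (D : ℚ) ^ 2 * z := by linear_combination h3
      exact mul_left_cancel₀ (pow_ne_zero 2 hDQ) h5
    rw [h4]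
    have h6 := (PadicOrdGe.intCast (p := p) z).div hdd
    rwa [padicValRat.of_int, padicValInt.eq_zero_of_not_dvd (hpZ.not_dvd_mul hd hd'),
      Nat.cast_zero, sub_zero] at h6

theorem single_mem_localLattice (hN : ∀ w, D • w ∈ N) (l : Fin 3) :
    Pi.single l 1 ∈ localLattice p D N := by
  have hpZ : Prime (p : ℤ) := Nat.prime_iff_prime_int.1 Fact.out
  refine ⟨1, hpZ.not_dvd_one, D • Pi.single l 1, hN _, fun m => ?_⟩
  rcases eq_or_ne m l with rfl | h
  · simp
  · simp [h]

theorem le_of_forall_localLattice_subset (hD : D ≠ 0) (hN' : ∀ w, D • w ∈ N')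
    (h : ∀ p : ℕ, p.Prime → (p : ℤ) ∣ D → localLattice p D N ⊆ localLattice p D N') :
    N ≤ N' := by
  intro u hu
  let I : Ideal ℤ := N'.comap (LinearMap.toSpanSingleton ℤ (Fin 3 → ℤ) u)
  have hI : ∀ d, d ∈ I ↔ d • u ∈ N' := fun d => Iff.rfl
  suffices h1 : (1 : ℤ) ∈ I by simpa [hI] using h1
  rw [← Ideal.eq_top_iff_one]
  by_contra hne
  obtain ⟨g, hg⟩ := IsPrincipalIdealRing.principal I
  have hdvd : ∀ d, d ∈ I ↔ g ∣ d := fun d => by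
    rw [hg]; exact Ideal.mem_span_singleton
  have hgu : g.natAbs ≠ 1 := fun h1 => hne (by
    rw [Ideal.eq_top_iff_one, hdvd]
    exact (Int.isUnit_iff_natAbs_eq.2 h1).dvd)
  obtain ⟨p, hp, hpg⟩ := Nat.exists_prime_and_dvd hgu
  have hpg' : (p : ℤ) ∣ g := Int.natCast_dvd.2 hpg
  have hpD : (p : ℤ) ∣ D := hpg'.trans ((hdvd D).1 (hN' u))
  have hDQ : (D : ℚ) ≠ 0 := by exact_mod_cast hD
  have hv : (fun l => (u l : ℚ) / D) ∈ localLattice p D N := by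
    refine ⟨1, (Nat.prime_iff_prime_int.1 hp).not_dvd_one, u, hu, fun l => ?_⟩
    push_cast
    field_simp
  obtain ⟨d, hd, u', hu', hdu⟩ := h p hp hpD hv
  refine hd (hpg'.trans ((hdvd d).1 ((hI d).2 ?_)))
  convert hu' using 1
  ext l
  have h1 := hdu l
  rw [mul_assoc, mul_div_cancel₀ _ hDQ] at h1
  simpa using (by exact_mod_cast h1 : d * u l = u' l)

end

theorem card_le_prod_card_image_localLattice [DecidableEq (Set (Fin 3 → ℚ))] {D : ℤ} (hD : D ≠ 0)
    (𝓝 : Finset (Submodule ℤ (Fin 3 → ℤ))) (h𝓝 : ∀ N ∈ 𝓝, ∀ w, D • w ∈ N) :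
    𝓝.card ≤ ∏ p ∈ D.natAbs.primeFactors, (𝓝.image (localLattice p D)).card := by
  classical
  rw [← Finset.card_pi]
  refine Finset.card_le_card_of_injOn (fun N p _ => localLattice p D N) (fun N hN => ?_) ?_
  · exact Finset.mem_pi.2 fun p _ => Finset.mem_image_of_mem _ hN
  · intro N hN N' hN' h
    have hloc : ∀ p : ℕ, p.Prime → (p : ℤ) ∣ D → localLattice p D N = localLattice p D N' :=
      fun p hp hpD => congrFun (congrFun h p) (Nat.mem_primeFactors.2
        ⟨hp, Int.natCast_dvd.1 hpD, Int.natAbs_ne_zero.2 hD⟩)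
    exact (le_of_forall_localLattice_subset hD (h𝓝 N' hN') fun p hp hpD =>
      (hloc p hp hpD).subset).antisymm (le_of_forall_localLattice_subset hD (h𝓝 N hN)
      fun p hp hpD => (hloc p hp hpD).symm.subset)

theorem card_integral_overlattices_le {A : Matrix (Fin 3) (Fin 3) ℤ} (hA : A.IsSymm)
    (hpos : ∀ v : Fin 3 → ℚ, v ≠ 0 → 0 < toBilin' (A.map (Int.cast : ℤ → ℚ)) v v)
    (hD : A.det ≠ 0) (𝓝 : Finset (Submodule ℤ (Fin 3 → ℤ)))
    (h𝓝 : ∀ N ∈ 𝓝, ∀ w, A.det • w ∈ N)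
    (hint : ∀ N ∈ 𝓝, ∀ u ∈ N, ∀ u' ∈ N, A.det ^ 2 ∣ toBilin' A u u') {k₁ k₂ : ℕ → ℕ}
    (hk₁ : ∀ p, p.Prime → ∃ x, toBilin' A x x ≠ 0 ∧ padicValInt p (toBilin' A x x) = k₁ p)
    (hk₂ : ∀ p, p.Prime → ∃ u v, toBilin' A u u * toBilin' A v v - toBilin' A u v ^ 2 ≠ 0 ∧
      padicValInt p (toBilin' A u u * toBilin' A v v - toBilin' A u v ^ 2) = k₂ p) :
    𝓝.card ≤ A.det.natAbs.divisors.card ^ 28 *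
      ∏ p ∈ A.det.natAbs.primeFactors, p ^ (k₁ p / 2) * p ^ (k₂ p / 2) := by
  classical
  rw [Nat.card_divisors (Int.natAbs_ne_zero.2 hD), ← Finset.prod_pow, ← Finset.prod_mul_distrib]
  refine (card_le_prod_card_image_localLattice hD 𝓝 h𝓝).trans ?_
  refine Finset.prod_le_prod' fun p hp => ?_
  obtain ⟨hp, hpD, -⟩ := Nat.mem_primeFactors.1 hp
  have := Fact.mk hp
  obtain ⟨x, hx, hx'⟩ := hk₁ p hp
  obtain ⟨u, v, hu, hu'⟩ := hk₂ p hp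
  have h := card_padicIntegral_le_of_form hA hpos hD (Int.natCast_dvd.2 hpD) hx hu
    (𝓝.image (localLattice p A.det)) (fun M hM => ?_) (fun M hM => ?_)
  · rw [hx', hu', padicValInt, ← Nat.factorization_def _ hp] at h
    exact h
  · obtain ⟨N, hN, rfl⟩ := Finset.mem_image.1 hM
    exact isPadicIntegral_localLattice hD (hint N hN)
  · obtain ⟨N, hN, rfl⟩ := Finset.mem_image.1 hM
    exact single_mem_localLattice (h𝓝 N hN)

section

variable {n : ℕ} {M : Matrix (Fin n) (Fin n) ℚ} {A : Matrix (Fin n) (Fin n) ℤ}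

theorem two_pow_mul_gramDet (hA : A.map (Int.cast : ℤ → ℚ) = (2 : ℚ) • M) {j : ℕ}
    (u : Fin j → Fin n → ℤ) :
    2 ^ j * gramDet M u = ((Matrix.of fun a b => toBilin' A (u a) (u b)).det : ℤ) := by
  rw [gramDet, Int.cast_det]
  have hsmul (G : Matrix (Fin j) (Fin j) ℚ) : 2 ^ j * G.det = ((2 : ℚ) • G).det := by
    rw [det_smul, Fintype.card_fin]
  rw [hsmul]
  congr 1
  ext a b
  have h := toBilin'_map_intCast A (u a) (u b)
  rw [hA, toBilin'_apply', smul_mulVec, dotProduct_smul] at h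
  exact h

theorem mem_span_range_single_of_mem_span_cast {j : ℕ} {ι : Fin j → Fin n}
    (hι : Function.Injective ι) {w : Fin n → ℤ}
    (hw : (fun i => ((w i : ℚ))) ∈ Submodule.span ℚ (Set.range fun a => fun i =>
      (((Pi.single (ι a) 1 : Fin n → ℤ) i : ℚ)))) :
    w ∈ Submodule.span ℤ (Set.range fun a => (Pi.single (ι a) 1 : Fin n → ℤ)) := by
  obtain ⟨c, hc⟩ := (Submodule.mem_span_range_iff_exists_fun ℚ).1 hw
  rw [Submodule.mem_span_range_iff_exists_fun]
  refine ⟨fun a => w (ι a), ?_⟩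
  ext i
  have hci := congrFun hc i
  simp only [Finset.sum_apply, Pi.smul_apply, smul_eq_mul] at hci ⊢
  by_cases hi : ∃ a, ι a = i
  · obtain ⟨a, rfl⟩ := hi
    rw [Finset.sum_eq_single a]
    · simp
    · intro b _ hb
      rw [Pi.single_eq_of_ne (fun h => hb (hι h.symm)), mul_zero]
    · simp
  · push Not at hi
    rw [Finset.sum_eq_zero fun a _ => by rw [Pi.single_eq_of_ne (hi a).symm, mul_zero]]
    rw [Finset.sum_eq_zero fun a _ => by
      rw [Pi.single_eq_of_ne (hi a).symm, Int.cast_zero, mul_zero]] at hci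
    exact_mod_cast hci

theorem exists_padicValInt_det_eq_kSum (hA : A.map (Int.cast : ℤ → ℚ) = (2 : ℚ) • M) {j : ℕ}
    {ι : Fin j → Fin n} (hι : Function.Injective ι)
    (hdet : (Matrix.of fun a b => toBilin' A (Pi.single (ι a) 1) (Pi.single (ι b) 1)).det ≠ 0)
    (p : ℕ) :
    ∃ u : Fin j → Fin n → ℤ, (Matrix.of fun a b => toBilin' A (u a) (u b)).det ≠ 0 ∧
      padicValInt p (Matrix.of fun a b => toBilin' A (u a) (u b)).det = kSum M j p := by
  have hmem : kSum M j p ∈ {v : ℕ | ∃ u : Fin j → Fin n → ℤ,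
      LinearIndependent ℤ u ∧
      (∀ w : Fin n → ℤ,
        (fun i => ((w i : ℚ))) ∈
            Submodule.span ℚ (Set.range fun a => fun i => ((u a i : ℚ))) →
          w ∈ Submodule.span ℤ (Set.range u)) ∧
      2 ^ j * gramDet M u ≠ 0 ∧
      (v : ℤ) = padicValRat p (2 ^ j * gramDet M u)} := by
    refine Nat.sInf_mem ⟨padicValInt p (Matrix.of fun a b =>
      toBilin' A (Pi.single (ι a) 1) (Pi.single (ι b) 1)).det,
      fun a => Pi.single (ι a) 1, ?_, fun w hw => ?_, ?_, ?_⟩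
    · have h := (Pi.basisFun ℤ (Fin n)).linearIndependent.comp ι hι
      have heq : (fun a => Pi.single (ι a) 1) = ⇑(Pi.basisFun ℤ (Fin n)) ∘ ι := by
        ext a
        simp
      rw [heq]
      exact h
    · exact mem_span_range_single_of_mem_span_cast hι hw
    · rw [two_pow_mul_gramDet hA]
      exact_mod_cast hdet
    · rw [two_pow_mul_gramDet hA, padicValRat.of_int]
  obtain ⟨u, -, -, h0, hv⟩ := hmem
  rw [two_pow_mul_gramDet hA] at h0 hv
  rw [padicValRat.of_int] at hv
  exact ⟨u, by exact_mod_cast h0, by exact_mod_cast hv.symm⟩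

theorem exists_padicValInt_eq_kSum_one (hA : A.map (Int.cast : ℤ → ℚ) = (2 : ℚ) • M)
    (hpos : ∀ v : Fin n → ℤ, v ≠ 0 → 0 < toBilin' A v v) (i : Fin n) (p : ℕ) :
    ∃ x, toBilin' A x x ≠ 0 ∧ padicValInt p (toBilin' A x x) = kSum M 1 p := by
  obtain ⟨u, h0, hu⟩ := exists_padicValInt_det_eq_kSum hA (ι := fun _ : Fin 1 => i)
    (Function.injective_of_subsingleton _) (by
      rw [det_fin_one, of_apply]
      exact (hpos _ (by simp)).ne') p
  rw [det_fin_one, of_apply] at h0 hu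
  exact ⟨u 0, h0, hu⟩

end

theorem exists_padicValInt_eq_kSum_two {M : Matrix (Fin 3) (Fin 3) ℚ}
    {A : Matrix (Fin 3) (Fin 3) ℤ} (hA : A.map (Int.cast : ℤ → ℚ) = (2 : ℚ) • M)
    (hsymm : A.IsSymm) (hdisc : A 0 0 * A 1 1 - A 0 1 ^ 2 ≠ 0) (p : ℕ) :
    ∃ u v, toBilin' A u u * toBilin' A v v - toBilin' A u v ^ 2 ≠ 0 ∧
      padicValInt p (toBilin' A u u * toBilin' A v v - toBilin' A u v ^ 2) = kSum M 2 p := by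
  have hdet : ∀ u : Fin 2 → Fin 3 → ℤ, (Matrix.of fun a b => toBilin' A (u a) (u b)).det =
      toBilin' A (u 0) (u 0) * toBilin' A (u 1) (u 1) - toBilin' A (u 0) (u 1) ^ 2 := by
    intro u
    rw [det_fin_two]
    simp only [of_apply]
    rw [toBilin'_comm hsymm (u 1) (u 0), sq]
  obtain ⟨u, h0, hu⟩ := exists_padicValInt_det_eq_kSum hA (ι := ![(0 : Fin 3), 1]) (by decide)
    (by
      rw [hdet fun a => Pi.single (![(0 : Fin 3), 1] a) 1]
      simpa [toBilin'_single] using hdisc) p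
  rw [hdet] at h0 hu
  exact ⟨u 0, u 1, h0, hu⟩

theorem exists_eq_natCast_of_padicValRat_nonneg {m : ℚ} (hm : 0 < m)
    (h : ∀ p : ℕ, p.Prime → 0 ≤ padicValRat p m) : ∃ n : ℕ, m = n := by
  have hden : m.den = 1 := by
    by_contra hne
    obtain ⟨p, hp, hpd⟩ := Nat.exists_prime_and_dvd hne
    have := Fact.mk hp
    exact PadicOrdGe.not_dvd_den hp (Or.inr (h p hp)) hpd
  refine ⟨m.num.toNat, ?_⟩
  rw [← Rat.coe_int_num_of_den_eq_one hden]
  have : 0 ≤ m.num := (Rat.num_pos.2 hm).le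
  exact_mod_cast (Int.toNat_of_nonneg this).symm

theorem prod_prime_pow_dvd {P : Finset ℕ} (hP : ∀ p ∈ P, p.Prime) {k : ℕ → ℕ} {n : ℕ}
    (h : ∀ p ∈ P, p ^ k p ∣ n) : ∏ p ∈ P, p ^ k p ∣ n :=
  Finset.prod_dvd_of_isRelPrime (fun p hp q hq hpq => Nat.coprime_iff_isRelPrime.1
    (((Nat.coprime_primes (hP p hp) (hP q hq)).2 hpq).pow _ _)) h

theorem prod_pow_half_kSum_le {n : ℕ} {Mq : Matrix (Fin n) (Fin n) ℚ} {m1 m2 : ℚ} {m2' : ℕ}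
    (h : IsM1M2M2' Mq m1 m2 m2') {P : Finset ℕ} (hP : ∀ p ∈ P, p.Prime) :
    ((∏ p ∈ P, p ^ (kSum Mq 1 p / 2) * p ^ (kSum Mq 2 p / 2) : ℕ) : ℚ) ≤ m1 * m2' := by
  obtain ⟨hm1, hv1, hm2, hv2, hm2', ⟨z, hz⟩, hmax⟩ := h
  obtain ⟨n1, rfl⟩ := exists_eq_natCast_of_padicValRat_nonneg hm1 fun p hp => by
    rw [hv1 p hp]; positivity
  have hm2int : m2 = ((m2' ^ 2 * z : ℤ) : ℚ) := by rw [hz]; push_cast; ring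
  have hk : ∀ p, p.Prime → kSum Mq 1 p ≤ kSum Mq 2 p := fun p hp => by
    have h1 := hv2 p hp
    rw [hm2int, padicValRat.of_int] at h1
    omega
  obtain ⟨n2, rfl⟩ := exists_eq_natCast_of_padicValRat_nonneg hm2 fun p hp => by
    rw [hv2 p hp]
    have := hk p hp
    omega
  have hn1 : 0 < n1 := by exact_mod_cast hm1
  have hn2 : 0 < n2 := by exact_mod_cast hm2
  have hd1 : ∏ p ∈ P, p ^ kSum Mq 1 p ∣ n1 := prod_prime_pow_dvd hP fun p hp => by
    have := Fact.mk (hP p hp)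
    have h1 := hv1 p (hP p hp)
    rw [padicValRat.of_nat] at h1
    rw [padicValNat_dvd_iff_le hn1.ne']
    omega
  have hd2 : ∏ p ∈ P, p ^ ((kSum Mq 2 p - kSum Mq 1 p) / 2 * 2) ∣ n2 :=
    prod_prime_pow_dvd hP fun p hp => by
      have := Fact.mk (hP p hp)
      have h1 := hv2 p (hP p hp)
      have h2 := hk p (hP p hp)
      rw [padicValRat.of_nat] at h1
      rw [padicValNat_dvd_iff_le hn2.ne']
      omega
  obtain ⟨c, hc⟩ := hd2
  have hle2 : ∏ p ∈ P, p ^ ((kSum Mq 2 p - kSum Mq 1 p) / 2) ≤ m2' := by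
    refine hmax _ (Finset.prod_pos fun p hp => pow_pos (hP p hp).pos _) ⟨c, ?_⟩
    rw [hc]
    simp only [pow_mul, Finset.prod_pow]
    push_cast
    ring
  have hle : ∏ p ∈ P, p ^ (kSum Mq 1 p / 2) * p ^ (kSum Mq 2 p / 2) ≤ n1 * m2' := by
    refine le_trans ?_ (Nat.mul_le_mul (Nat.le_of_dvd hn1 hd1) hle2)
    rw [← Finset.prod_mul_distrib]
    refine Finset.prod_le_prod' fun p hp => ?_
    rw [← pow_add, ← pow_add]
    have := hk p (hP p hp)
    exact Nat.pow_le_pow_right (hP p hp).pos (by omega)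
  exact_mod_cast hle

namespace IsIntegralPosDefForm

variable {n : ℕ} {M : Matrix (Fin n) (Fin n) ℚ} {A : Matrix (Fin n) (Fin n) ℤ}

theorem exists_map_intCast_eq_two_smul (hM : IsIntegralPosDefForm M) :
    ∃ A : Matrix (Fin n) (Fin n) ℤ, A.map (Int.cast : ℤ → ℚ) = (2 : ℚ) • M := by
  choose A hA using hM.2.2.1
  refine ⟨Matrix.of A, ?_⟩
  ext i j
  exact (hA i j).symm

theorem isSymm_of_map_eq (hM : IsIntegralPosDefForm M)
    (hA : A.map (Int.cast : ℤ → ℚ) = (2 : ℚ) • M) : A.IsSymm := by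
  ext i j
  have h1 := congrFun (congrFun hA i) j
  have h2 := congrFun (congrFun hA j) i
  have h3 := hM.1.apply i j
  simp only [map_apply, Matrix.smul_apply] at h1 h2
  rw [transpose_apply]
  rw [h3, ← h1] at h2
  exact_mod_cast h2

theorem toBilin'_map_pos (hM : IsIntegralPosDefForm M)
    (hA : A.map (Int.cast : ℤ → ℚ) = (2 : ℚ) • M) {v : Fin n → ℚ} (hv : v ≠ 0) :
    0 < toBilin' (A.map (Int.cast : ℤ → ℚ)) v v := by
  rw [hA, toBilin'_apply', smul_mulVec, dotProduct_smul]
  exact mul_pos two_pos (hM.2.2.2 v hv)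

theorem toBilin'_pos (hM : IsIntegralPosDefForm M)
    (hA : A.map (Int.cast : ℤ → ℚ) = (2 : ℚ) • M) {v : Fin n → ℤ} (hv : v ≠ 0) :
    0 < toBilin' A v v := by
  have h := hM.toBilin'_map_pos hA (v := fun l => (v l : ℚ)) fun h => hv <| by
    ext l
    simpa using congrFun h l
  rw [toBilin'_map_intCast] at h
  exact_mod_cast h

theorem det_ne_zero_of_map_eq (hM : IsIntegralPosDefForm M)
    (hA : A.map (Int.cast : ℤ → ℚ) = (2 : ℚ) • M) : A.det ≠ 0 := by
  intro h0
  have h1 : (A.map (Int.cast : ℤ → ℚ)).det = 0 := by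
    rw [← Int.cast_det, h0, Int.cast_zero]
  obtain ⟨v, hv, hv0⟩ := exists_mulVec_eq_zero_iff.2 h1
  have h2 := hM.toBilin'_map_pos hA hv
  rw [toBilin'_apply', hv0, dotProduct_zero] at h2
  exact h2.false

end IsIntegralPosDefForm

theorem minor_pos_of_toBilin'_pos {A : Matrix (Fin 3) (Fin 3) ℤ} (hA : A.IsSymm)
    (hpos : ∀ v : Fin 3 → ℤ, v ≠ 0 → 0 < toBilin' A v v) :
    0 < A 0 0 * A 1 1 - A 0 1 ^ 2 := by
  have h00 : 0 < A 0 0 := by simpa [toBilin'_single] using hpos (Pi.single 0 1) (by simp)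
  have h := hpos ![A 0 1, -A 0 0, 0] fun h => h00.ne' <| by simpa using congrFun h 1
  have heq : toBilin' A ![A 0 1, -A 0 0, 0] ![A 0 1, -A 0 0, 0] =
      A 0 0 * (A 0 0 * A 1 1 - A 0 1 ^ 2) := by
    simp [toBilin'_apply', mulVec, dotProduct, Fin.sum_univ_three, hA.apply 0 1]
    ring
  rw [heq] at h
  exact pos_of_mul_pos_right h h00.le

theorem det_pos_of_toBilin'_pos {A : Matrix (Fin 3) (Fin 3) ℤ} (hA : A.IsSymm)
    (hpos : ∀ v : Fin 3 → ℤ, v ≠ 0 → 0 < toBilin' A v v) : 0 < A.det := by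
  have hm := minor_pos_of_toBilin'_pos hA hpos
  set w : Fin 3 → ℤ := ![A 0 1 * A 1 2 - A 0 2 * A 1 1, A 0 1 * A 0 2 - A 0 0 * A 1 2,
    A 0 0 * A 1 1 - A 0 1 ^ 2] with hw
  have h := hpos w fun h => hm.ne' <| by simpa [hw] using congrFun h 2
  have heq : toBilin' A w w = A.det * (A 0 0 * A 1 1 - A 0 1 ^ 2) := by
    simp only [hw, toBilin'_apply', mulVec, dotProduct, Fin.sum_univ_three, det_fin_three,
      hA.apply 0 1, hA.apply 0 2, hA.apply 1 2, cons_val]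
    ring
  rw [heq] at h
  exact pos_of_mul_pos_left h hm.le

theorem sq_dvd_toBilin'_of_mem_divLattice {m n : ℕ} {A : Matrix (Fin m) (Fin m) ℤ}
    {X : Matrix (Fin m) (Fin n) ℤ} {D : ℤ} {u u' : Fin n → ℤ} (hu : u ∈ divLattice D X)
    (hu' : u' ∈ divLattice D X) : D ^ 2 ∣ toBilin' (Xᵀ * A * X) u u' := by
  obtain ⟨y, hy⟩ := hu
  obtain ⟨y', hy'⟩ := hu'
  refine ⟨y ⬝ᵥ A *ᵥ y', ?_⟩
  rw [toBilin'_apply', ← mulVec_mulVec, ← mulVec_mulVec, dotProduct_mulVec, vecMul_transpose, hy,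
    hy', mulVec_smul, smul_dotProduct, dotProduct_smul, smul_eq_mul, smul_eq_mul]
  ring

theorem card_representations_le {A : Matrix (Fin 4) (Fin 4) ℤ} (hA : A.IsSymm) (hAdet : A.det ≠ 0)
    (O : Finset (Matrix (Fin 4) (Fin 4) ℤ))
    (hO : ∀ h : Matrix (Fin 4) (Fin 4) ℤ, hᵀ * A * h = A → h ∈ O)
    {M : Matrix (Fin 3) (Fin 3) ℚ} (hM : IsIntegralPosDefForm M) {B : Matrix (Fin 3) (Fin 3) ℤ}
    (hB : B.map (Int.cast : ℤ → ℚ) = (2 : ℚ) • M) (F : Finset (Matrix (Fin 4) (Fin 3) ℤ))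
    (hF : ∀ X ∈ F, Xᵀ * A * X = B) :
    F.card ≤ O.card * (2 * A.det.natAbs ^ 2) * (A.det.natAbs ^ 2) ^ 3 *
      B.det.natAbs.divisors.card ^ 29 *
      ∏ p ∈ B.det.natAbs.primeFactors, p ^ (kSum M 1 p / 2) * p ^ (kSum M 2 p / 2) := by
  classical
  have hBsymm := hM.isSymm_of_map_eq hB
  have hBpos := fun v => hM.toBilin'_pos hB (v := v)
  have hBdet := det_pos_of_toBilin'_pos hBsymm hBpos
  have hn : B.det = B.det.natAbs := (Int.natAbs_of_nonneg hBdet.le).symm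
  have hfiber := Finset.card_le_mul_card_image (f := divLattice B.det) F _ fun N _ =>
    card_representations_divLattice_le hA hAdet O hO (Int.natAbs_pos.2 hBdet.ne') hn N
      (F.filter fun X => divLattice B.det X = N) fun X hX => by
        rw [Finset.mem_filter] at hX
        exact ⟨hF X hX.1, hn ▸ hX.2⟩
  have himage := card_integral_overlattices_le hBsymm (fun v => hM.toBilin'_map_pos hB) hBdet.ne'
    (F.image (divLattice B.det))
    (fun N hN w => by
      obtain ⟨X, -, rfl⟩ := Finset.mem_image.1 hN
      exact smul_mem_divLattice _ _ _)
    (fun N hN u hu u' hu' => by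
      obtain ⟨X, hX, rfl⟩ := Finset.mem_image.1 hN
      have h := sq_dvd_toBilin'_of_mem_divLattice (A := A) hu hu'
      rwa [hF X hX] at h)
    (fun p _ => exists_padicValInt_eq_kSum_one hB hBpos 0 p)
    (fun p _ => exists_padicValInt_eq_kSum_two hB hBsymm
      (minor_pos_of_toBilin'_pos hBsymm hBpos).ne' p)
  refine (hfiber.trans (Nat.mul_le_mul_left _ himage)).trans_eq ?_
  ring

theorem mul_gram_eq_of_map_eq {m n : ℕ} {M : Matrix (Fin m) (Fin m) ℚ}
    {N : Matrix (Fin n) (Fin n) ℚ} {A : Matrix (Fin m) (Fin m) ℤ} {B : Matrix (Fin n) (Fin n) ℤ}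
    (hA : A.map (Int.cast : ℤ → ℚ) = (2 : ℚ) • M) (hB : B.map (Int.cast : ℤ → ℚ) = (2 : ℚ) • N)
    {X : Matrix (Fin m) (Fin n) ℤ}
    (hX : (X.map (Int.cast : ℤ → ℚ))ᵀ * M * X.map (Int.cast : ℤ → ℚ) = N) :
    Xᵀ * A * X = B := by
  have hinj : Function.Injective fun Y : Matrix (Fin n) (Fin n) ℤ => Y.map (Int.castRingHom ℚ) :=
    Matrix.map_injective Int.cast_injective
  apply hinj
  have hA' : A.map (Int.castRingHom ℚ) = (2 : ℚ) • M := hA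
  have hB' : B.map (Int.castRingHom ℚ) = (2 : ℚ) • N := hB
  have hX' : (X.map (Int.castRingHom ℚ))ᵀ * M * X.map (Int.castRingHom ℚ) = N := hX
  simp only [Matrix.map_mul, transpose_map, hA', hB']
  rw [← hX', Matrix.mul_smul, Matrix.smul_mul]

/-- codimension 1: rank 3 in rank 4.  Fix a positive definite integral
quaternary form `Q`.  For every `ε > 0` there is a constant `C = C(Q, ε)` such that for
every positive definite integral ternary form `q`, the number of representations of `q` by
`Q` is at most `C·m_1(q)·m_2'(q)·disc(q)^ε`. -/
theorem representation_count_codim_one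
    (MQ : Matrix (Fin 4) (Fin 4) ℚ) (hQ : IsIntegralPosDefForm MQ)
    (ε : ℝ) (hε : 0 < ε) :
    ∃ Cst : ℝ, ∀ Mq : Matrix (Fin 3) (Fin 3) ℚ, IsIntegralPosDefForm Mq →
      ∀ (m1 m2 : ℚ) (m2' : ℕ), IsM1M2M2' Mq m1 m2 m2' →
        (({X : Matrix (Fin 4) (Fin 3) ℤ |
              (X.map (Int.cast : ℤ → ℚ))ᵀ * MQ * X.map (Int.cast : ℤ → ℚ) = Mq}).ncard : ℝ)
          ≤ Cst * (m1 : ℝ) * (m2' : ℝ) * ((Mq.det : ℝ) ^ ε) := by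
  obtain ⟨A, hA⟩ := hQ.exists_map_intCast_eq_two_smul
  have hAsymm := hQ.isSymm_of_map_eq hA
  have hAdet := hQ.det_ne_zero_of_map_eq hA
  have hfin := fun {m : ℕ} => finite_setOf_gram_eq (m := m) hAsymm (fun v hv => by
    simpa only [toBilin'_apply'] using hQ.toBilin'_pos hA hv) hAdet
  obtain ⟨C, hC0, hC⟩ := exists_card_divisors_le_rpow (ε := ε / 29) (by positivity)
  set K := (hfin A).toFinset.card * (2 * A.det.natAbs ^ 2) * (A.det.natAbs ^ 2) ^ 3
  refine ⟨K * C ^ 29 * 8 ^ ε, fun Mq hq m1 m2 m2' hm => ?_⟩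
  obtain ⟨B, hB⟩ := hq.exists_map_intCast_eq_two_smul
  have hBdet := det_pos_of_toBilin'_pos (hq.isSymm_of_map_eq hB) fun v => hq.toBilin'_pos hB
  have hcount : ({X : Matrix (Fin 4) (Fin 3) ℤ |
      (X.map (Int.cast : ℤ → ℚ))ᵀ * MQ * X.map (Int.cast : ℤ → ℚ) = Mq}).ncard ≤
      (hfin B).toFinset.card := by
    rw [← Set.ncard_eq_toFinset_card _ (hfin B)]
    exact Set.ncard_le_ncard (fun X hX => mul_gram_eq_of_map_eq hA hB hX) (hfin B)
  have hcard := hcount.trans (card_representations_le hAsymm hAdet (hfin A).toFinset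
    (fun h hh => (hfin A).mem_toFinset.2 hh) hq hB (hfin B).toFinset
    fun X hX => (hfin B).mem_toFinset.1 hX)
  have hprod := prod_pow_half_kSum_le hm (P := B.det.natAbs.primeFactors)
    fun p hp => Nat.prime_of_mem_primeFactors hp
  set n := B.det.natAbs with hn
  have hdet : (n : ℝ) = 8 * (Mq.det : ℝ) := by
    have h1 : (B.det : ℚ) = 8 * Mq.det := by
      rw [Int.cast_det, hB, det_smul, Fintype.card_fin]
      norm_num
    rw [hn, Nat.cast_natAbs, abs_of_pos hBdet]
    have h2 := congrArg (Rat.cast : ℚ → ℝ) h1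
    rw [Rat.cast_mul, Rat.cast_intCast] at h2
    simpa only [Rat.cast_ofNat] using h2
  have hdet0 : 0 ≤ (Mq.det : ℝ) := by
    have := n.cast_nonneg (α := ℝ)
    linarith
  have hdiv : (n.divisors.card : ℝ) ^ 29 ≤ C ^ 29 * (8 ^ ε * (Mq.det : ℝ) ^ ε) := by
    calc (n.divisors.card : ℝ) ^ 29 ≤ (C * (n : ℝ) ^ (ε / 29)) ^ 29 := by
          gcongr
          exact hC n (Int.natAbs_ne_zero.2 hBdet.ne')
      _ = C ^ 29 * (8 ^ ε * (Mq.det : ℝ) ^ ε) := by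
          rw [mul_pow, ← Real.rpow_natCast ((n : ℝ) ^ (ε / 29)), ← Real.rpow_mul n.cast_nonneg,
            ← Real.mul_rpow (by norm_num) hdet0, hdet]
          norm_num
  have hprod' : ((∏ p ∈ n.primeFactors, p ^ (kSum Mq 1 p / 2) * p ^ (kSum Mq 2 p / 2) : ℕ) : ℝ) ≤
      m1 * m2' := by exact_mod_cast hprod
  calc _ ≤ ((K * n.divisors.card ^ 29 *
        ∏ p ∈ n.primeFactors, p ^ (kSum Mq 1 p / 2) * p ^ (kSum Mq 2 p / 2) : ℕ) : ℝ) := by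
        exact_mod_cast hcard
    _ = K * (n.divisors.card : ℝ) ^ 29 *
        ((∏ p ∈ n.primeFactors, p ^ (kSum Mq 1 p / 2) * p ^ (kSum Mq 2 p / 2) : ℕ) : ℝ) := by
        push_cast; ring
    _ ≤ K * (C ^ 29 * (8 ^ ε * (Mq.det : ℝ) ^ ε)) * (m1 * m2') := by gcongr
    _ = _ := by ring
end
end

section
/- Let p be an odd prime, n ≥ 2, let b_1,…,b_n ∈ ℤ_p^× and integers 0 ≤ l_1 ≤ … ≤ l_n, and consider the quadratic form Q(y) = Σ_{i=1}^n b_i·p^{l_i}·y_i² on ℤ_p^n, with bilinear form ⟨y,z⟩ = Σ_i b_i·p^{l_i}·y_i·z_i. Let k > 0 be an integer, a ∈ ℤ_p^×, and let x ∈ ℤ_p^n be nonzero with Q(x) = a·p^k; set ν_i = ord_p(x_i) ∈ ℤ_{≥0} ∪ {∞}. Let Λ = { y ∈ ℤ_p^n : ⟨y,x⟩ = 0 }, a free ℤ_p-module of rank n−1, and let disc(Λ) be the determinant of the Gram matrix (⟨u_i,u_j⟩) of any ℤ_p-basis u_1,…,u_{n−1} of Λ. Then ord_p(disc(Λ)) =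 (k − 2·min_i (l_i + ν_i)) + Σ_{i=1}^n l_i. -/
open Matrix

/-- Let `w` be a linear functional with `w ⬝ᵥ z = 1` whose kernel is spanned by the family `u`.
If `x` is orthogonal to `u` for the diagonal form with entries `d`, then the Gram determinant
of `u` times the norm of `x` is `(w ⬝ᵥ x) ^ 2 * ∏ i, d i` up to a unit. -/
theorem det_gram_mul_norm_eq {R ι κ : Type*} [CommRing R] [Fintype ι] [DecidableEq ι]
    [Fintype κ] [DecidableEq κ] (e : κ ⊕ Unit ≃ ι) (d w x z : ι → R) (u : κ → ι → R)
    (hz : w ⬝ᵥ z = 1) (hspan : ∀ y, w ⬝ᵥ y = 0 → ∃ c : κ → R, y = ∑ j, c j • u j)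
    (hux : ∀ j, ∑ i, d i * u j i * x i = 0) :
    ∃ v : R, IsUnit v ∧
      (Matrix.of fun j j' => ∑ i, d i * u j i * u j' i).det * ∑ i, d i * x i ^ 2
        = v * (w ⬝ᵥ x) ^ 2 * ∏ i, d i := by
  have hdec : ∀ y, ∃ c : κ → R, y = ∑ j, c j • u j + (w ⬝ᵥ y) • z := by
    intro y
    obtain ⟨c, hc⟩ := hspan (y - (w ⬝ᵥ y) • z) (by simp [dotProduct_sub, hz])
    exact ⟨c, by rw [← hc]; simp⟩
  choose c hc using hdec
  set M : Matrix (κ ⊕ Unit) (κ ⊕ Unit) R :=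
    Matrix.of fun r s => Sum.elim u (fun _ => z) r (e s) with hM
  set N : Matrix (κ ⊕ Unit) (κ ⊕ Unit) R :=
    Matrix.of fun r s => Sum.elim u (fun _ => x) r (e s) with hN
  have hMdet : IsUnit M.det := by
    let C : Matrix (κ ⊕ Unit) (κ ⊕ Unit) R := Matrix.of fun r s =>
      Sum.elim (c (Pi.single (e r) 1)) (fun _ => w ⬝ᵥ Pi.single (e r) 1) s
    have hCM : C * M = 1 := by
      ext r s
      have h := congrFun (hc (Pi.single (e r) 1)) (e s)
      simp only [Matrix.mul_apply, Fintype.sum_sum_type, C, hM, Matrix.of_apply, Sum.elim_inl,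
        Sum.elim_inr, Finset.univ_unique, Finset.sum_singleton]
      simp only [Pi.add_apply, Finset.sum_apply, Pi.smul_apply, smul_eq_mul] at h
      rw [← h, Matrix.one_apply, Pi.single_apply]
      simp [eq_comm]
    exact IsUnit.of_mul_eq_one_right C.det (by rw [← Matrix.det_mul, hCM, Matrix.det_one])
  have hNM : N = Matrix.fromBlocks 1 0 (Matrix.of fun _ j => c x j)
      (Matrix.of fun _ _ => w ⬝ᵥ x) * M := by
    ext r s
    rcases r with r | r
    · simp [Matrix.mul_apply, Fintype.sum_sum_type, hM, hN, Matrix.one_apply]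
    · have h := congrFun (hc x) (e s)
      simp only [Pi.add_apply, Finset.sum_apply, Pi.smul_apply, smul_eq_mul] at h
      simpa [Matrix.mul_apply, Fintype.sum_sum_type, hM, hN] using h
  have hNdet : N.det = (w ⬝ᵥ x) * M.det := by
    rw [hNM, Matrix.det_mul, Matrix.det_fromBlocks_zero₁₂]
    simp
  have hgram : N * Matrix.diagonal (d ∘ e) * Nᵀ = Matrix.fromBlocks
      (Matrix.of fun j j' => ∑ i, d i * u j i * u j' i) 0 0
      (Matrix.of fun _ _ => ∑ i, d i * x i ^ 2) := by
    ext r s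
    have hrs : (N * Matrix.diagonal (d ∘ e) * Nᵀ) r s = ∑ i, d i *
        Sum.elim u (fun _ => x) r i * Sum.elim u (fun _ => x) s i := by
      rw [Matrix.mul_apply, ← e.sum_comp]
      refine Finset.sum_congr rfl fun i _ => ?_
      simp only [Matrix.mul_diagonal, Matrix.transpose_apply, hN, Matrix.of_apply,
        Function.comp_apply]
      ring
    rw [hrs]
    rcases r with r | r <;> rcases s with s | s
    · simp
    · simpa using hux r
    · simpa [mul_right_comm] using hux s
    · simp [pow_two, mul_assoc]
  have hdet := congrArg Matrix.det hgram
  rw [Matrix.det_mul, Matrix.det_mul, Matrix.det_transpose, Matrix.det_diagonal, hNdet,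
    Matrix.det_fromBlocks_zero₁₂] at hdet
  refine ⟨M.det ^ 2, hMdet.pow 2, ?_⟩
  have hprod : ∏ i, (d ∘ e) i = ∏ i, d i := e.prod_comp d
  rw [hprod] at hdet
  simp only [Matrix.det_unique, Matrix.of_apply] at hdet
  rw [← hdet]
  ring

/-- Units of `ℤ_[p]` have valuation zero. -/
theorem PadicInt.valuation_eq_zero_of_isUnit {p : ℕ} [Fact p.Prime] {v : ℤ_[p]}
    (hv : IsUnit v) : v.valuation = 0 := by
  have h := PadicInt.norm_eq_zpow_neg_valuation hv.ne_zero
  rw [PadicInt.isUnit_iff.mp hv] at h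
  have hp : (1 : ℝ) < p := mod_cast (Fact.out : p.Prime).one_lt
  have h0 := (zpow_eq_one_iff_right₀ (by positivity) hp.ne').mp h.symm
  omega



/-- Let `p` be an odd prime, `n ≥ 2`, `b_i ∈ ℤ_p^×`,
`0 ≤ l_1 ≤ ⋯ ≤ l_n`, and consider `Q(y) = Σ b_i·p^{l_i}·y_i²` on `ℤ_p^n` with bilinear
form `⟨y,z⟩ = Σ b_i·p^{l_i}·y_i·z_i`.  Let `k > 0`, `a ∈ ℤ_p^×`, and let `x ∈ ℤ_p^n` be
nonzero with `Q(x) = a·p^k`; put `ν_i = ord_p(x_i)` and `m = min_i (l_i + ν_i)`.  If `u`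
is a `ℤ_p`-basis of the orthogonal complement `Λ = {y : ⟨y,x⟩ = 0}` (a free module of
rank `n − 1`), then `ord_p(disc Λ) = (k − 2·m) + Σ_i l_i`, where `disc Λ` is the
determinant of the Gram matrix of `u`. -/
theorem ord_disc_orthocomplement_padic (p : ℕ) [hp : Fact p.Prime] (hp2 : p ≠ 2)
    (n : ℕ) (hn : 2 ≤ n) (b : Fin n → ℤ_[p]) (hb : ∀ i, IsUnit (b i))
    (l : Fin n → ℕ) (hl : Monotone l)
    (k : ℕ) (hk : 0 < k) (a : ℤ_[p]) (ha : IsUnit a)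
    (x : Fin n → ℤ_[p]) (hx : x ≠ 0)
    (hQx : ∑ i, b i * (p : ℤ_[p]) ^ l i * x i ^ 2 = a * (p : ℤ_[p]) ^ k)
    -- `m = min_i (l_i + ν_i)` where `ν_i = ord_p (x_i)` (with `ν_i = ∞` if `x_i = 0`)
    (m : ℤ)
    (hm1 : ∀ i, x i ≠ 0 → m ≤ (l i : ℤ) + (x i).valuation)
    (hm2 : ∃ i, x i ≠ 0 ∧ m = (l i : ℤ) + (x i).valuation)
    -- `u` is a `ℤ_p`-basis of `Λ = {y : ⟨y,x⟩ = 0}`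
    (u : Fin (n - 1) → Fin n → ℤ_[p])
    (hu_mem : ∀ a', ∑ i, b i * (p : ℤ_[p]) ^ l i * u a' i * x i = 0)
    (hu_li : LinearIndependent ℤ_[p] u)
    (hu_span : ∀ y : Fin n → ℤ_[p], (∑ i, b i * (p : ℤ_[p]) ^ l i * y i * x i = 0) →
      ∃ c : Fin (n - 1) → ℤ_[p], y = ∑ a', c a' • u a') :
    ((Matrix.of fun a' b' => ∑ i, b i * (p : ℤ_[p]) ^ l i * u a' i * u b' i).det).valuation
      = ((k : ℤ) - 2 * m) + ∑ i, (l i : ℤ) := by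
  obtain ⟨r, rfl⟩ : ∃ r, n = r + 1 := ⟨n - 1, by omega⟩
  have hp0 : (p : ℤ_[p]) ≠ 0 := PadicInt.prime_p.ne_zero
  obtain ⟨j, hxj, hmj⟩ := hm2
  lift m to ℕ using by omega
  have hdvd : ∀ i, ∃ q, b i * (p : ℤ_[p]) ^ l i * x i = (p : ℤ_[p]) ^ m * q := by
    intro i
    by_cases hxi : x i = 0
    · exact ⟨0, by simp [hxi]⟩
    · have hi : m ≤ l i + (x i).valuation := by exact_mod_cast hm1 i hxi
      have hpow : (p : ℤ_[p]) ^ m ∣ b i * (p : ℤ_[p]) ^ l i * x i := by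
        rw [PadicInt.unitCoeff_spec hxi]
        refine (pow_dvd_pow _ hi).trans
          (Dvd.intro_left (b i * (PadicInt.unitCoeff hxi : ℤ_[p])) ?_)
        ring
      exact hpow
  choose w hw using hdvd
  have hpm : (p : ℤ_[p]) ^ m ≠ 0 := pow_ne_zero _ hp0
  have hwj : IsUnit (w j) := by
    have hj : m = l j + (x j).valuation := by exact_mod_cast hmj
    have h : w j = b j * (PadicInt.unitCoeff hxj : ℤ_[p]) := by
      refine mul_left_cancel₀ hpm ?_
      rw [← hw j, hj]
      conv_lhs => rw [PadicInt.unitCoeff_spec hxj]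
      ring
    rw [h]
    exact (hb j).mul (Units.isUnit _)
  obtain ⟨s, hs⟩ := hwj.exists_right_inv
  have hpw : ∀ y : Fin (r + 1) → ℤ_[p],
      ∑ i, b i * (p : ℤ_[p]) ^ l i * y i * x i = (p : ℤ_[p]) ^ m * (w ⬝ᵥ y) := by
    intro y
    rw [dotProduct, Finset.mul_sum]
    refine Finset.sum_congr rfl fun i _ => ?_
    rw [← mul_assoc, ← hw i]
    ring
  obtain ⟨v, hv, hdet⟩ := det_gram_mul_norm_eq
    ((Equiv.optionEquivSumPUnit (Fin r)).symm.trans (finSuccEquiv r).symm)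
    (fun i => b i * (p : ℤ_[p]) ^ l i) w x (Pi.single j s) u (by simp [hs])
    (fun y hy => hu_span y (by rw [hpw, hy, mul_zero])) hu_mem
  have hwx : (p : ℤ_[p]) ^ m * (w ⬝ᵥ x) = a * (p : ℤ_[p]) ^ k := by
    rw [← hpw, ← hQx]
    exact Finset.sum_congr rfl fun i _ => by ring
  have hak : a * (p : ℤ_[p]) ^ k ≠ 0 := mul_ne_zero ha.ne_zero (pow_ne_zero _ hp0)
  have hwx0 : w ⬝ᵥ x ≠ 0 := right_ne_zero_of_mul (hwx ▸ hak)
  have hprod : ∏ i, b i * (p : ℤ_[p]) ^ l i = (∏ i, b i) * (p : ℤ_[p]) ^ ∑ i, l i := by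
    rw [Finset.prod_mul_distrib, Finset.prod_pow_eq_pow_sum]
  have hbu : IsUnit (∏ i, b i) := by simpa [IsUnit.prod_univ_iff] using hb
  rw [hQx, hprod] at hdet
  have hrhs : v * (w ⬝ᵥ x) ^ 2 * ((∏ i, b i) * (p : ℤ_[p]) ^ ∑ i, l i) ≠ 0 :=
    mul_ne_zero (mul_ne_zero hv.ne_zero (pow_ne_zero _ hwx0))
      (mul_ne_zero hbu.ne_zero (pow_ne_zero _ hp0))
  have hG := left_ne_zero_of_mul (hdet ▸ hrhs)
  have hval := congrArg PadicInt.valuation hdet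
  have hvalx := congrArg PadicInt.valuation hwx
  rw [PadicInt.valuation_mul hG hak, PadicInt.valuation_mul ha.ne_zero (pow_ne_zero _ hp0),
    PadicInt.valuation_mul (mul_ne_zero hv.ne_zero (pow_ne_zero _ hwx0))
      (mul_ne_zero hbu.ne_zero (pow_ne_zero _ hp0)),
    PadicInt.valuation_mul hv.ne_zero (pow_ne_zero _ hwx0),
    PadicInt.valuation_mul hbu.ne_zero (pow_ne_zero _ hp0)] at hval
  rw [PadicInt.valuation_mul hpm hwx0,
    PadicInt.valuation_mul ha.ne_zero (pow_ne_zero _ hp0)] at hvalx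
  simp only [PadicInt.valuation_pow, PadicInt.valuation_p,
    PadicInt.valuation_eq_zero_of_isUnit ha, PadicInt.valuation_eq_zero_of_isUnit hv,
    PadicInt.valuation_eq_zero_of_isUnit hbu] at hval hvalx
  rw [← Nat.cast_sum]
  have hsolve : ∀ g t s : ℕ, g + (0 + k * 1) = 0 + 2 * t + (0 + s * 1) →
      m * 1 + t = 0 + k * 1 → (g : ℤ) = (k : ℤ) - 2 * m + (s : ℤ) := by
    intro g t s h₁ h₂
    omega
  exact hsolve _ _ _ (by simpa using hval) (by simpa using hvalx)
end
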